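/- A degenerate Kundt metric ds² = 2 du [dr + H du + W_α dx^α] + g_{αβ}(u,x) dx^α dx^β with W_α = r W_α^{(1)} + W_α^{(0)} and H = r² H^{(2)} + r H^{(1)} + H^{(0)}, together with an aligned VSI Maxwell p-form F, solves the Einstein–Maxwell equations with cosmological constant Λ if and only if F satisfies the transverse Maxwell equations f_{[α₂…α_{p−1},α₁]} = 0, (√(g̃) f^{β α₁…α_{p−2}})_{,β} = 0, and the metric functions satisfy: (i) R_{αβ} = (2Λ/(n−2)) g_{αβ} + ½ W_α^{(1)} W_β^{(1)} − W^{(1)}_{(α||β)}; (ii) 2H^{(2)} = R/2 − ((n−4)/(n−2))Λ + ¼ W^{(1)α} W_α^{(1)}; (iii) the stated quasilinear equation for W_α^{(1)}; (iv) the stated equation expressing 2H^{(1)}_{,α} in terms of W^{(0)}, W^{(1)}, g_{αβ,u}; and (v) the stated Poisson-type equation for H^{(0)} whose source includes the term −κ₀ F², quadratic in the electromagnetic field. -/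

import Mathlib

open scoped BigOperators

noncomputable section

namespace VSI

/-! ### Basic setup: tensor fields on an `n`-dimensional coordinate chart -/

/-- A point of an `n`-dimensional coordinate chart. -/
abbrev Pt (n : ℕ) := Fin n → ℝ

/-- A covariant tensor field of rank `k`, given by its components. -/
abbrev TensorField (n k : ℕ) := Pt n → (Fin k → Fin n) → ℝ

/-- A vector field, given by its components. -/
abbrev VecField (n : ℕ) := Pt n → Fin n → ℝ

/-- A field of `n × n` matrices (e.g. a metric). -/
abbrev MetricField (n : ℕ) := Pt n → Matrix (Fin n) (Fin n) ℝ

/-- Partial derivative of a scalar function along the `a`-th coordinate. -/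
def pd {n : ℕ} (f : Pt n → ℝ) (a : Fin n) (x : Pt n) : ℝ :=
  fderiv ℝ f x (Pi.single a 1)

/-- Partial derivative masked to the transverse directions (coordinates `≥ 2`). -/
def pdT {n : ℕ} (f : Pt n → ℝ) (a : Fin n) (x : Pt n) : ℝ :=
  if 2 ≤ (a : ℕ) then pd f a x else 0

/-- A function on the chart is independent of the coordinate `r` (coordinate number 1). -/
def IndepOfR {n : ℕ} {α : Type*} (f : Pt n → α) : Prop :=
  ∀ x x' : Pt n, (∀ i : Fin n, (i : ℕ) ≠ 1 → x i = x' i) → f x = f x'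

/-- A smooth symmetric metric of Lorentzian signature `(-,+,…,+)`. -/
def IsLorentzMetric {n : ℕ} (g : MetricField n) : Prop :=
  (∀ a b, ContDiff ℝ (⊤ : ℕ∞) fun x => g x a b) ∧ (∀ x, (g x).IsSymm) ∧
  (∀ x, ∃ P : Matrix (Fin n) (Fin n) ℝ, IsUnit P.det ∧
    P.transpose * g x * P = Matrix.diagonal fun i : Fin n => if (i : ℕ) = 0 then (-1 : ℝ) else 1)

/-- Metric pairing of two vectors at a point. -/
def gdot {n : ℕ} (g : MetricField n) (x : Pt n) (X Y : Fin n → ℝ) : ℝ :=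
  ∑ a, ∑ b, g x a b * X a * Y b

/-- Index lowering of a vector field. -/
def lower {n : ℕ} (g : MetricField n) (ℓ : VecField n) (x : Pt n) (a : Fin n) : ℝ :=
  ∑ b, g x a b * ℓ x b

/-- The 1-form (rank-1 covariant tensor field) associated with a vector field. -/
def lowerField {n : ℕ} (g : MetricField n) (ℓ : VecField n) : TensorField n 1 :=
  fun x idx => lower g ℓ x (idx 0)

/-- Christoffel symbols `Γ^a_{bc}` of the Levi-Civita connection of `g`. -/
def christoffel {n : ℕ} (g : MetricField n) (x : Pt n) (a b c : Fin n) : ℝ :=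
  (1/2) * ∑ d, (g x)⁻¹ a d *
    (pd (fun y => g y d c) b x + pd (fun y => g y b d) c x - pd (fun y => g y b c) d x)

/-- Covariant derivative of a covariant tensor field; the new (derivative) index is
the first index of the result. -/
def covD {n k : ℕ} (g : MetricField n) (T : TensorField n k) : TensorField n (k+1) :=
  fun x idx =>
    pd (fun y => T y fun m => idx m.succ) (idx 0) x
    - ∑ m : Fin k, ∑ e : Fin n,
        christoffel g x e (idx 0) (idx m.succ) * T x (Function.update (fun m' => idx m'.succ) m e)

/-- Iterated covariant derivative. -/
def covDIter {n k : ℕ} (g : MetricField n) (T : TensorField n k) : (I : ℕ) → TensorField n (k + I)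
  | 0 => T
  | I + 1 => covD g (covDIter g T I)

/-! ### Scalar polynomial invariants and tensor concomitants -/

/-- A scheme describing a polynomial concomitant of a rank-`k` tensor field: a full
metric contraction of a tensor product of covariant derivatives (of orders `ord j`)
of the field, with `r` free indices left over.  `m` is the number of contracted
index pairs; `slots` enumerates all index slots of the tensor product. -/
structure ConcomScheme (k r : ℕ) where
  N : ℕ
  hN : 0 < N
  ord : Fin N → ℕ
  m : ℕ
  slots : ((Fin m × Bool) ⊕ Fin r) ≃ (Σ j : Fin N, Fin (k + ord j))

/-- The value of a concomitant scheme: all contracted index pairs are contracted with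
the inverse metric. -/
def ConcomScheme.value {k r : ℕ} (S : ConcomScheme k r) {n : ℕ} (g : MetricField n)
    (T : TensorField n k) : TensorField n r := fun x free =>
  ∑ φ : Fin S.m × Bool → Fin n,
    (∏ i : Fin S.m, (g x)⁻¹ (φ (i, false)) (φ (i, true))) *
    ∏ j : Fin S.N, covDIter g T (S.ord j) x
      (fun s => Sum.elim φ free (S.slots.symm ⟨j, s⟩))

/-- All scalar polynomial invariants constructed from `T` and its covariant
derivatives up to order `I` vanish. -/
def IsVSIUpTo {n k : ℕ} (g : MetricField n) (T : TensorField n k) (I : ℕ) : Prop :=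
  ∀ S : ConcomScheme k 0, (∀ j, S.ord j ≤ I) → ∀ x v, S.value g T x v = 0

/-- All scalar polynomial invariants of arbitrary order vanish. -/
def IsVSI {n k : ℕ} (g : MetricField n) (T : TensorField n k) : Prop :=
  ∀ I : ℕ, IsVSIUpTo g T I

/-- All zeroth order scalar polynomial invariants of `T` vanish at the point `x`. -/
def IsVSI0At {n k : ℕ} (g : MetricField n) (T : TensorField n k) (x : Pt n) : Prop :=
  ∀ S : ConcomScheme k 0, (∀ j, S.ord j = 0) → ∀ v, S.value g T x v = 0

/-- A rank-`r` tensor field `G` is (polynomially) constructed from `T`, its covariant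
derivatives of arbitrary order and the metric. -/
def IsConstructedFrom {n k r : ℕ} (g : MetricField n) (T : TensorField n k)
    (G : TensorField n r) : Prop :=
  G ∈ Submodule.span ℝ {G' : TensorField n r | ∃ S : ConcomScheme k r, G' = S.value g T}

/-- A symmetric-2-tensor "correction" to the standard electromagnetic energy-momentum
tensor: constructed from `T` and its covariant derivatives, where each monomial either
contains at least three factors of the field or at least one covariant derivative
(i.e. it comes from a non-Maxwellian term of a generalized electrodynamics). -/
def IsCorrectionTensor {n k : ℕ} (g : MetricField n) (T : TensorField n k)
    (Tc : TensorField n 2) : Prop :=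
  Tc ∈ Submodule.span ℝ {G : TensorField n 2 |
    ∃ S : ConcomScheme k 2, (3 ≤ S.N ∨ ∃ j, 1 ≤ S.ord j) ∧ G = S.value g T}

/-! ### p-forms, type N, Lie derivative -/

def IsAlternating {n k : ℕ} (T : TensorField n k) : Prop :=
  ∀ (x : Pt n) (idx : Fin k → Fin n) (σ : Equiv.Perm (Fin k)),
    T x (idx ∘ σ) = ((Equiv.Perm.sign σ : ℤ) : ℝ) * T x idx

def IsSmoothT {n k : ℕ} (T : TensorField n k) : Prop :=
  ∀ idx, ContDiff ℝ (⊤ : ℕ∞) fun x => T x idx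

/-- A smooth differential form (totally antisymmetric covariant tensor field). -/
def IsFormField {n k : ℕ} (T : TensorField n k) : Prop :=
  IsSmoothT T ∧ IsAlternating T

def IsSmoothVec {n : ℕ} (ℓ : VecField n) : Prop :=
  ∀ a, ContDiff ℝ (⊤ : ℕ∞) fun x => ℓ x a

/-- A (nowhere vanishing, smooth) null vector field. -/
def IsNullField {n : ℕ} (g : MetricField n) (ℓ : VecField n) : Prop :=
  IsSmoothVec ℓ ∧ (∀ x, ℓ x ≠ 0) ∧ ∀ x, gdot g x (ℓ x) (ℓ x) = 0

/-- `ℓ^a F_{a b₁ … b_{p-1}} = 0`. -/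
def ContractsFirstZero {n p : ℕ} [NeZero p] (ℓ : VecField n) (F : TensorField n p) : Prop :=
  ∀ (x : Pt n) (v : Fin p → Fin n), (∑ a, ℓ x a * F x (Function.update v 0 a)) = 0

/-- `ℓ_{[a} F_{b₁ … b_p]} = 0`. -/
def WedgeWithZero {n p : ℕ} (g : MetricField n) (ℓ : VecField n) (F : TensorField n p) : Prop :=
  ∀ (x : Pt n) (idx : Fin (p+1) → Fin n),
    (∑ σ : Equiv.Perm (Fin (p+1)), ((Equiv.Perm.sign σ : ℤ) : ℝ) *
      (lower g ℓ x (idx (σ 0)) * F x (fun m => idx (σ m.succ)))) = 0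

/-- The `p`-form `F` is of type N with multiple null direction `ℓ`. -/
def IsTypeN {n p : ℕ} [NeZero p] (g : MetricField n) (F : TensorField n p)
    (ℓ : VecField n) : Prop :=
  IsNullField g ℓ ∧ ContractsFirstZero ℓ F ∧ WedgeWithZero g ℓ F

/-- Lie derivative of a covariant tensor field along a vector field. -/
def lieD {n k : ℕ} (ℓ : VecField n) (T : TensorField n k) : TensorField n k :=
  fun x idx =>
    (∑ a, ℓ x a * pd (fun y => T y idx) a x)
    + ∑ m : Fin k, ∑ a, pd (fun y => ℓ y a) (idx m) x * T x (Function.update idx m a)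

/-! ### Optical properties: geodesic, Kundt -/

/-- `∇_b ℓ_a` (first index is the derivative index). -/
def nablaLow {n : ℕ} (g : MetricField n) (ℓ : VecField n) (x : Pt n) (b a : Fin n) : ℝ :=
  covD g (lowerField g ℓ) x ![b, a]

/-- `ℓ` is geodesic: `ℓ^b ∇_b ℓ_a ∝ ℓ_a`. -/
def IsGeodesicField {n : ℕ} (g : MetricField n) (ℓ : VecField n) : Prop :=
  ∀ x, ∃ c : ℝ, ∀ a, (∑ b, ℓ x b * nablaLow g ℓ x b a) = c * lower g ℓ x a

/-- `ℓ` is affinely parameterized: `ℓ^b ∇_b ℓ_a = 0`. -/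
def IsAffinelyParam {n : ℕ} (g : MetricField n) (ℓ : VecField n) : Prop :=
  ∀ x a, (∑ b, ℓ x b * nablaLow g ℓ x b a) = 0

/-- `ℓ` is a Kundt null vector field: null, geodesic and with vanishing optical matrix
(expansion-free, shear-free and twist-free). -/
def IsKundt {n : ℕ} (g : MetricField n) (ℓ : VecField n) : Prop :=
  IsNullField g ℓ ∧ IsGeodesicField g ℓ ∧
  ∀ (x : Pt n) (X Y : Fin n → ℝ), gdot g x X (ℓ x) = 0 → gdot g x Y (ℓ x) = 0 →
    (∑ a, ∑ b, X a * Y b * nablaLow g ℓ x b a) = 0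

/-! ### Curvature -/

/-- Fully lowered Riemann tensor `R_{abcd}`. -/
def riemann {n : ℕ} (g : MetricField n) : TensorField n 4 := fun x idx =>
  ∑ e, g x (idx 0) e *
    (pd (fun y => christoffel g y e (idx 3) (idx 1)) (idx 2) x
     - pd (fun y => christoffel g y e (idx 2) (idx 1)) (idx 3) x
     + ∑ f', (christoffel g x e (idx 2) f' * christoffel g x f' (idx 3) (idx 1)
            - christoffel g x e (idx 3) f' * christoffel g x f' (idx 2) (idx 1)))

def ricci {n : ℕ} (g : MetricField n) (x : Pt n) (b d : Fin n) : ℝ :=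
  ∑ a, ∑ c, (g x)⁻¹ a c * riemann g x ![a, b, c, d]

def ricciScalar {n : ℕ} (g : MetricField n) (x : Pt n) : ℝ :=
  ∑ b, ∑ d, (g x)⁻¹ b d * ricci g x b d

def tracelessRicci {n : ℕ} (g : MetricField n) : TensorField n 2 := fun x idx =>
  ricci g x (idx 0) (idx 1) - ricciScalar g x / (n : ℝ) * g x (idx 0) (idx 1)

/-- Weyl tensor `C_{abcd}` (for `n ≥ 3`). -/
def weyl {n : ℕ} (g : MetricField n) : TensorField n 4 := fun x idx =>
  riemann g x idx
  - (1 / ((n : ℝ) - 2)) *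
      (g x (idx 0) (idx 2) * ricci g x (idx 3) (idx 1)
       - g x (idx 0) (idx 3) * ricci g x (idx 2) (idx 1)
       - g x (idx 1) (idx 2) * ricci g x (idx 3) (idx 0)
       + g x (idx 1) (idx 3) * ricci g x (idx 2) (idx 0))
  + (1 / (((n : ℝ) - 1) * ((n : ℝ) - 2))) * ricciScalar g x *
      (g x (idx 0) (idx 2) * g x (idx 3) (idx 1) - g x (idx 0) (idx 3) * g x (idx 2) (idx 1))

/-! ### Null frames, boost weights, algebraic types -/

/-- A null frame at a point: two null vectors `e 0 = ℓ`, `e 1 = n` with `ℓ·n = 1`, and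
orthonormal spacelike vectors `e i`, `i ≥ 2`, orthogonal to both. -/
structure NullFrameAt {n : ℕ} [NeZero n] (g : MetricField n) (x : Pt n) where
  e : Fin n → Fin n → ℝ
  h00 : gdot g x (e 0) (e 0) = 0
  h11 : gdot g x (e 1) (e 1) = 0
  h01 : gdot g x (e 0) (e 1) = 1
  h0i : ∀ i : Fin n, 2 ≤ (i : ℕ) → gdot g x (e 0) (e i) = 0
  h1i : ∀ i : Fin n, 2 ≤ (i : ℕ) → gdot g x (e 1) (e i) = 0
  hij : ∀ i j : Fin n, 2 ≤ (i : ℕ) → 2 ≤ (j : ℕ) →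
    gdot g x (e i) (e j) = (if i = j then 1 else 0)

/-- Boost weight of a frame multi-index: `+1` for each contraction with `ℓ = e 0`,
`-1` for each contraction with `n = e 1`. -/
def bw {n k : ℕ} (a : Fin k → Fin n) : ℤ :=
  ((Finset.univ.filter fun m => (a m : ℕ) = 0).card : ℤ)
  - ((Finset.univ.filter fun m => (a m : ℕ) = 1).card : ℤ)

/-- Frame components of a covariant tensor. -/
def frameComp {n k : ℕ} (T : TensorField n k) (e : Fin n → Fin n → ℝ) (x : Pt n)
    (a : Fin k → Fin n) : ℝ :=
  ∑ idx : Fin k → Fin n, T x idx * ∏ m, e (a m) (idx m)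

/-- The tensor field `T` has boost order at most `b` with respect to the null
direction `ℓ`: in any null frame containing `ℓ`, all frame components of boost
weight `> b` vanish.  `b = 0` is the aligned type II condition, `b = -1` type III. -/
def BoostOrderLE {n k : ℕ} [NeZero n] (g : MetricField n) (ℓ : VecField n)
    (T : TensorField n k) (b : ℤ) : Prop :=
  ∀ (x : Pt n) (fr : NullFrameAt g x), fr.e 0 = ℓ x →
    ∀ a : Fin k → Fin n, b < bw a → frameComp T fr.e x a = 0

/-- `g` is a degenerate Kundt metric with Kundt null direction `ℓ`: `ℓ` is Kundt and
the Riemann tensor together with its covariant derivatives of all orders is of aligned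
type II with respect to `ℓ`. -/
def IsDegenerateKundt {n : ℕ} [NeZero n] (g : MetricField n) (ℓ : VecField n) : Prop :=
  IsKundt g ℓ ∧ ∀ I : ℕ, BoostOrderLE g ℓ (covDIter g (riemann g) I) 0

/-! ### Exterior derivative, Hodge dual, Maxwell equations -/

/-- Exterior derivative (components, no normalization factor). -/
def extD {n k : ℕ} (F : TensorField n k) : TensorField n (k+1) := fun x idx =>
  ∑ m : Fin (k+1), (-1 : ℝ) ^ (m : ℕ) *
    pd (fun y => F y fun i => idx (m.succAbove i)) (idx m) x

/-- Sign of a self-map of `Fin k` (0 if not bijective). -/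
def permSign {k : ℕ} (f : Fin k → Fin k) : ℤ :=
  if h : Function.Bijective f then Equiv.Perm.sign (Equiv.ofBijective f h) else 0

/-- Raise all indices of a covariant tensor with the inverse metric. -/
def raiseAll {n k : ℕ} (g : MetricField n) (T : TensorField n k) : TensorField n k :=
  fun x idx => ∑ jdx : Fin k → Fin n, (∏ m, (g x)⁻¹ (idx m) (jdx m)) * T x jdx

/-- Hodge dual of a `p`-form (`p + q = n`), via the metric volume element
`√|det g| ε_{a₁…aₙ}`. -/
def hodge {n p q : ℕ} (h : p + q = n) (g : MetricField n) (F : TensorField n p) :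
    TensorField n q := fun x idx =>
  (1 / (Nat.factorial p : ℝ)) *
    ∑ a : Fin p → Fin n, raiseAll g F x a *
      (Real.sqrt |(g x).det| *
        ((permSign fun i => Fin.append a idx (Fin.cast h.symm i) : ℤ) : ℝ))

/-- Source-free Maxwell equations `dF = 0 = d*F` for a `p`-form (`p + q = n`). -/
def MaxwellEqs {n p q : ℕ} (h : p + q = n) (g : MetricField n) (F : TensorField n p) : Prop :=
  (∀ x idx, extD F x idx = 0) ∧ (∀ x idx, extD (hodge h g F) x idx = 0)

/-! ### Wedge products -/

def wedgeP {n a b : ℕ} (F : TensorField n a) (G : TensorField n b) : TensorField n (a+b) :=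
  fun x idx => ∑ σ : Equiv.Perm (Fin (a+b)), ((Equiv.Perm.sign σ : ℤ) : ℝ) *
    (F x fun i => idx (σ (Fin.castAdd b i))) * (G x fun j => idx (σ (Fin.natAdd a j)))

def wedgePow {n p : ℕ} (F : TensorField n p) : (k : ℕ) → TensorField n (p * k)
  | 0 => fun _ _ => 1
  | k + 1 => wedgeP (wedgePow F k) F

def castT {n a b : ℕ} (h : a = b) (T : TensorField n a) : TensorField n b :=
  fun x idx => T x fun i => idx (Fin.cast h i)

/-! ### Degenerate Kundt metrics in adapted coordinates -/

/-- The Kundt metric `ds² = 2 du (dr + H du + W_α dx^α) + g_{αβ} dx^α dx^β` in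
coordinates `(u, r, x^α) = (x⁰, x¹, x^{α≥2})`. -/
def kundtMetric {n : ℕ} (H : Pt n → ℝ) (W : Pt n → Fin n → ℝ) (hT : MetricField n) :
    MetricField n := fun x => Matrix.of fun a b =>
  if (a : ℕ) = 0 ∧ (b : ℕ) = 0 then 2 * H x
  else if ((a : ℕ) = 0 ∧ (b : ℕ) = 1) ∨ ((a : ℕ) = 1 ∧ (b : ℕ) = 0) then 1
  else if (a : ℕ) = 0 then W x b
  else if (b : ℕ) = 0 then W x a
  else if (a : ℕ) = 1 ∨ (b : ℕ) = 1 then 0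
  else hT x a b

/-- A transverse (Riemannian) metric `g_{αβ}(u,x)`, stored as an `n×n` matrix padded
by the identity on the coordinates `u, r`. -/
def IsTransverseMetric {n : ℕ} (hT : MetricField n) : Prop :=
  (∀ (x : Pt n) (a b : Fin n), ((a : ℕ) < 2 ∨ (b : ℕ) < 2) → hT x a b = (if a = b then 1 else 0)) ∧
  (∀ x, (hT x).IsSymm) ∧ (∀ a b, ContDiff ℝ (⊤ : ℕ∞) fun x => hT x a b) ∧
  IndepOfR hT ∧ (∀ x, (hT x).PosDef)

/-- Data of a degenerate Kundt metric: `W_α = r W¹_α + W⁰_α`,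
`H = r² H² + r H¹ + H⁰`, transverse metric `hT`. -/
structure DegKundtData (n : ℕ) where
  H2 : Pt n → ℝ
  H1 : Pt n → ℝ
  H0 : Pt n → ℝ
  W1 : Pt n → Fin n → ℝ
  W0 : Pt n → Fin n → ℝ
  hT : MetricField n

def DegKundtData.Hfun {n : ℕ} [NeZero n] (D : DegKundtData n) : Pt n → ℝ :=
  fun z => (z 1)^2 * D.H2 z + z 1 * D.H1 z + D.H0 z

def DegKundtData.Wfun {n : ℕ} [NeZero n] (D : DegKundtData n) : Pt n → Fin n → ℝ :=
  fun z b => z 1 * D.W1 z b + D.W0 z b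

/-- The degenerate Kundt metric built from the data. -/
def DegKundtData.metric {n : ℕ} [NeZero n] (D : DegKundtData n) : MetricField n :=
  kundtMetric D.Hfun D.Wfun D.hT

/-- Regularity and shape conditions on the degenerate Kundt data: the metric functions
depend only on `(u, x^α)` and are smooth, `W`'s are transverse. -/
def DegKundtData.Regular {n : ℕ} (D : DegKundtData n) : Prop :=
  IsTransverseMetric D.hT ∧
  IndepOfR D.H2 ∧ IndepOfR D.H1 ∧ IndepOfR D.H0 ∧ IndepOfR D.W1 ∧ IndepOfR D.W0 ∧
  ContDiff ℝ (⊤ : ℕ∞) D.H2 ∧ ContDiff ℝ (⊤ : ℕ∞) D.H1 ∧ ContDiff ℝ (⊤ : ℕ∞) D.H0 ∧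
  (∀ a, ContDiff ℝ (⊤ : ℕ∞) fun x => D.W1 x a) ∧ (∀ a, ContDiff ℝ (⊤ : ℕ∞) fun x => D.W0 x a) ∧
  (∀ (x : Pt n) (a : Fin n), (a : ℕ) < 2 → D.W1 x a = 0) ∧ (∀ (x : Pt n) (a : Fin n), (a : ℕ) < 2 → D.W0 x a = 0)

/-- The `(q+1)`-form `du ∧ f` built from a transverse `q`-form `f`. -/
def duWedge {n q : ℕ} (f : TensorField n q) : TensorField n (q+1) := fun x idx =>
  ∑ m : Fin (q+1), (-1 : ℝ) ^ (m : ℕ) * (if (idx m : ℕ) = 0 then 1 else 0) *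
    f x (fun i => idx (m.succAbove i))

/-- `f_{[α₂…α_p , α₁]} = 0`: `f` is closed in the transverse geometry. -/
def TransClosed {n q : ℕ} (f : TensorField n q) : Prop :=
  ∀ (x : Pt n) (v : Fin (q+1) → Fin n), (∀ i, 2 ≤ (v i : ℕ)) →
    (∑ m : Fin (q+1), (-1 : ℝ) ^ (m : ℕ) *
      pd (fun y => f y fun i => v (m.succAbove i)) (v m) x) = 0

/-- `(√g̃ f^{β α₁…α_{p-2}})_{,β} = 0`: `f` is co-closed in the transverse geometry. -/
def TransCoclosed {n q : ℕ} [NeZero q] (hT : MetricField n) (f : TensorField n q) : Prop :=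
  ∀ (x : Pt n) (v : Fin q → Fin n),
    (∑ b : Fin n, pd (fun y =>
      Real.sqrt (hT y).det * raiseAll hT f y (Function.update v 0 b)) b x) = 0

/-! ### Transverse curvature -/

def christoffelT {n : ℕ} (h : MetricField n) (x : Pt n) (a b c : Fin n) : ℝ :=
  (1/2) * ∑ d, (h x)⁻¹ a d *
    (pdT (fun y => h y d c) b x + pdT (fun y => h y b d) c x - pdT (fun y => h y b c) d x)

def covDT {n k : ℕ} (h : MetricField n) (T : TensorField n k) : TensorField n (k+1) :=
  fun x idx =>
    pdT (fun y => T y fun m => idx m.succ) (idx 0) x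
    - ∑ m : Fin k, ∑ e : Fin n,
        christoffelT h x e (idx 0) (idx m.succ) * T x (Function.update (fun m' => idx m'.succ) m e)

def riemannT {n : ℕ} (h : MetricField n) : TensorField n 4 := fun x idx =>
  ∑ e, h x (idx 0) e *
    (pdT (fun y => christoffelT h y e (idx 3) (idx 1)) (idx 2) x
     - pdT (fun y => christoffelT h y e (idx 2) (idx 1)) (idx 3) x
     + ∑ f', (christoffelT h x e (idx 2) f' * christoffelT h x f' (idx 3) (idx 1)
            - christoffelT h x e (idx 3) f' * christoffelT h x f' (idx 2) (idx 1)))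

def ricciT {n : ℕ} (h : MetricField n) (x : Pt n) (b d : Fin n) : ℝ :=
  ∑ a, ∑ c, (h x)⁻¹ a c * riemannT h x ![a, b, c, d]

def ricciScalarT {n : ℕ} (h : MetricField n) (x : Pt n) : ℝ :=
  ∑ b, ∑ d, (h x)⁻¹ b d * ricciT h x b d

/-- A covector field as a rank-1 tensor field. -/
def oneForm {n : ℕ} (W : Pt n → Fin n → ℝ) : TensorField n 1 := fun x idx => W x (idx 0)

/-- Transverse covariant derivative `∇̃_b V_a` (`= V_{a||b}`). -/
def nablaT {n : ℕ} (h : MetricField n) (V : TensorField n 1) (x : Pt n) (b a : Fin n) : ℝ :=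
  covDT h V x ![b, a]

/-- Second transverse covariant derivative `∇̃_c ∇̃_b V_a`. -/
def nablaT2 {n : ℕ} (h : MetricField n) (V : TensorField n 1) (x : Pt n) (c b a : Fin n) : ℝ :=
  covDT h (covDT h V) x ![c, b, a]

/-- Transverse divergence `V^{α}{}_{||α}`. -/
def divT {n : ℕ} (h : MetricField n) (V : TensorField n 1) (x : Pt n) : ℝ :=
  ∑ b, ∑ c, (h x)⁻¹ b c * nablaT h V x b c

def gradT {n : ℕ} (f : Pt n → ℝ) : TensorField n 1 := fun x idx => pdT f (idx 0) x

/-- Transverse Laplacian. -/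
def laplaceT {n : ℕ} (h : MetricField n) (f : Pt n → ℝ) (x : Pt n) : ℝ :=
  ∑ a, ∑ b, (h x)⁻¹ a b * covDT h (gradT f) x ![a, b]

def lnSqrtDet {n : ℕ} (h : MetricField n) (y : Pt n) : ℝ :=
  Real.log (Real.sqrt (h y).det)

/-! ### Electromagnetic energy-momentum tensor -/

/-- Standard energy-momentum tensor of a `(q+1)`-form Maxwell field:
`T_{ab} = (1/q!) (F_{a c⃗} F_b{}^{c⃗} - (1/(2(q+1))) g_{ab} F_{c⃗}F^{c⃗})`. -/
def emTensor {n q : ℕ} (g : MetricField n) (F : TensorField n (q+1)) (x : Pt n)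
    (a b : Fin n) : ℝ :=
  (1 / (Nat.factorial q : ℝ)) *
    ((∑ v : Fin q → Fin n, F x (Fin.cons a v) *
        ∑ w : Fin q → Fin n, (∏ i, (g x)⁻¹ (v i) (w i)) * F x (Fin.cons b w))
     - (1 / (2 * ((q : ℝ) + 1))) * g x a b *
        ∑ v : Fin (q+1) → Fin n, F x v * raiseAll g F x v)

/-! ### Coordinate transformations (for adapted coordinates) -/

/-- Jacobian `∂ψ^a/∂y^b` of a coordinate change. -/
def jac {n : ℕ} (ψ : Pt n → Pt n) (y : Pt n) (a b : Fin n) : ℝ :=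
  pd (fun z => ψ z a) b y

/-- Pullback of the metric along the coordinate change `ψ` (from new to old coords). -/
def pullMetric {n : ℕ} (g : MetricField n) (ψ : Pt n → Pt n) : MetricField n :=
  fun y => Matrix.of fun μ ν => ∑ a, ∑ b, jac ψ y a μ * jac ψ y b ν * g (ψ y) a b

/-- Pullback of a covariant tensor field along `ψ`. -/
def pullForm {n p : ℕ} (F : TensorField n p) (ψ : Pt n → Pt n) : TensorField n p :=
  fun y idx => ∑ jdx : Fin p → Fin n, (∏ m, jac ψ y (jdx m) (idx m)) * F (ψ y) jdx

/-! ### Parallelly transported adapted frames -/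

/-- A null frame field containing `ℓ`, parallelly transported along `ℓ` and adapted
(`M^i_{jk} = 0`). -/
structure AdaptedPTFrame {n : ℕ} [NeZero n] (g : MetricField n) (ℓ : VecField n) where
  fr : ∀ x : Pt n, NullFrameAt g x
  aligned : ∀ x, (fr x).e 0 = ℓ x
  parallel : ∀ (x : Pt n) (a c : Fin n),
    (∑ b, ℓ x b * (pd (fun y => (fr y).e a c) b x
      + ∑ d, christoffel g x c b d * (fr x).e a d)) = 0
  adapted : ∀ (x : Pt n) (i j k : Fin n), 2 ≤ (i : ℕ) → 2 ≤ (j : ℕ) → 2 ≤ (k : ℕ) →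
    (∑ a, ∑ b, covD g (lowerField g fun z => (fr z).e j) x ![b, a]
      * (fr x).e i a * (fr x).e k b) = 0

/-! ### Explicit Petrov type III solutions -/

/-- The type III vacuum metric of Petrov,
`ds² = 2 du (dr + ½(xr − x eˣ) du) + eˣ(dx² + e^{2u} dy²)`, in coordinates
`(u,r,x,y)`. -/
def petrovG : MetricField 4 := fun z => Matrix.of fun a b =>
  if a = 0 ∧ b = 0 then z 2 * z 1 - z 2 * Real.exp (z 2)
  else if (a = 0 ∧ b = 1) ∨ (a = 1 ∧ b = 0) then 1
  else if a = 2 ∧ b = 2 then Real.exp (z 2)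
  else if a = 3 ∧ b = 3 then Real.exp (z 2 + 2 * z 0)
  else 0

/-- The same metric with the electromagnetic backreaction term
`−2κ₀ eˣ c(u)²` included in `2H`. -/
def petrovEM (κ₀ : ℝ) (c : ℝ → ℝ) : MetricField 4 := fun z => Matrix.of fun a b =>
  if a = 0 ∧ b = 0 then z 2 * z 1 - z 2 * Real.exp (z 2) - 2 * κ₀ * Real.exp (z 2) * (c (z 0))^2
  else if (a = 0 ∧ b = 1) ∨ (a = 1 ∧ b = 0) then 1
  else if a = 2 ∧ b = 2 then Real.exp (z 2)
  else if a = 3 ∧ b = 3 then Real.exp (z 2 + 2 * z 0)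
  else 0

/-- The null direction `ℓ = ∂_r`. -/
def ellR : VecField 4 := fun _ a => if a = 1 then 1 else 0

/-- The transverse covector of the VSI Maxwell field (4). -/
def petrovA (c : ℝ → ℝ) (z : Pt 4) : Fin 4 → ℝ := fun a =>
  if a = 2 then -(Real.exp (z 2 / 2) * c (z 0) * Real.cos (z 3 * Real.exp (z 0) / 2))
  else if a = 3 then Real.exp (z 2 / 2) * c (z 0) * Real.exp (z 0) * Real.sin (z 3 * Real.exp (z 0) / 2)
  else 0

/-- The Maxwell 2-form
`F = e^{x/2} c(u) du ∧ (−cos(y eᵘ/2) dx + eᵘ sin(y eᵘ/2) dy)`. -/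
def petrovF (c : ℝ → ℝ) : TensorField 4 2 := fun z idx =>
  (if idx 0 = 0 then petrovA c z (idx 1) else 0)
  - (if idx 1 = 0 then petrovA c z (idx 0) else 0)

set_option linter.unusedSectionVars false
set_option linter.unusedSimpArgs false
section AbsGeom

variable {A : Type*} [CommRing A] [Algebra ℝ A] {ι : Type*} [Fintype ι] [DecidableEq ι]

/-- Abstract Christoffel symbols. -/
def aGam (d : ι → Derivation ℝ A A) (g gi : Matrix ι ι A) (a b c : ι) : A :=
  (1/2 : ℝ) • ∑ e, gi a e * (d b (g e c) + d c (g b e) - d e (g b c))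

/-- Abstract mixed Riemann tensor. -/
def aRm (d : ι → Derivation ℝ A A) (Γ : ι → ι → ι → A) (e b c f : ι) : A :=
  d c (Γ e f b) - d f (Γ e c b) + ∑ k, (Γ e c k * Γ k f b - Γ e f k * Γ k c b)

/-- Abstract Ricci tensor. -/
def aRic (d : ι → Derivation ℝ A A) (Γ : ι → ι → ι → A) (b f : ι) : A :=
  ∑ a, aRm d Γ a b a f

/-- Hypotheses for an abstract metric. -/
structure AGeo (d : ι → Derivation ℝ A A) (g gi : Matrix ι ι A) : Prop where
  comm : ∀ a b f, d a (d b f) = d b (d a f)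
  gs : ∀ a b, g a b = g b a
  gis : ∀ a b, gi a b = gi b a
  inv : gi * g = 1
  inv' : g * gi = 1

/-- Entrywise derivative of a matrix. -/
def dM (δ : Derivation ℝ A A) (M : Matrix ι ι A) : Matrix ι ι A := fun a b => δ (M a b)

lemma dM_mul (δ : Derivation ℝ A A) (M N : Matrix ι ι A) :
    dM δ (M * N) = dM δ M * N + M * dM δ N := by
  ext a b
  simp only [dM, Matrix.mul_apply, Matrix.add_apply, map_sum, Derivation.leibniz, smul_eq_mul,
    ← Finset.sum_add_distrib]
  refine Finset.sum_congr rfl fun k _ => ?_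
  ring

lemma dM_add (δ : Derivation ℝ A A) (M N : Matrix ι ι A) :
    dM δ (M + N) = dM δ M + dM δ N := by
  ext a b; simp [dM]

lemma dM_sub (δ : Derivation ℝ A A) (M N : Matrix ι ι A) :
    dM δ (M - N) = dM δ M - dM δ N := by
  ext a b; simp [dM]

lemma dM_neg (δ : Derivation ℝ A A) (M : Matrix ι ι A) :
    dM δ (-M) = - dM δ M := by
  ext a b; simp [dM]

lemma dM_tr (δ : Derivation ℝ A A) (M : Matrix ι ι A) :
    dM δ M.transpose = (dM δ M).transpose := by
  ext a b; simp [dM]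

lemma dM_one (δ : Derivation ℝ A A) : dM δ (1 : Matrix ι ι A) = 0 := by
  ext a b
  simp only [dM, Matrix.one_apply, Matrix.zero_apply]
  split_ifs <;> simp

lemma dM_comm {d : ι → Derivation ℝ A A} (hc : ∀ a b f, d a (d b f) = d b (d a f)) (a b : ι)
    (M : Matrix ι ι A) : dM (d a) (dM (d b) M) = dM (d b) (dM (d a) M) := by
  ext i j; simp [dM, hc a b]

/-- connection matrices -/
def gM (Γ : ι → ι → ι → A) (c : ι) : Matrix ι ι A := fun e b => Γ e c b

/-- curvature matrices -/
def rM (d : ι → Derivation ℝ A A) (Γ : ι → ι → ι → A) (c f : ι) : Matrix ι ι A :=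
  dM (d c) (gM Γ f) - dM (d f) (gM Γ c) + (gM Γ c * gM Γ f - gM Γ f * gM Γ c)

lemma rM_apply (d : ι → Derivation ℝ A A) (Γ : ι → ι → ι → A) (e b c f : ι) :
    rM d Γ c f e b = aRm d Γ e b c f := by
  simp [rM, aRm, dM, gM, Matrix.mul_apply, Finset.sum_sub_distrib]

lemma rM_anti (d : ι → Derivation ℝ A A) (Γ : ι → ι → ι → A) (c f : ι) :
    rM d Γ c f = - rM d Γ f c := by
  unfold rM; abel

lemma rM_bianchi {d : ι → Derivation ℝ A A} (hc : ∀ a b f, d a (d b f) = d b (d a f))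
    (Γ : ι → ι → ι → A) (a c f : ι) :
    (dM (d a) (rM d Γ c f) + gM Γ a * rM d Γ c f - rM d Γ c f * gM Γ a)
    + (dM (d c) (rM d Γ f a) + gM Γ c * rM d Γ f a - rM d Γ f a * gM Γ c)
    + (dM (d f) (rM d Γ a c) + gM Γ f * rM d Γ a c - rM d Γ a c * gM Γ f) = 0 := by
  simp only [rM, dM_add, dM_sub, dM_mul]
  rw [dM_comm hc c a, dM_comm hc f a, dM_comm hc f c]
  noncomm_ring

variable {d : ι → Derivation ℝ A A} {g gi : Matrix ι ι A}

lemma aGam_symm (gs : ∀ a b, g a b = g b a) (a b c : ι) :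
    aGam d g gi a b c = aGam d g gi a c b := by
  unfold aGam
  congr 1
  refine Finset.sum_congr rfl fun e _ => ?_
  rw [gs e c, gs b e, gs b c]
  ring

lemma AGeo.low (G : AGeo d g gi) (e b c : ι) :
    ∑ a, g e a * aGam d g gi a b c = (1/2 : ℝ) • (d b (g e c) + d c (g b e) - d e (g b c)) := by
  unfold aGam
  simp only [mul_smul_comm, ← Finset.smul_sum, Finset.mul_sum]
  congr 1
  rw [Finset.sum_comm]
  have : ∀ k, ∑ a, g e a * (gi a k * (d b (g k c) + d c (g b k) - d k (g b c)))
      = (if e = k then 1 else 0) * (d b (g k c) + d c (g b k) - d k (g b c)) := by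
    intro k
    rw [← Matrix.one_apply, ← G.inv', Matrix.mul_apply, Finset.sum_mul]
    exact Finset.sum_congr rfl fun _ _ => by ring
  simp only [this]
  simp

lemma AGeo.compat (G : AGeo d g gi) (c : ι) :
    dM (d c) g = (gM (aGam d g gi) c).transpose * g + g * gM (aGam d g gi) c := by
  ext a b
  have h1 := G.low a c b
  have h2 := G.low b c a
  have e1 : ((gM (aGam d g gi) c).transpose * g) a b = ∑ k, g b k * aGam d g gi k c a := by
    simp only [Matrix.mul_apply, Matrix.transpose_apply, gM]
    exact Finset.sum_congr rfl fun k _ => by rw [G.gs k b]; ring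
  have e2 : (g * gM (aGam d g gi) c) a b = ∑ k, g a k * aGam d g gi k c b := by
    simp only [Matrix.mul_apply, gM]
  rw [Matrix.add_apply, e1, e2, h1, h2, G.gs b a, G.gs c a]
  change d c (g a b) = _
  algebra

lemma AGeo.compat_inv (G : AGeo d g gi) (c : ι) :
    dM (d c) gi = - (gM (aGam d g gi) c * gi) - gi * (gM (aGam d g gi) c).transpose := by
  have h : dM (d c) (gi * g) = 0 := by rw [G.inv, dM_one]
  rw [dM_mul, G.compat] at h
  have h2 : (dM (d c) gi * g + gi * ((gM (aGam d g gi) c).transpose * g + g * gM (aGam d g gi) c)) * gi = 0 := by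
    rw [h, Matrix.zero_mul]
  have h3 : dM (d c) gi * (g * gi) + gi * (gM (aGam d g gi) c).transpose * (g * gi)
      + (gi * g) * gM (aGam d g gi) c * gi = 0 := by
    rw [← h2]; noncomm_ring
  rw [G.inv, G.inv', Matrix.mul_one, Matrix.mul_one, Matrix.one_mul] at h3
  have : dM (d c) gi = dM (d c) gi + gi * (gM (aGam d g gi) c).transpose
      + gM (aGam d g gi) c * gi - gi * (gM (aGam d g gi) c).transpose
      - gM (aGam d g gi) c * gi := by abel
  rw [this, h3]; abel

/-- raised curvature -/
def sM (d : ι → Derivation ℝ A A) (g gi : Matrix ι ι A) (c f : ι) : Matrix ι ι A :=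
  rM d (aGam d g gi) c f * gi

lemma sM_anti (c f : ι) : sM d g gi c f = - sM d g gi f c := by
  rw [sM, sM, rM_anti, Matrix.neg_mul]

lemma AGeo.sM_tr (G : AGeo d g gi) (c f : ι) : (sM d g gi c f).transpose = - sM d g gi c f := by
  have h := dM_comm G.comm c f gi
  have gt : gi.transpose = gi := by ext a b; exact G.gis b a
  rw [G.compat_inv, G.compat_inv] at h
  simp only [dM_sub, dM_neg, dM_mul, dM_tr, G.compat_inv] at h
  simp only [sM, rM, Matrix.transpose_mul, gt, Matrix.transpose_add, Matrix.transpose_sub]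
  rw [← sub_eq_zero] at h ⊢
  rw [← neg_eq_zero, ← h]
  noncomm_ring

lemma AGeo.sM_bianchi (G : AGeo d g gi) (a c f : ι) :
    (dM (d a) (sM d g gi c f) + gM (aGam d g gi) a * sM d g gi c f + sM d g gi c f * (gM (aGam d g gi) a).transpose)
    + (dM (d c) (sM d g gi f a) + gM (aGam d g gi) c * sM d g gi f a + sM d g gi f a * (gM (aGam d g gi) c).transpose)
    + (dM (d f) (sM d g gi a c) + gM (aGam d g gi) f * sM d g gi a c + sM d g gi a c * (gM (aGam d g gi) f).transpose) = 0 := by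
  have h := congrArg (fun M => M * gi) (rM_bianchi G.comm (aGam d g gi) a c f)
  simp only [sM, dM_mul, G.compat_inv]
  rw [Matrix.zero_mul] at h
  rw [← h]
  noncomm_ring

/-- `Q^f_c`. -/
def aQ (d : ι → Derivation ℝ A A) (g gi : Matrix ι ι A) (f c : ι) : A :=
  ∑ b, aRic d (aGam d g gi) b c * gi b f

lemma aQ_eq1 (f c : ι) : ∑ a, sM d g gi a c a f = aQ d g gi f c := by
  simp only [aQ, sM, aRic, Matrix.mul_apply, rM_apply, Finset.sum_mul]
  rw [Finset.sum_comm]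

lemma AGeo.aQ_eq2 (G : AGeo d g gi) (f c : ι) : ∑ a, sM d g gi c a f a = aQ d g gi f c := by
  rw [← aQ_eq1]
  refine Finset.sum_congr rfl fun a _ => ?_
  have h1 := congrFun (congrFun (G.sM_tr c a) a) f
  rw [sM_anti a c, Matrix.neg_apply, ← Matrix.neg_apply, ← h1, Matrix.transpose_apply]

lemma AGeo.sM_trA (G : AGeo d g gi) (c f a b : ι) : sM d g gi c f b a = - sM d g gi c f a b :=
  congrFun (congrFun (G.sM_tr c f) a) b

lemma sM_antiA (c f a b : ι) : sM d g gi c f a b = - sM d g gi f c a b :=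
  congrFun (congrFun (sM_anti c f) a) b

lemma AGeo.aQ_eq3 (G : AGeo d g gi) (f c : ι) : ∑ a, sM d g gi a c f a = - aQ d g gi f c := by
  rw [← aQ_eq1, ← Finset.sum_neg_distrib]
  exact Finset.sum_congr rfl fun a _ => by rw [G.sM_trA]

/-- Contracted Bianchi identity, mixed form. -/
lemma AGeo.bianchi (G : AGeo d g gi) (c : ι) :
    (2:ℝ) • ((∑ a, d a (aQ d g gi a c)) + (∑ a, ∑ k, aGam d g gi a a k * aQ d g gi k c)
      - ∑ a, ∑ k, aGam d g gi a c k * aQ d g gi k a) = d c (∑ a, aQ d g gi a a) := by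
  have hB : ∀ a f, ((dM (d a) (sM d g gi c f) + gM (aGam d g gi) a * sM d g gi c f + sM d g gi c f * (gM (aGam d g gi) a).transpose)
    + (dM (d c) (sM d g gi f a) + gM (aGam d g gi) c * sM d g gi f a + sM d g gi f a * (gM (aGam d g gi) c).transpose)
    + (dM (d f) (sM d g gi a c) + gM (aGam d g gi) f * sM d g gi a c + sM d g gi a c * (gM (aGam d g gi) f).transpose)) a f = 0 := by
    intro a f; rw [G.sM_bianchi a c f]; rfl
  have hS : ∑ a, ∑ f, (((d a (sM d g gi c f a f) + (∑ k, aGam d g gi a a k * sM d g gi c f k f) + ∑ k, sM d g gi c f a k * aGam d g gi f a k)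
    + (d c (sM d g gi f a a f) + (∑ k, aGam d g gi a c k * sM d g gi f a k f) + ∑ k, sM d g gi f a a k * aGam d g gi f c k))
    + (d f (sM d g gi a c a f) + (∑ k, aGam d g gi a f k * sM d g gi a c k f) + ∑ k, sM d g gi a c a k * aGam d g gi f f k)) = 0 := by
    refine Finset.sum_eq_zero fun a _ => Finset.sum_eq_zero fun f _ => ?_
    rw [← hB a f]
    simp only [Matrix.add_apply, Matrix.mul_apply, Matrix.transpose_apply]
    rfl
  simp only [Finset.sum_add_distrib] at hS
  -- the nine sums
  have t1 : ∑ a, ∑ f, d a (sM d g gi c f a f) = ∑ a, d a (aQ d g gi a c) := by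
    simp only [← G.aQ_eq2, map_sum]
  have t2 : ∑ a, ∑ f, ∑ k, aGam d g gi a a k * sM d g gi c f k f
      = ∑ a, ∑ k, aGam d g gi a a k * aQ d g gi k c := by
    refine Finset.sum_congr rfl fun a _ => ?_
    rw [Finset.sum_comm]
    simp only [← G.aQ_eq2, Finset.mul_sum]
  have t3 : ∑ a, ∑ f, ∑ k, sM d g gi c f a k * aGam d g gi f a k = 0 := by
    rw [Finset.sum_comm]
    refine Finset.sum_eq_zero fun f _ => ?_
    have h : ∑ a, ∑ k, sM d g gi c f a k * aGam d g gi f a k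
        = - ∑ a, ∑ k, sM d g gi c f a k * aGam d g gi f a k := by
      conv_lhs => rw [Finset.sum_comm]
      rw [← Finset.sum_neg_distrib]
      refine Finset.sum_congr rfl fun a _ => ?_
      rw [← Finset.sum_neg_distrib]
      refine Finset.sum_congr rfl fun k _ => ?_
      rw [G.sM_trA c f a k, aGam_symm G.gs f k a]; ring
    have h2 : (2:ℝ) • ∑ a, ∑ k, sM d g gi c f a k * aGam d g gi f a k = 0 := by
      rw [two_smul]; nth_rewrite 1 [h]; ring
    have h3 := congrArg (fun z => (1/2:ℝ) • z) h2
    simpa [smul_smul] using h3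
  have t4 : ∑ a, ∑ f, d c (sM d g gi f a a f) = - d c (∑ a, aQ d g gi a a) := by
    simp only [map_sum, ← G.aQ_eq2, ← Finset.sum_neg_distrib]
    refine Finset.sum_congr rfl fun a _ => Finset.sum_congr rfl fun f _ => ?_
    rw [sM_antiA f a, map_neg]
  have t5 : ∑ a, ∑ f, ∑ k, aGam d g gi a c k * sM d g gi f a k f
      = - ∑ a, ∑ k, aGam d g gi a c k * aQ d g gi k a := by
    rw [← Finset.sum_neg_distrib]
    refine Finset.sum_congr rfl fun a _ => ?_
    rw [Finset.sum_comm, ← Finset.sum_neg_distrib]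
    refine Finset.sum_congr rfl fun k _ => ?_
    rw [← Finset.mul_sum, G.aQ_eq3]; ring
  have t6 : ∑ a, ∑ f, ∑ k, sM d g gi f a a k * aGam d g gi f c k
      = - ∑ a, ∑ k, aGam d g gi a c k * aQ d g gi k a := by
    rw [Finset.sum_comm, ← Finset.sum_neg_distrib]
    refine Finset.sum_congr rfl fun f _ => ?_
    rw [Finset.sum_comm, ← Finset.sum_neg_distrib]
    refine Finset.sum_congr rfl fun k _ => ?_
    rw [← Finset.sum_mul, ← aQ_eq1]
    have : ∑ a, sM d g gi f a a k = - ∑ a, sM d g gi a f a k := by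
      rw [← Finset.sum_neg_distrib]
      exact Finset.sum_congr rfl fun a _ => sM_antiA _ _ _ _
    rw [this]; ring
  have t7 : ∑ a, ∑ f, d f (sM d g gi a c a f) = ∑ a, d a (aQ d g gi a c) := by
    rw [Finset.sum_comm]
    simp only [← aQ_eq1, map_sum]
  have t8 : ∑ a, ∑ f, ∑ k, aGam d g gi a f k * sM d g gi a c k f = 0 := by
    refine Finset.sum_eq_zero fun b _ => ?_
    have h : ∑ a, ∑ k, aGam d g gi b a k * sM d g gi b c k a
        = - ∑ a, ∑ k, aGam d g gi b a k * sM d g gi b c k a := by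
      conv_lhs => rw [Finset.sum_comm]
      rw [← Finset.sum_neg_distrib]
      refine Finset.sum_congr rfl fun a _ => ?_
      rw [← Finset.sum_neg_distrib]
      refine Finset.sum_congr rfl fun k _ => ?_
      rw [G.sM_trA b c k a, aGam_symm G.gs b k a]; ring
    have h2 : (2:ℝ) • ∑ a, ∑ k, aGam d g gi b a k * sM d g gi b c k a = 0 := by
      rw [two_smul]; nth_rewrite 1 [h]; ring
    have h3 := congrArg (fun z => (1/2:ℝ) • z) h2
    simpa [smul_smul] using h3
  have t9 : ∑ a, ∑ f, ∑ k, sM d g gi a c a k * aGam d g gi f f k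
      = ∑ a, ∑ k, aGam d g gi a a k * aQ d g gi k c := by
    rw [Finset.sum_comm]
    refine Finset.sum_congr rfl fun f _ => ?_
    rw [Finset.sum_comm]
    refine Finset.sum_congr rfl fun k _ => ?_
    rw [← Finset.sum_mul, aQ_eq1]; ring
  rw [t1, t2, t3, t4, t5, t6, t7, t8, t9] at hS
  rw [two_smul]
  linear_combination hS

end AbsGeom

section AbsGeom2

variable {A : Type*} [CommRing A] [Algebra ℝ A] {ι : Type*} [Fintype ι] [DecidableEq ι]

/-- raising an index -/
def aUp (gi : Matrix ι ι A) (X : ι → A) (i : ι) : A := ∑ j, gi i j * X j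

/-- inner product of covectors -/
def aIp (gi : Matrix ι ι A) (X Y : ι → A) : A := ∑ b, ∑ c, gi b c * X b * Y c

/-- covariant derivative of a covector -/
def aNab (d : ι → Derivation ℝ A A) (Γ : ι → ι → ι → A) (X : ι → A) (b a : ι) : A :=
  d b (X a) - ∑ e, Γ e b a * X e

/-- divergence of a covector -/
def aDv (d : ι → Derivation ℝ A A) (Γ : ι → ι → ι → A) (gi : Matrix ι ι A) (X : ι → A) : A :=
  ∑ b, ∑ c, gi b c * aNab d Γ X b c

/-- covariant derivative of a two-tensor -/
def aCov2 (d : ι → Derivation ℝ A A) (Γ : ι → ι → ι → A) (T : ι → ι → A) (c b a : ι) : A :=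
  d c (T b a) - ((∑ e, Γ e c b * T e a) + ∑ e, Γ e c a * T b e)

/-- divergence of a two-tensor on its first index -/
def aDv2 (d : ι → Derivation ℝ A A) (Γ : ι → ι → ι → A) (gi : Matrix ι ι A) (T : ι → ι → A) (a : ι) : A :=
  ∑ b, ∑ c, gi b c * aCov2 d Γ T c b a

variable {d : ι → Derivation ℝ A A} {g gi : Matrix ι ι A}

lemma AGeo.dgi (G : AGeo d g gi) (c a b : ι) :
    d c (gi a b) = - (∑ k, aGam d g gi a c k * gi k b) - ∑ k, gi a k * aGam d g gi b c k := by
  have h := congrFun (congrFun (G.compat_inv c) a) b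
  simpa only [dM, Matrix.sub_apply, Matrix.neg_apply, Matrix.mul_apply, Matrix.transpose_apply,
    gM] using h

lemma AGeo.trace (G : AGeo d g gi) (b : ι) :
    ∑ a, aGam d g gi a a b = (1/2:ℝ) • ∑ a, ∑ c, gi a c * d b (g a c) := by
  unfold aGam
  rw [← Finset.smul_sum]
  congr 1
  have h : ∑ a, ∑ e, gi a e * (d a (g e b) - d e (g a b)) = 0 := by
    simp only [mul_sub, Finset.sum_sub_distrib]
    rw [sub_eq_zero]
    conv_rhs => rw [Finset.sum_comm]
    refine Finset.sum_congr rfl fun a _ => Finset.sum_congr rfl fun e _ => ?_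
    rw [G.gis]
  rw [← sub_eq_zero, ← h, ← Finset.sum_sub_distrib]
  refine Finset.sum_congr rfl fun a _ => ?_
  rw [← Finset.sum_sub_distrib]
  refine Finset.sum_congr rfl fun e _ => ?_
  ring

lemma AGeo.div1 (G : AGeo d g gi) (X : ι → A) :
    (∑ i, d i (aUp gi X i)) + ∑ k, (∑ a, aGam d g gi a a k) * aUp gi X k
      = aDv d (aGam d g gi) gi X := by
  have e1 : ∑ i, d i (aUp gi X i) = ∑ i, ∑ j, gi i j * d i (X j)
      - (∑ i, ∑ j, ∑ k, aGam d g gi i i k * gi k j * X j)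
      - ∑ i, ∑ j, ∑ k, gi i k * aGam d g gi j i k * X j := by
    rw [← Finset.sum_sub_distrib, ← Finset.sum_sub_distrib]
    refine Finset.sum_congr rfl fun i _ => ?_
    rw [aUp, map_sum, ← Finset.sum_sub_distrib, ← Finset.sum_sub_distrib]
    refine Finset.sum_congr rfl fun j _ => ?_
    rw [Derivation.leibniz, G.dgi, smul_eq_mul, smul_eq_mul, ← Finset.sum_mul, ← Finset.sum_mul]
    ring
  have e2 : ∑ k, (∑ a, aGam d g gi a a k) * aUp gi X k
      = ∑ i, ∑ j, ∑ k, aGam d g gi i i k * gi k j * X j := by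
    simp only [Finset.sum_mul]
    rw [Finset.sum_comm]
    refine Finset.sum_congr rfl fun i _ => ?_
    rw [Finset.sum_comm]
    refine Finset.sum_congr rfl fun k _ => ?_
    rw [aUp, Finset.mul_sum]
    refine Finset.sum_congr rfl fun j _ => ?_
    ring
  have e3 : aDv d (aGam d g gi) gi X = ∑ i, ∑ j, gi i j * d i (X j)
      - ∑ i, ∑ j, ∑ k, gi i k * aGam d g gi j i k * X j := by
    simp only [aDv, aNab, mul_sub, Finset.sum_sub_distrib]
    congr 1
    refine Finset.sum_congr rfl fun i _ => ?_
    rw [Finset.sum_comm]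
    refine Finset.sum_congr rfl fun k _ => ?_
    rw [Finset.mul_sum]
    refine Finset.sum_congr rfl fun j _ => ?_
    ring
  rw [e1, e2, e3]; ring

lemma AGeo.div2 (G : AGeo d g gi) (T : ι → ι → A) (c : ι) :
    (∑ i, d i (∑ j, gi i j * T j c)) + (∑ k, (∑ a, aGam d g gi a a k) * ∑ j, gi k j * T j c)
      - (∑ a, ∑ k, aGam d g gi a c k * ∑ j, gi k j * T j a)
      = aDv2 d (aGam d g gi) gi T c := by
  have h := G.div1 (fun j => T j c)
  simp only [aUp] at h
  rw [h]
  simp only [aDv2, aDv, aNab, aCov2, mul_sub, mul_add, Finset.sum_sub_distrib, Finset.sum_add_distrib]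
  have e1 : ∑ b, ∑ k, gi b k * d k (T b c) = ∑ b, ∑ k, gi b k * d b (T k c) := by
    rw [Finset.sum_comm]
    exact Finset.sum_congr rfl fun _ _ => Finset.sum_congr rfl fun _ _ => by rw [G.gis]
  have e2 : ∑ b, ∑ k, gi b k * ∑ e, aGam d g gi e k b * T e c
      = ∑ b, ∑ k, gi b k * ∑ e, aGam d g gi e b k * T e c := by
    rw [Finset.sum_comm]
    exact Finset.sum_congr rfl fun _ _ => Finset.sum_congr rfl fun _ _ => by rw [G.gis]
  have e3 : ∑ b, ∑ k, gi b k * ∑ e, aGam d g gi e k c * T b e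
      = ∑ a, ∑ k, aGam d g gi a c k * ∑ j, gi k j * T j a := by
    have : ∀ b k, gi b k * ∑ e, aGam d g gi e k c * T b e
        = ∑ e, aGam d g gi e c k * (gi k b * T b e) := by
      intro b k
      rw [Finset.mul_sum]
      exact Finset.sum_congr rfl fun e _ => by rw [aGam_symm G.gs e c k, G.gis k b]; ring
    simp only [this, Finset.mul_sum]
    rw [Finset.sum_comm]
    conv_rhs => rw [Finset.sum_comm]
    refine Finset.sum_congr rfl fun k _ => ?_
    rw [Finset.sum_comm]
  rw [e1, e2, e3]; ring

/-- Ricci tensor through the trace potential. -/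
lemma aRic_eq (Γ : ι → ι → ι → A) (t : ι → A) (ht : ∀ b, ∑ a, Γ a a b = t b) (b f : ι) :
    aRic d Γ b f = (∑ a, d a (Γ a f b)) - d f (t b) + (∑ k, t k * Γ k f b)
      - ∑ a, ∑ k, Γ a f k * Γ k a b := by
  have e : ∑ k, t k * Γ k f b = ∑ a, ∑ k, Γ a a k * Γ k f b := by
    rw [Finset.sum_comm]
    exact Finset.sum_congr rfl fun k _ => by rw [← ht, Finset.sum_mul]
  simp only [aRic, aRm, Finset.sum_add_distrib, Finset.sum_sub_distrib]
  rw [e, ← ht b, map_sum]; ring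

/-- Contracted Bianchi identity for the Ricci tensor, covariant form. -/
lemma AGeo.bianchi2 (G : AGeo d g gi) (c : ι) :
    (2:ℝ) • aDv2 d (aGam d g gi) gi (aRic d (aGam d g gi)) c
      = d c (∑ a, ∑ b, gi a b * aRic d (aGam d g gi) a b) := by
  have hQ : ∀ f c, aQ d g gi f c = ∑ j, gi f j * aRic d (aGam d g gi) j c := by
    intro f c
    exact Finset.sum_congr rfl fun b _ => by rw [G.gis f b]; ring
  have h := G.bianchi c
  rw [← G.div2]
  have e1 : ∑ a, ∑ b, gi a b * aRic d (aGam d g gi) a b = ∑ a, aQ d g gi a a := by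
    simp only [hQ]
    rw [Finset.sum_comm]
    exact Finset.sum_congr rfl fun b _ => Finset.sum_congr rfl fun a _ => by rw [G.gis]
  rw [e1, ← h]
  congr 1
  simp only [hQ]
  congr 2
  rw [Finset.sum_comm]
  exact Finset.sum_congr rfl fun k _ => by rw [Finset.sum_mul]

end AbsGeom2

section AbsKundt

variable {A : Type*} [CommRing A] [Algebra ℝ A] {m : ℕ}

lemma sum2 {M : Type*} [AddCommMonoid M] (f : Fin (m+2) → M) :
    ∑ a, f a = f 0 + f 1 + ∑ i : Fin m, f i.succ.succ := by
  rw [Fin.sum_univ_succ, Fin.sum_univ_succ]; exact (add_assoc _ _ _).symm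

@[simp] lemma d_two (δ : Derivation ℝ A A) : δ (2 : A) = 0 := by
  have : (2:A) = 1 + 1 := by norm_num
  rw [this, map_add, Derivation.map_one_eq_zero, add_zero]

lemma forall2 {P : Fin (m+2) → Prop} : (∀ a, P a) ↔ P 0 ∧ P 1 ∧ ∀ i : Fin m, P i.succ.succ := by
  rw [Fin.forall_fin_succ, Fin.forall_fin_succ]; rfl

/-- block matrix in `u, r, transverse` form -/
def blk (a00 a01 a11 : A) (w0 w1 : Fin m → A) (h : Matrix (Fin m) (Fin m) A) :
    Matrix (Fin (m+2)) (Fin (m+2)) A := fun a b =>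
  Fin.cases (Fin.cases a00 (Fin.cases a01 w0) b)
    (Fin.cases (Fin.cases a01 (Fin.cases a11 w1) b)
      (fun i => Fin.cases (w0 i) (Fin.cases (w1 i) (h i)) b)) a

section
variable (a00 a01 a11 : A) (w0 w1 : Fin m → A) (h : Matrix (Fin m) (Fin m) A) (i j : Fin m)
@[simp] lemma blk00 : blk a00 a01 a11 w0 w1 h 0 0 = a00 := rfl
@[simp] lemma blk01 : blk a00 a01 a11 w0 w1 h 0 1 = a01 := rfl
@[simp] lemma blk10 : blk a00 a01 a11 w0 w1 h 1 0 = a01 := rfl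
@[simp] lemma blk11 : blk a00 a01 a11 w0 w1 h 1 1 = a11 := rfl
@[simp] lemma blk0j : blk a00 a01 a11 w0 w1 h 0 j.succ.succ = w0 j := rfl
@[simp] lemma blk1j : blk a00 a01 a11 w0 w1 h 1 j.succ.succ = w1 j := rfl
@[simp] lemma blki0 : blk a00 a01 a11 w0 w1 h i.succ.succ 0 = w0 i := rfl
@[simp] lemma blki1 : blk a00 a01 a11 w0 w1 h i.succ.succ 1 = w1 i := rfl
@[simp] lemma blkij : blk a00 a01 a11 w0 w1 h i.succ.succ j.succ.succ = h i j := rfl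
end

/-- Kundt metric -/
def kG (H : A) (W : Fin m → A) (h : Matrix (Fin m) (Fin m) A) : Matrix (Fin (m+2)) (Fin (m+2)) A :=
  blk (2 * H) 1 0 W (fun _ => 0) h

/-- inverse Kundt metric -/
def kGi (H : A) (W : Fin m → A) (hi : Matrix (Fin m) (Fin m) A) : Matrix (Fin (m+2)) (Fin (m+2)) A :=
  blk 0 1 (aIp hi W W - 2 * H) (fun _ => 0) (fun i => - aUp hi W i) hi

/-- transverse derivations -/
def dT (d : Fin (m+2) → Derivation ℝ A A) (i : Fin m) : Derivation ℝ A A := d i.succ.succ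

structure AKundt (d : Fin (m+2) → Derivation ℝ A A) (h hi : Matrix (Fin m) (Fin m) A)
    (W W1 : Fin m → A) (H Hr H2 L : A) : Prop where
  comm : ∀ a b f, d a (d b f) = d b (d a f)
  geo : AGeo (dT d) h hi
  h_r : ∀ i j, d 1 (h i j) = 0
  W_r : ∀ i, d 1 (W i) = W1 i
  W1_r : ∀ i, d 1 (W1 i) = 0
  H_r : d 1 H = Hr
  Hr_r : d 1 Hr = 2 * H2
  H2_r : d 1 H2 = 0
  L_d : ∀ a, d a L = (1/2:ℝ) • ∑ i, ∑ j, hi i j * d a (h i j)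

variable {d : Fin (m+2) → Derivation ℝ A A} {h hi : Matrix (Fin m) (Fin m) A}
    {W W1 : Fin m → A} {H Hr H2 L : A}

lemma up_ip (hi : Matrix (Fin m) (Fin m) A) (X Y : Fin m → A) :
    ∑ i, X i * aUp hi Y i = aIp hi X Y := by
  simp only [aUp, aIp, Finset.mul_sum]
  exact Finset.sum_congr rfl fun _ _ => Finset.sum_congr rfl fun _ _ => by ring

lemma AGeo.ip_comm {d' : Fin m → Derivation ℝ A A} (G : AGeo d' h hi) (X Y : Fin m → A) :
    aIp hi X Y = aIp hi Y X := by
  unfold aIp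
  rw [Finset.sum_comm]
  exact Finset.sum_congr rfl fun _ _ => Finset.sum_congr rfl fun _ _ => by rw [G.gis]; ring

lemma AKundt.hi_r (K : AKundt d h hi W W1 H Hr H2 L) (i j : Fin m) : d 1 (hi i j) = 0 := by
  have e : dM (d 1) (hi * h) = 0 := by rw [K.geo.inv, dM_one]
  have e0 : dM (d 1) h = 0 := by ext a b; exact K.h_r a b
  rw [dM_mul, e0, Matrix.mul_zero, add_zero] at e
  have e2 : dM (d 1) hi * h * hi = 0 := by rw [e, Matrix.zero_mul]
  rw [Matrix.mul_assoc, K.geo.inv', Matrix.mul_one] at e2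
  exact congrFun (congrFun e2 i) j

lemma AKundt.L_r (K : AKundt d h hi W W1 H Hr H2 L) : d 1 L = 0 := by
  rw [K.L_d]; simp [K.h_r]

lemma AKundt.low_up (K : AKundt d h hi W W1 H Hr H2 L) (X : Fin m → A) (i : Fin m) :
    ∑ j, h i j * aUp hi X j = X i := by
  have : (h * hi).mulVec X i = X i := by rw [K.geo.inv', Matrix.one_mulVec]
  rw [← this, ← Matrix.mulVec_mulVec]; rfl

lemma AKundt.full (K : AKundt d h hi W W1 H Hr H2 L) : AGeo d (kG H W h) (kGi H W hi) := by
  have g1 : ∀ a b, kG H W h a b = kG H W h b a := by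
    simp only [forall2, kG]
    simp [K.geo.gs]
    try exact fun i j => K.geo.gs i j
  have g2 : ∀ a b, kGi H W hi a b = kGi H W hi b a := by
    simp only [forall2, kGi]
    simp
    exact fun i j => K.geo.gis i j
  have hu : ∀ i, ∑ j, W j * hi j i = aUp hi W i := by
    intro i; unfold aUp; exact Finset.sum_congr rfl fun j _ => by rw [K.geo.gis]; ring
  have g3 : kG H W h * kGi H W hi = 1 := by
    ext a b
    revert a b
    simp only [forall2, Matrix.mul_apply, sum2, kG, kGi]
    simp [Matrix.one_apply, Fin.succ_ne_zero, up_ip, K.low_up, hu, Fin.ext_iff]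
    intro i j
    have := congrFun (congrFun K.geo.inv' i) j
    rw [Matrix.mul_apply, Matrix.one_apply] at this
    simpa [Fin.ext_iff] using this
  exact ⟨K.comm, g1, g2, mul_eq_one_comm.mp g3, g3⟩

/-- full Christoffel symbols -/
def kGam (d : Fin (m+2) → Derivation ℝ A A) (h hi : Matrix (Fin m) (Fin m) A)
    (W : Fin m → A) (H : A) : Fin (m+2) → Fin (m+2) → Fin (m+2) → A :=
  aGam d (kG H W h) (kGi H W hi)

/-- transverse Christoffel symbols -/
def tGam (d : Fin (m+2) → Derivation ℝ A A) (h hi : Matrix (Fin m) (Fin m) A) :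
    Fin m → Fin m → Fin m → A := aGam (dT d) h hi

lemma AKundt.sy (K : AKundt d h hi W W1 H Hr H2 L) (a b c) :
    kGam d h hi W H a b c = kGam d h hi W H a c b := aGam_symm K.full.gs a b c

variable (K : AKundt d h hi W W1 H Hr H2 L)
include K

lemma AKundt.g000 : kGam d h hi W H 0 0 0 = - Hr := by
  simp only [kGam, aGam, sum2, kG, kGi]
  simp [K.H_r]
  algebra

lemma AKundt.g00i (i : Fin m) : kGam d h hi W H 0 0 i.succ.succ = - (1/2:ℝ) • W1 i := by
  simp only [kGam, aGam, sum2, kG, kGi]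
  simp [K.W_r]

lemma AKundt.g0r (a : Fin (m+2)) : kGam d h hi W H 0 1 a = 0 := by
  revert a
  simp only [forall2, kGam, aGam, sum2, kG, kGi]
  simp

lemma AKundt.g0ij (i j : Fin m) : kGam d h hi W H 0 i.succ.succ j.succ.succ = 0 := by
  simp only [kGam, aGam, sum2, kG, kGi]
  simp [K.h_r]

lemma AKundt.gi00 (i : Fin m) : kGam d h hi W H i.succ.succ 0 0 =
    aUp hi (fun j => d 0 (W j) - d j.succ.succ H) i + aUp hi W i * Hr := by
  have : ∑ j, hi i j * (d 0 (W j) + d 0 (W j) - 2 * d j.succ.succ H)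
     = 2 * aUp hi (fun j => d 0 (W j) - d j.succ.succ H) i := by
    rw [aUp, Finset.mul_sum]; exact Finset.sum_congr rfl fun _ _ => by ring
  simp only [kGam, aGam, sum2, kG, kGi]
  simp [K.H_r, this]
  algebra

lemma AKundt.gi0r (i : Fin m) : kGam d h hi W H i.succ.succ 0 1 = (1/2:ℝ) • aUp hi W1 i := by
  simp only [kGam, aGam, sum2, kG, kGi]
  simp [K.W_r, aUp]

lemma AKundt.gi0j (i j : Fin m) : kGam d h hi W H i.succ.succ 0 j.succ.succ =
    (1/2:ℝ) • ((∑ k, hi i k * (d 0 (h k j) + d j.succ.succ (W k) - d k.succ.succ (W j)))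
      + aUp hi W i * W1 j) := by
  simp only [kGam, aGam, sum2, kG, kGi]
  simp [K.W_r]
  algebra

lemma AKundt.girr (i : Fin m) : kGam d h hi W H i.succ.succ 1 1 = 0 := by
  simp only [kGam, aGam, sum2, kG, kGi]
  simp

lemma AKundt.girj (i j : Fin m) : kGam d h hi W H i.succ.succ 1 j.succ.succ = 0 := by
  simp only [kGam, aGam, sum2, kG, kGi]
  simp [K.h_r]

lemma AKundt.gijk (i j k : Fin m) : kGam d h hi W H i.succ.succ j.succ.succ k.succ.succ =
    tGam d h hi i j k := by
  simp only [kGam, tGam, aGam, sum2, kG, kGi]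
  simp [K.h_r, dT]

lemma AKundt.gr0r : kGam d h hi W H 1 0 1 = Hr - (1/2:ℝ) • aIp hi W W1 := by
  have e : ∑ j, aUp hi W j * W1 j = aIp hi W W1 := by
    rw [K.geo.ip_comm, ← up_ip]; exact Finset.sum_congr rfl fun _ _ => by ring
  simp only [kGam, aGam, sum2, kG, kGi]
  simp [K.H_r, K.W_r, e]
  algebra

lemma AKundt.grrr : kGam d h hi W H 1 1 1 = 0 := by
  simp only [kGam, aGam, sum2, kG, kGi]
  simp

lemma AKundt.grri (i : Fin m) : kGam d h hi W H 1 1 i.succ.succ = (1/2:ℝ) • W1 i := by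
  simp only [kGam, aGam, sum2, kG, kGi]
  simp [K.W_r, K.h_r]

lemma AKundt.gr00 : kGam d h hi W H 1 0 0 =
    d 0 H + (2 * H - aIp hi W W) * Hr - aIp hi W (fun j => d 0 (W j) - d j.succ.succ H) := by
  have e : ∑ j, aUp hi W j * (d 0 (W j) + d 0 (W j) - 2 * d j.succ.succ H)
      = 2 * aIp hi W (fun j => d 0 (W j) - d j.succ.succ H) := by
    rw [K.geo.ip_comm, ← up_ip, Finset.mul_sum]; exact Finset.sum_congr rfl fun _ _ => by ring
  simp only [kGam, aGam, sum2, kG, kGi]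
  simp [K.H_r, e]
  algebra

lemma AKundt.gr0i (i : Fin m) : kGam d h hi W H 1 0 i.succ.succ =
    d i.succ.succ H + (1/2:ℝ) • ((2 * H - aIp hi W W) * W1 i)
     - (1/2:ℝ) • ∑ k, aUp hi W k * (d 0 (h k i) + d i.succ.succ (W k) - d k.succ.succ (W i)) := by
  simp only [kGam, aGam, sum2, kG, kGi]
  simp [K.W_r]
  algebra

lemma AKundt.grij (i j : Fin m) : kGam d h hi W H 1 i.succ.succ j.succ.succ =
    (1/2:ℝ) • (aNab (dT d) (tGam d h hi) W i j + aNab (dT d) (tGam d h hi) W j i - d 0 (h i j)) := by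
  have e : ∑ k, aUp hi W k * (d i.succ.succ (h k j) + d j.succ.succ (h i k) - d k.succ.succ (h i j))
      = 2 * ∑ e, tGam d h hi e i j * W e := by
    simp only [tGam, aGam, aUp, dT, Finset.sum_mul, Finset.smul_sum, Finset.mul_sum]
    rw [Finset.sum_comm]
    refine Finset.sum_congr rfl fun a _ => Finset.sum_congr rfl fun b _ => ?_
    rw [K.geo.gis b a]; algebra
  have e' : ∑ e, tGam d h hi e j i * W e = ∑ e, tGam d h hi e i j * W e :=
    Finset.sum_congr rfl fun a _ => by rw [tGam, aGam_symm K.geo.gs]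
  simp only [kGam, aGam, sum2, kG, kGi, aNab, e']
  simp [K.h_r, e, dT]
  algebra

end AbsKundt

section AbsRic

variable {A : Type*} [CommRing A] [Algebra ℝ A] {m : ℕ}
variable {d : Fin (m+2) → Derivation ℝ A A} {h hi : Matrix (Fin m) (Fin m) A}
    {W W1 : Fin m → A} {H Hr H2 L : A}

/-- the tensor `B` -/
def bL (d : Fin (m+2) → Derivation ℝ A A) (h : Matrix (Fin m) (Fin m) A) (W : Fin m → A) (k j : Fin m) : A :=
  d 0 (h k j) + d j.succ.succ (W k) - d k.succ.succ (W j)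

lemma ip_congr (X : Fin m → A) {Y Y' : Fin m → A} (e : ∀ i, Y i = Y' i) : aIp hi X Y = aIp hi X Y' := by
  rw [funext e]

lemma ip_sub (X Y Z : Fin m → A) : aIp hi X (fun i => Y i - Z i) = aIp hi X Y - aIp hi X Z := by
  simp only [aIp, mul_sub, Finset.sum_sub_distrib]
lemma ip_add (X Y Z : Fin m → A) : aIp hi X (fun i => Y i + Z i) = aIp hi X Y + aIp hi X Z := by
  simp only [aIp, mul_add, Finset.sum_add_distrib]
lemma ip_mul (X Y : Fin m → A) (c : A) : aIp hi X (fun i => Y i * c) = aIp hi X Y * c := by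
  simp only [aIp, Finset.sum_mul, mul_assoc]
lemma ip_smul (X Y : Fin m → A) (c : ℝ) : aIp hi X (fun i => c • Y i) = c • aIp hi X Y := by
  simp only [aIp, Finset.smul_sum, mul_smul_comm]

variable (K : AKundt d h hi W W1 H Hr H2 L)
include K

lemma AKundt.up_ip' (X Y : Fin m → A) : ∑ i, aUp hi X i * Y i = aIp hi X Y := by
  rw [K.geo.ip_comm, ← up_ip]; exact Finset.sum_congr rfl fun _ _ => by ring

lemma AKundt.trace (b : Fin (m+2)) : ∑ a, kGam d h hi W H a a b = d b L := by
  rw [K.L_d]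
  simp only [kGam]
  rw [K.full.trace]
  simp only [sum2, kG, kGi]
  simp

lemma AKundt.ttrace (k : Fin m) : ∑ a, tGam d h hi a a k = d k.succ.succ L := by
  rw [K.L_d]
  exact K.geo.trace k

lemma AKundt.div1 (X : Fin m → A) : (∑ i, d i.succ.succ (aUp hi X i)) +
    ∑ k, d (Fin.succ (Fin.succ k)) L * aUp hi X k = aDv (dT d) (tGam d h hi) hi X := by
  have := K.geo.div1 X
  rw [← tGam] at this
  simp only [K.ttrace] at this
  exact this

lemma AKundt.div2 (T : Fin m → Fin m → A) (c : Fin m) :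
    (∑ i, d (Fin.succ (Fin.succ i)) (aUp hi (fun j => T j c) i)) +
      (∑ k, d (Fin.succ (Fin.succ k)) L * aUp hi (fun j => T j c) k)
      - (∑ a, ∑ k, tGam d h hi a c k * aUp hi (fun j => T j a) k) = aDv2 (dT d) (tGam d h hi) hi T c := by
  have := K.geo.div2 T c
  rw [← tGam] at this
  simp only [K.ttrace] at this
  exact this

lemma AKundt.tsy (a b c) : tGam d h hi a b c = tGam d h hi a c b := aGam_symm K.geo.gs a b c

lemma AKundt.ric_eq (b f) : aRic d (kGam d h hi W H) b f = (∑ a, d a (kGam d h hi W H a f b)) - d f (d b L)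
    + (∑ k, d k L * kGam d h hi W H k f b) - ∑ a, ∑ k, kGam d h hi W H a f k * kGam d h hi W H k a b :=
  aRic_eq _ _ K.trace b f

lemma AKundt.tric_eq (b f : Fin m) : aRic (dT d) (tGam d h hi) b f = (∑ a, dT d a (tGam d h hi a f b)) - dT d f (dT d b L)
    + (∑ k, dT d k L * tGam d h hi k f b) - ∑ a, ∑ k, tGam d h hi a f k * tGam d h hi k a b :=
  aRic_eq _ _ K.ttrace b f

lemma AKundt.ricsy (a b) : aRic d (kGam d h hi W H) a b = aRic d (kGam d h hi W H) b a := by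
  rw [K.ric_eq, K.ric_eq, K.comm b a]
  simp only [K.sy _ a b]
  congr 1
  rw [Finset.sum_comm]
  refine Finset.sum_congr rfl fun x _ => Finset.sum_congr rfl fun y _ => ?_
  rw [K.sy x y a, K.sy y b x, mul_comm]

lemma AKundt.g0i0 (i : Fin m) : kGam d h hi W H 0 i.succ.succ 0 = - (1/2:ℝ) • W1 i := by
  rw [K.sy, K.g00i]
lemma AKundt.g0ar (a : Fin (m+2)) : kGam d h hi W H 0 a 1 = 0 := by rw [K.sy, K.g0r]
lemma AKundt.gir0 (i : Fin m) : kGam d h hi W H i.succ.succ 1 0 = (1/2:ℝ) • aUp hi W1 i := by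
  rw [K.sy, K.gi0r]
lemma AKundt.gi0j' (i j : Fin m) : kGam d h hi W H i.succ.succ 0 j.succ.succ =
    (1/2:ℝ) • (aUp hi (fun k => bL d h W k j) i + aUp hi W i * W1 j) := K.gi0j i j
lemma AKundt.gij0 (i j : Fin m) : kGam d h hi W H i.succ.succ j.succ.succ 0 =
    (1/2:ℝ) • (aUp hi (fun k => bL d h W k j) i + aUp hi W i * W1 j) := by
  rw [K.sy, K.gi0j']
lemma AKundt.gijr (i j : Fin m) : kGam d h hi W H i.succ.succ j.succ.succ 1 = 0 := by
  rw [K.sy, K.girj]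
lemma AKundt.grr0 : kGam d h hi W H 1 1 0 = Hr - (1/2:ℝ) • aIp hi W W1 := by
  rw [K.sy, K.gr0r]
lemma AKundt.grir (i : Fin m) : kGam d h hi W H 1 i.succ.succ 1 = (1/2:ℝ) • W1 i := by
  rw [K.sy, K.grri]
lemma AKundt.gr0i' (i : Fin m) : kGam d h hi W H 1 0 i.succ.succ =
    d i.succ.succ H + (1/2:ℝ) • ((2 * H - aIp hi W W) * W1 i)
     - (1/2:ℝ) • aIp hi W (fun k => bL d h W k i) := by
  rw [K.gr0i, ← K.up_ip' W (fun k => bL d h W k i)]; rfl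
lemma AKundt.gri0 (i : Fin m) : kGam d h hi W H 1 i.succ.succ 0 =
    d i.succ.succ H + (1/2:ℝ) • ((2 * H - aIp hi W W) * W1 i)
     - (1/2:ℝ) • aIp hi W (fun k => bL d h W k i) := by
  rw [K.sy, K.gr0i']

lemma AKundt.d1ip (X Y : Fin m → A) : d 1 (aIp hi X Y) =
    aIp hi (fun i => d 1 (X i)) Y + aIp hi X (fun i => d 1 (Y i)) := by
  simp only [aIp, map_sum, ← Finset.sum_add_distrib]
  refine Finset.sum_congr rfl fun a _ => Finset.sum_congr rfl fun b _ => ?_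
  simp only [Derivation.leibniz, K.hi_r, smul_eq_mul]; ring

lemma AKundt.tG_r (i j k) : d 1 (tGam d h hi i j k) = 0 := by
  rw [tGam, aGam, Derivation.map_smul, map_sum, Finset.sum_eq_zero, smul_zero]
  intro x _
  rw [Derivation.leibniz, K.hi_r, smul_zero, add_zero, map_sub, map_add]
  simp only [dT, K.comm 1, K.h_r, map_zero]
  simp

lemma AKundt.d1nab (X : Fin m → A) (i j) : d 1 (aNab (dT d) (tGam d h hi) X i j) = aNab (dT d) (tGam d h hi) (fun k => d 1 (X k)) i j := by
  simp only [aNab, map_sub, map_sum, Derivation.leibniz, K.tG_r, dT, K.comm 1]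
  simp

/-- metric compatibility for the inner product -/
lemma AKundt.dip (j : Fin m) (X Y : Fin m → A) : d j.succ.succ (aIp hi X Y) =
    aIp hi (fun i => aNab (dT d) (tGam d h hi) X j i) Y + aIp hi X (fun i => aNab (dT d) (tGam d h hi) Y j i) := by
  have e : ∀ a b, d j.succ.succ (hi a b) = - (∑ k, tGam d h hi a j k * hi k b)
      - ∑ k, hi a k * tGam d h hi b j k := fun a b => K.geo.dgi j a b
  have e1 : aIp hi (fun i => ∑ e, tGam d h hi e j i * X e) Y
     = ∑ a, ∑ b, (∑ k, tGam d h hi a j k * hi k b) * X a * Y b := by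
    simp only [aIp, Finset.sum_mul, Finset.mul_sum]
    rw [Finset.sum_comm_cycle]
    refine Finset.sum_congr rfl fun a _ => ?_
    rw [Finset.sum_comm]
    refine Finset.sum_congr rfl fun b _ => Finset.sum_congr rfl fun k _ => by ring
  have e2 : aIp hi X (fun i => ∑ e, tGam d h hi e j i * Y e)
     = ∑ a, ∑ b, (∑ k, hi a k * tGam d h hi b j k) * X a * Y b := by
    simp only [aIp, Finset.sum_mul, Finset.mul_sum]
    refine Finset.sum_congr rfl fun a _ => ?_
    rw [Finset.sum_comm]
    refine Finset.sum_congr rfl fun b _ => Finset.sum_congr rfl fun k _ => by ring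
  have e3 : aIp hi (fun i => aNab (dT d) (tGam d h hi) X j i) Y = aIp hi (fun i => d j.succ.succ (X i)) Y
      - aIp hi (fun i => ∑ e, tGam d h hi e j i * X e) Y := by
    simp only [aIp, aNab, dT, mul_sub, sub_mul, Finset.sum_sub_distrib]
  have e4 : aIp hi X (fun i => aNab (dT d) (tGam d h hi) Y j i) = aIp hi X (fun i => d j.succ.succ (Y i))
      - aIp hi X (fun i => ∑ e, tGam d h hi e j i * Y e) := by
    simp only [aIp, aNab, dT, mul_sub, sub_mul, Finset.sum_sub_distrib]
  rw [e3, e4, e1, e2]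
  simp only [aIp, map_sum, ← Finset.sum_add_distrib, ← Finset.sum_sub_distrib]
  refine Finset.sum_congr rfl fun a _ => Finset.sum_congr rfl fun b _ => ?_
  simp only [Derivation.leibniz, e, smul_eq_mul]; ring

lemma AKundt.bL_nab (k j) : bL d h W k j = d 0 (h k j) + aNab (dT d) (tGam d h hi) W j k - aNab (dT d) (tGam d h hi) W k j := by
  simp only [bL, aNab, dT, K.tsy _ j k]; ring

lemma AKundt.ric11 : aRic d (kGam d h hi W H) 1 1 = 0 := by
  rw [K.ric_eq]
  simp only [sum2, K.g0r, K.g0ar, K.girr, K.grrr, K.girj, K.gijr, K.gr0r, K.grr0, K.gi0r, K.gir0, K.L_r]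
  simp

lemma AKundt.ric1j (j : Fin m) : aRic d (kGam d h hi W H) 1 j.succ.succ = 0 := by
  rw [K.ric_eq]
  simp only [sum2, K.g0r, K.g0ar, K.girr, K.grrr, K.girj, K.gijr, K.gr0r, K.grr0, K.gi0r, K.gir0, K.L_r,
    K.grir, K.grri, K.g0ij, K.g0i0]
  simp [K.W1_r]

lemma AKundt.ric10 : aRic d (kGam d h hi W H) 1 0 = 2 * H2 - (1/2:ℝ) • aIp hi W1 W1 + (1/2:ℝ) • aDv (dT d) (tGam d h hi) hi W1 := by
  rw [K.ric_eq]
  simp only [sum2, K.g0r, K.g0ar, K.girr, K.grrr, K.girj, K.gijr, K.gr0r, K.grr0, K.gi0r, K.gir0, K.L_r,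
    K.grir, K.grri, K.g0ij, K.g0i0, K.g00i, map_sub, Derivation.map_smul, K.d1ip, K.W_r, K.W1_r, K.Hr_r]
  rw [← K.div1]
  have e1 : ∑ x, d (Fin.succ (Fin.succ x)) L * (1/2:ℝ) • aUp hi W1 x = (1/2:ℝ) • ∑ x, d (Fin.succ (Fin.succ x)) L * aUp hi W1 x := by
    rw [Finset.smul_sum]; exact Finset.sum_congr rfl fun _ _ => by algebra
  have e2 : ∑ x, -(1/2:ℝ) • W1 x * (1/2:ℝ) • aUp hi W1 x = -(1/4:ℝ) • aIp hi W1 W1 := by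
    rw [← up_ip, Finset.smul_sum]; exact Finset.sum_congr rfl fun _ _ => by algebra
  have e3 : ∑ x, (1/2:ℝ) • aUp hi W1 x * (1/2:ℝ) • W1 x = (1/4:ℝ) • aIp hi W1 W1 := by
    rw [← up_ip, Finset.smul_sum]; exact Finset.sum_congr rfl fun _ _ => by algebra
  have e4 : aIp hi W (fun _ => 0) = 0 := by simp [aIp]
  simp [e1, e2, e3, e4, Finset.sum_add_distrib, ← Finset.smul_sum, up_ip, K.up_ip']
  algebra

lemma AKundt.ricij (i j : Fin m) : aRic d (kGam d h hi W H) j.succ.succ i.succ.succ = aRic (dT d) (tGam d h hi) j i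
    + (1/2:ℝ) • (aNab (dT d) (tGam d h hi) W1 i j + aNab (dT d) (tGam d h hi) W1 j i) - (1/2:ℝ) • (W1 i * W1 j) := by
  rw [K.ric_eq, K.tric_eq]
  have e : (fun k => d 1 (W k)) = W1 := funext K.W_r
  simp only [sum2, K.g0r, K.g0ar, K.girr, K.grrr, K.girj, K.gijr, K.L_r,
    K.grir, K.grri, K.g0ij, K.g0i0, K.g00i, K.gijk, K.grij, map_sub, map_add, Derivation.map_smul, K.d1nab, e, K.comm 1, K.h_r]
  simp [dT]
  algebra

end AbsRic

section AbsRic2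

variable {A : Type*} [CommRing A] [Algebra ℝ A] {m : ℕ}
variable {d : Fin (m+2) → Derivation ℝ A A} {h hi : Matrix (Fin m) (Fin m) A}
    {W W1 : Fin m → A} {H Hr H2 L : A}

variable (K : AKundt d h hi W W1 H Hr H2 L)
include K

lemma AKundt.d1bL (k j : Fin m) : d 1 (bL d h W k j) =
    aNab (dT d) (tGam d h hi) W1 j k - aNab (dT d) (tGam d h hi) W1 k j := by
  have e : aNab (dT d) (tGam d h hi) W1 j k - aNab (dT d) (tGam d h hi) W1 k j
     = d j.succ.succ (W1 k) - d k.succ.succ (W1 j) := by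
    simp only [aNab, dT, K.tsy _ j k]; ring
  rw [e, bL, map_sub, map_add, K.comm 1, K.comm 1, K.comm 1, K.h_r, K.W_r, K.W_r, map_zero]
  ring

lemma AKundt.divmul (X : Fin m → A) (c : A) :
    (∑ i, d (Fin.succ (Fin.succ i)) (aUp hi X i * c)) + ∑ k, d (Fin.succ (Fin.succ k)) L * (aUp hi X k * c)
    = aDv (dT d) (tGam d h hi) hi X * c + aIp hi X (fun i => d i.succ.succ c) := by
  rw [← K.div1, ← K.up_ip', add_mul, Finset.sum_mul, Finset.sum_mul, ← Finset.sum_add_distrib,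
    ← Finset.sum_add_distrib, ← Finset.sum_add_distrib]
  refine Finset.sum_congr rfl fun i _ => ?_
  rw [Derivation.leibniz, smul_eq_mul, smul_eq_mul]; ring

lemma AKundt.ricj0 (j : Fin m) : aRic d (kGam d h hi W H) j.succ.succ 0 =
    d j.succ.succ Hr - (1/2:ℝ) • d 0 (W1 j) - d 0 (d j.succ.succ L) - (1/2:ℝ) • (d 0 L * W1 j)
    - (1/2:ℝ) • (aIp hi W W1 * W1 j) + (1/2:ℝ) • (aDv (dT d) (tGam d h hi) hi W * W1 j)
    + (1/2:ℝ) • aDv2 (dT d) (tGam d h hi) hi (bL d h W) j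
    - (1/2:ℝ) • d j.succ.succ (aIp hi W W1)
    + aIp hi W (fun k => aNab (dT d) (tGam d h hi) W1 k j) := by
  have P1 : ∑ a, d a (kGam d h hi W H a 0 j.succ.succ) =
      - (1/2:ℝ) • d 0 (W1 j) + (d j.succ.succ Hr + (Hr - aIp hi W W1) * W1 j
        - (1/2:ℝ) • (aIp hi W1 (fun k => bL d h W k j) + aIp hi W (fun k =>
             aNab (dT d) (tGam d h hi) W1 j k - aNab (dT d) (tGam d h hi) W1 k j)))
        + (1/2:ℝ) • ((∑ i, d (Fin.succ (Fin.succ i)) (aUp hi (fun k => bL d h W k j) i))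
          + ∑ i, d (Fin.succ (Fin.succ i)) (aUp hi W i * W1 j)) := by
    have e : (fun k => d 1 (W k)) = W1 := funext K.W_r
    rw [sum2, K.g00i, K.gr0i', ← Finset.sum_add_distrib, Finset.smul_sum]
    congr 1
    · rw [Derivation.map_smul, map_sub, map_add, Derivation.map_smul, Derivation.map_smul, K.d1ip,
        Derivation.leibniz, map_sub, K.d1ip, K.comm 1, K.H_r, K.W1_r, Derivation.leibniz, K.H_r, d_two, e]
      simp only [K.d1bL, smul_eq_mul]
      rw [K.geo.ip_comm W1 W]
      algebra
    · refine Finset.sum_congr rfl fun i _ => ?_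
      rw [K.gi0j', Derivation.map_smul, map_add]
  have P2 : ∑ a, d a L * kGam d h hi W H a 0 j.succ.succ =
      - (1/2:ℝ) • (d 0 L * W1 j) + (1/2:ℝ) • ((∑ i, d (Fin.succ (Fin.succ i)) L * aUp hi (fun k => bL d h W k j) i)
          + ∑ i, d (Fin.succ (Fin.succ i)) L * (aUp hi W i * W1 j)) := by
    rw [sum2, K.g00i, K.L_r, ← Finset.sum_add_distrib, Finset.smul_sum, zero_mul, add_zero]
    congr 1
    · algebra
    · refine Finset.sum_congr rfl fun i _ => ?_
      rw [K.gi0j']; algebra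
  have P3 : ∑ a, ∑ k, kGam d h hi W H a 0 k * kGam d h hi W H k a j.succ.succ =
      Hr * W1 j - (1/2:ℝ) • (aIp hi W W1 * W1 j) - (1/4:ℝ) • aIp hi W1 (fun k => bL d h W k j)
      + (1/4:ℝ) • aIp hi W1 (fun k => aNab (dT d) (tGam d h hi) W k j + aNab (dT d) (tGam d h hi) W j k - d 0 (h k j))
      + (1/2:ℝ) • ((∑ a, ∑ k, tGam d h hi a j k * aUp hi (fun l => bL d h W l a) k)
        + aIp hi W (fun k => ∑ e, tGam d h hi e k j * W1 e)) := by
    simp only [sum2, K.g000, K.g0r, K.g0ar, K.girr, K.grrr, K.girj, K.gijr, K.gr0r, K.grr0, K.gi0r, K.gir0,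
      K.grir, K.grri, K.g0ij, K.g0i0, K.g00i, K.gijk, K.gi0j', K.grij]
    have e1 : ∑ x, -(1/2:ℝ) • W1 x * (1/2:ℝ) • (aUp hi (fun k => bL d h W k j) x + aUp hi W x * W1 j)
      = -(1/4:ℝ) • (aIp hi W1 (fun k => bL d h W k j) + aIp hi W W1 * W1 j) := by
      rw [K.geo.ip_comm W W1, ← up_ip, ← up_ip, Finset.sum_mul, ← Finset.sum_add_distrib, Finset.smul_sum]
      exact Finset.sum_congr rfl fun _ _ => by algebra
    have e2 : ∑ x, (1/2:ℝ) • aUp hi W1 x * (1/2:ℝ) • (aNab (dT d) (tGam d h hi) W x j + aNab (dT d) (tGam d h hi) W j x - d 0 (h x j))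
      = (1/4:ℝ) • aIp hi W1 (fun k => aNab (dT d) (tGam d h hi) W k j + aNab (dT d) (tGam d h hi) W j k - d 0 (h k j)) := by
      rw [← K.up_ip', Finset.smul_sum]
      exact Finset.sum_congr rfl fun _ _ => by algebra
    have e3 : ∑ x, ∑ y, (1/2:ℝ) • (aUp hi (fun k => bL d h W k y) x + aUp hi W x * W1 y) * tGam d h hi y x j
      = (1/2:ℝ) • ((∑ a, ∑ k, tGam d h hi a j k * aUp hi (fun l => bL d h W l a) k)
        + aIp hi W (fun k => ∑ e, tGam d h hi e k j * W1 e)) := by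
      rw [← K.up_ip', Finset.sum_comm, smul_add]
      simp only [Finset.mul_sum, Finset.smul_sum]
      conv_rhs => enter [2]; rw [Finset.sum_comm]
      rw [← Finset.sum_add_distrib]
      refine Finset.sum_congr rfl fun a _ => ?_
      rw [← Finset.sum_add_distrib]
      refine Finset.sum_congr rfl fun b _ => ?_
      rw [K.tsy a j b]; algebra
    simp only [mul_zero, zero_mul, Finset.sum_const_zero, add_zero, zero_add, Finset.sum_add_distrib, e1, e2, e3]
    algebra
  rw [K.ric_eq, P1, P2, P3, K.dip]
  have D2 := K.div2 (bL d h W) j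
  have DM := K.divmul W (W1 j)
  have c1 : aIp hi W1 (fun k => bL d h W k j) + aIp hi W1 (fun k => aNab (dT d) (tGam d h hi) W k j + aNab (dT d) (tGam d h hi) W j k - d 0 (h k j))
     = (2:ℝ) • aIp hi (fun k => aNab (dT d) (tGam d h hi) W j k) W1 := by
    rw [K.geo.ip_comm _ W1, ← ip_add, ← ip_smul]
    refine ip_congr _ fun i => ?_
    rw [K.bL_nab]; algebra
  have c2 : aIp hi W (fun k => aNab (dT d) (tGam d h hi) W1 k j) = aIp hi W (fun k => d k.succ.succ (W1 j))
     - aIp hi W (fun k => ∑ e, tGam d h hi e k j * W1 e) := by rw [← ip_sub]; rfl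
  rw [ip_sub]
  linear_combination (norm := algebra) (1/2:ℝ) • D2 + (1/2:ℝ) • DM - (1/4:ℝ) • c1 - (1/2:ℝ) • c2

lemma AKundt.ric00 : aRic d (kGam d h hi W H) 0 0 =
    (2 * H - aIp hi W W) * (2 * H2 - (1/2:ℝ) • aIp hi W1 W1) - aIp hi W1 (fun i => d i.succ.succ H)
    - aIp hi W (fun i => d 0 (W1 i)) + 2 * aIp hi W (fun i => d i.succ.succ Hr)
    + aDv (dT d) (tGam d h hi) hi (fun j => d 0 (W j) - d j.succ.succ H)
    + aDv (dT d) (tGam d h hi) hi W * Hr - d 0 (d 0 L) - d 0 L * Hr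
    - (1/2:ℝ) • (aIp hi W W1)^2
    - (1/4:ℝ) • (∑ a, ∑ b, aUp hi (fun k => bL d h W k a) b * aUp hi (fun k => bL d h W k b) a)
    + (1/2:ℝ) • aIp hi W1 (fun k => aIp hi W (fun l => bL d h W l k - bL d h W k l)) := by
  have e : (fun k => d 1 (W k)) = W1 := funext K.W_r
  set X : Fin m → A := fun j => d 0 (W j) - d j.succ.succ H with hX
  have gX : ∀ i : Fin m, kGam d h hi W H i.succ.succ 0 0 = aUp hi X i + aUp hi W i * Hr := K.gi00
  have P1 : ∑ a, d a (kGam d h hi W H a 0 0) =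
      - d 0 Hr + (d 0 Hr + (2 * Hr - 2 * aIp hi W W1) * Hr + (2 * H - aIp hi W W) * (2 * H2)
       - aIp hi W1 X - aIp hi W (fun i => d 0 (W1 i)) + aIp hi W (fun i => d i.succ.succ Hr))
        + ((∑ i, d (Fin.succ (Fin.succ i)) (aUp hi X i))
          + ∑ i, d (Fin.succ (Fin.succ i)) (aUp hi W i * Hr)) := by
    rw [sum2, K.g000, K.gr00, ← Finset.sum_add_distrib, map_neg]
    have e1 : (fun i => d 1 (d 0 (W i) - d i.succ.succ H)) = fun i => d 0 (W1 i) - d i.succ.succ Hr := by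
      funext i; rw [map_sub, K.comm 1, K.comm 1, K.W_r, K.H_r]
    congr 1
    · rw [map_sub, map_add, K.d1ip,
        Derivation.leibniz, map_sub, K.d1ip, K.comm 1, K.H_r, K.Hr_r, Derivation.leibniz, K.H_r, d_two, e, e1]
      simp only [hX, ip_sub, smul_eq_mul]
      rw [K.geo.ip_comm W1 W]
      algebra
    · refine Finset.sum_congr rfl fun i _ => ?_
      rw [K.gi00, map_add]
  have P2 : ∑ a, d a L * kGam d h hi W H a 0 0 =
      - (d 0 L * Hr) + ((∑ i, d (Fin.succ (Fin.succ i)) L * aUp hi X i)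
          + ∑ i, d (Fin.succ (Fin.succ i)) L * (aUp hi W i * Hr)) := by
    rw [sum2, K.g000, K.L_r, ← Finset.sum_add_distrib, zero_mul, add_zero]
    congr 1
    · ring
    · refine Finset.sum_congr rfl fun i _ => ?_
      rw [K.gi00]; ring
  have P3 : ∑ a, ∑ k, kGam d h hi W H a 0 k * kGam d h hi W H k a 0 =
      Hr^2 - aIp hi W1 X - aIp hi W W1 * Hr + (Hr - (1/2:ℝ) • aIp hi W W1)^2
      + aIp hi W1 (fun i => d i.succ.succ H) + (1/2:ℝ) • ((2 * H - aIp hi W W) * aIp hi W1 W1)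
      - (1/2:ℝ) • aIp hi W1 (fun i => aIp hi W (fun k => bL d h W k i))
      + (1/4:ℝ) • ((∑ a, ∑ b, aUp hi (fun k => bL d h W k a) b * aUp hi (fun k => bL d h W k b) a)
        + 2 * aIp hi W1 (fun k => aIp hi W (fun l => bL d h W k l)) + (aIp hi W W1)^2) := by
    simp only [sum2, K.g000, K.g0r, K.g0ar, K.girr, K.grrr, K.girj, K.gijr, K.gr0r, K.grr0, K.gi0r, K.gir0,
      K.grir, K.grri, K.g0ij, K.g0i0, K.g00i, K.gijk, K.gi0j', K.gij0, gX, K.gr0i', K.gri0]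
    have e1 : ∑ x, -(1/2:ℝ) • W1 x * (aUp hi X x + aUp hi W x * Hr)
      = -(1/2:ℝ) • (aIp hi W1 X + aIp hi W W1 * Hr) := by
      rw [K.geo.ip_comm W W1, ← up_ip, ← up_ip, Finset.sum_mul, ← Finset.sum_add_distrib, Finset.smul_sum]
      exact Finset.sum_congr rfl fun _ _ => by algebra
    have e1' : ∑ x, (aUp hi X x + aUp hi W x * Hr) * -(1/2:ℝ) • W1 x
      = -(1/2:ℝ) • (aIp hi W1 X + aIp hi W W1 * Hr) := by
      rw [← e1]; exact Finset.sum_congr rfl fun _ _ => by ring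
    have e2 : ∑ x, (d (Fin.succ (Fin.succ x)) H + (1/2:ℝ) • ((2 * H - aIp hi W W) * W1 x)
        - (1/2:ℝ) • aIp hi W (fun k => bL d h W k x)) * (1/2:ℝ) • aUp hi W1 x
      = (1/2:ℝ) • (aIp hi W1 (fun i => d i.succ.succ H) + (1/2:ℝ) • (aIp hi W1 W1 * (2 * H - aIp hi W W))
         - (1/2:ℝ) • aIp hi W1 (fun i => aIp hi W (fun k => bL d h W k i))) := by
      rw [← ip_mul, ← ip_smul, ← ip_smul, ← ip_add, ← ip_sub, ← K.up_ip' W1, Finset.smul_sum]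
      exact Finset.sum_congr rfl fun _ _ => by algebra
    have e2' : ∑ x, (1/2:ℝ) • aUp hi W1 x * (d (Fin.succ (Fin.succ x)) H + (1/2:ℝ) • ((2 * H - aIp hi W W) * W1 x)
        - (1/2:ℝ) • aIp hi W (fun k => bL d h W k x))
      = (1/2:ℝ) • (aIp hi W1 (fun i => d i.succ.succ H) + (1/2:ℝ) • (aIp hi W1 W1 * (2 * H - aIp hi W W))
         - (1/2:ℝ) • aIp hi W1 (fun i => aIp hi W (fun k => bL d h W k i))) := by
      rw [← e2]; exact Finset.sum_congr rfl fun _ _ => by ring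
    have q : ∑ x, ∑ y, aUp hi (fun k => bL d h W k y) x * (aUp hi W y * W1 x)
        = aIp hi W1 (fun k => aIp hi W (fun l => bL d h W k l)) := by
      have qq : ∀ y, aIp hi W1 (fun k => bL d h W k y) = ∑ x, aUp hi (fun k => bL d h W k y) x * W1 x := by
        intro y; rw [← up_ip]; exact Finset.sum_congr rfl fun _ _ => by ring
      have q1 : aIp hi W1 (fun k => aIp hi W (fun l => bL d h W k l)) = aIp hi W (fun l => aIp hi W1 (fun k => bL d h W k l)) := by
        rw [← K.up_ip', ← K.up_ip']
        simp only [← K.up_ip' W, ← K.up_ip' W1, Finset.mul_sum]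
        rw [Finset.sum_comm]
        exact Finset.sum_congr rfl fun _ _ => Finset.sum_congr rfl fun _ _ => by ring
      rw [q1, ← K.up_ip', Finset.sum_comm]
      refine Finset.sum_congr rfl fun x _ => ?_
      rw [qq, Finset.mul_sum]
      exact Finset.sum_congr rfl fun _ _ => by ring
    have e3 : ∑ x, ∑ y, (1/2:ℝ) • (aUp hi (fun k => bL d h W k y) x + aUp hi W x * W1 y) *
         (1/2:ℝ) • (aUp hi (fun k => bL d h W k x) y + aUp hi W y * W1 x)
      = (1/4:ℝ) • ((∑ a, ∑ b, aUp hi (fun k => bL d h W k a) b * aUp hi (fun k => bL d h W k b) a)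
        + 2 * aIp hi W1 (fun k => aIp hi W (fun l => bL d h W k l)) + (aIp hi W W1)^2) := by
      have q' := q
      rw [Finset.sum_comm] at q'
      rw [two_mul, ← add_assoc]
      nth_rewrite 1 [← q]
      rw [← q', sq, ← K.up_ip', Finset.sum_mul_sum]
      simp only [← Finset.sum_add_distrib, Finset.smul_sum]
      exact Finset.sum_congr rfl fun _ _ => Finset.sum_congr rfl fun _ _ => by algebra
    simp only [mul_zero, zero_mul, Finset.sum_const_zero, add_zero, zero_add, Finset.sum_add_distrib, e1, e2, e3, e1', e2']
    algebra
  rw [K.ric_eq, P1, P2, P3]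
  have D1 := K.div1 X
  have DM := K.divmul W Hr
  simp only [ip_sub]
  linear_combination (norm := algebra) D1 + DM

end AbsRic2

section AbsMain

variable {A : Type*} [CommRing A] [Algebra ℝ A] {m : ℕ}
variable {d : Fin (m+2) → Derivation ℝ A A} {h hi : Matrix (Fin m) (Fin m) A}
    {W W1 : Fin m → A} {H Hr H2 L : A}

lemma smul_inj2 {x : A} (e : (2:ℝ) • x = 0) : x = 0 := by
  have h3 := congrArg (fun z => (1/2:ℝ) • z) e
  simpa [smul_smul] using h3

lemma dv2_add (T S : Fin m → Fin m → A) (a) : aDv2 (dT d) (tGam d h hi) hi (fun i j => T i j + S i j) a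
    = aDv2 (dT d) (tGam d h hi) hi T a + aDv2 (dT d) (tGam d h hi) hi S a := by
  simp only [aDv2, aCov2, map_add, mul_add, Finset.sum_add_distrib, mul_sub, Finset.sum_sub_distrib]; ring

lemma dv2_smul (c : ℝ) (T : Fin m → Fin m → A) (a) : aDv2 (dT d) (tGam d h hi) hi (fun i j => c • T i j) a
    = c • aDv2 (dT d) (tGam d h hi) hi T a := by
  simp only [aDv2, aCov2, Derivation.map_smul, mul_smul_comm, ← Finset.smul_sum, ← smul_add, ← smul_sub]

lemma dv_sub (X Y : Fin m → A) : aDv (dT d) (tGam d h hi) hi (fun i => X i - Y i)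
    = aDv (dT d) (tGam d h hi) hi X - aDv (dT d) (tGam d h hi) hi Y := by
  simp only [aDv, aNab, map_sub, mul_sub, Finset.sum_sub_distrib]; ring

variable (K : AKundt d h hi W W1 H Hr H2 L)
include K

lemma AKundt.dv2_h (a) : aDv2 (dT d) (tGam d h hi) hi (fun i j => h i j) a = 0 := by
  have e : ∀ c b, aCov2 (dT d) (tGam d h hi) (fun i j => h i j) c b a = 0 := by
    intro c b
    have := congrFun (congrFun (K.geo.compat c) b) a
    simp only [dM, gM, Matrix.add_apply, Matrix.mul_apply, Matrix.transpose_apply] at this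
    unfold aCov2
    rw [this]
    simp only [tGam]
    rw [sub_eq_zero]
    congr 1
    exact Finset.sum_congr rfl fun _ _ => by ring
  simp only [aDv2, e, mul_zero, Finset.sum_const_zero]

lemma AKundt.dv2_mul (X : Fin m → A) (a) : aDv2 (dT d) (tGam d h hi) hi (fun i j => X i * X j) a
    = aDv (dT d) (tGam d h hi) hi X * X a + aIp hi X (fun k => aNab (dT d) (tGam d h hi) X k a) := by
  have e : ∀ c b, aCov2 (dT d) (tGam d h hi) (fun i j => X i * X j) c b a
     = aNab (dT d) (tGam d h hi) X c b * X a + X b * aNab (dT d) (tGam d h hi) X c a := by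
    intro c b
    simp only [aCov2, aNab, Derivation.leibniz, smul_eq_mul, sub_mul, mul_sub, Finset.mul_sum, Finset.sum_mul]
    have : ∑ e, tGam d h hi e c a * (X b * X e) = ∑ e, X b * (tGam d h hi e c a * X e) :=
      Finset.sum_congr rfl fun _ _ => by ring
    rw [this]
    simp only [mul_assoc]; ring
  simp only [aDv2, e, aDv, aIp, mul_add, Finset.sum_add_distrib, Finset.sum_mul]
  congr 1
  · rw [Finset.sum_comm]
    exact Finset.sum_congr rfl fun _ _ => Finset.sum_congr rfl fun _ _ => by rw [K.geo.gis]; ring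
  · exact Finset.sum_congr rfl fun _ _ => Finset.sum_congr rfl fun _ _ => by ring

/-- the equation (i) -/
def E1 (d : Fin (m+2) → Derivation ℝ A A) (h hi : Matrix (Fin m) (Fin m) A) (W1 : Fin m → A) (lam : ℝ) : Prop :=
  ∀ i j, aRic (dT d) (tGam d h hi) i j = lam • h i j + (1/2:ℝ) • (W1 i * W1 j)
    - (1/2:ℝ) • (aNab (dT d) (tGam d h hi) W1 j i + aNab (dT d) (tGam d h hi) W1 i j)

lemma AKundt.trE1 {lam : ℝ} (e : E1 d h hi W1 lam) :
    ∑ i, ∑ j, hi i j * aRic (dT d) (tGam d h hi) i j = (lam * m) • (1:A) + (1/2:ℝ) • aIp hi W1 W1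
      - aDv (dT d) (tGam d h hi) hi W1 := by
  have e0 : ∑ i, ∑ j, hi i j * h i j = (m:ℝ) • (1:A) := by
    have : ∀ i, ∑ j, hi i j * h i j = 1 := by
      intro i
      have := congrFun (congrFun K.geo.inv i) i
      rw [Matrix.mul_apply, Matrix.one_apply_eq] at this
      rw [← this]; exact Finset.sum_congr rfl fun j _ => by rw [K.geo.gs i j]
    simp only [this, Finset.sum_const, Finset.card_univ, Fintype.card_fin]
    rw [Nat.cast_smul_eq_nsmul]
  have e1 : ∑ i, ∑ j, hi i j * aNab (dT d) (tGam d h hi) W1 j i = aDv (dT d) (tGam d h hi) hi W1 := by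
    rw [aDv, Finset.sum_comm]
    exact Finset.sum_congr rfl fun _ _ => Finset.sum_congr rfl fun _ _ => by rw [K.geo.gis]
  have e2 : ∑ i, ∑ j, hi i j * aRic (dT d) (tGam d h hi) i j = lam • (∑ i, ∑ j, hi i j * h i j)
     + (1/2:ℝ) • aIp hi W1 W1 - (1/2:ℝ) • ((∑ i, ∑ j, hi i j * aNab (dT d) (tGam d h hi) W1 j i) +
        aDv (dT d) (tGam d h hi) hi W1) := by
    simp only [aIp, aDv, Finset.smul_sum, ← Finset.sum_add_distrib, ← Finset.sum_sub_distrib]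
    exact Finset.sum_congr rfl fun i _ => Finset.sum_congr rfl fun j _ => by rw [e i j]; algebra
  rw [e2, e0, e1]
  algebra

lemma AKundt.bianchiE1 {lam : ℝ} (e : E1 d h hi W1 lam) (a : Fin m) :
    aDv (dT d) (tGam d h hi) hi W1 * W1 a + aIp hi W1 (fun k => aNab (dT d) (tGam d h hi) W1 k a)
     - aDv2 (dT d) (tGam d h hi) hi (fun b a => aNab (dT d) (tGam d h hi) W1 b a) a
     - aDv2 (dT d) (tGam d h hi) hi (fun b a => aNab (dT d) (tGam d h hi) W1 a b) a
     = (1/2:ℝ) • d a.succ.succ (aIp hi W1 W1) - d a.succ.succ (aDv (dT d) (tGam d h hi) hi W1) := by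
  have B := K.geo.bianchi2 a
  rw [← tGam, K.trE1 e] at B
  have eR : aRic (dT d) (tGam d h hi) = fun i j => (lam • h i j + (1/2:ℝ) • (W1 i * W1 j))
    + ((-1/2:ℝ) • aNab (dT d) (tGam d h hi) W1 i j + (-1/2:ℝ) • aNab (dT d) (tGam d h hi) W1 j i) := by
    funext i j; rw [e i j]; algebra
  rw [eR, dv2_add, dv2_add, dv2_add] at B
  rw [dv2_smul lam (fun i j => h i j), dv2_smul, dv2_smul, dv2_smul, K.dv2_mul] at B
  rw [K.dv2_h a, map_sub, map_add, Derivation.map_smul, Derivation.map_smul, Derivation.map_one_eq_zero] at B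
  simp only [dT] at B ⊢
  linear_combination (norm := algebra) B

/-- the equation (iii) -/
def E3 (d : Fin (m+2) → Derivation ℝ A A) (h hi : Matrix (Fin m) (Fin m) A) (W1 : Fin m → A) (lam : ℝ) : Prop :=
  ∀ a, aDv2 (dT d) (tGam d h hi) hi (fun b a => aNab (dT d) (tGam d h hi) W1 b a) a
    = (1/2:ℝ) • (3 * aIp hi W1 (fun k => aNab (dT d) (tGam d h hi) W1 k a)
        - aIp hi W1 (fun k => aNab (dT d) (tGam d h hi) W1 a k))
      + W1 a * (aDv (dT d) (tGam d h hi) hi W1 - (1/2:ℝ) • aIp hi W1 W1 - lam • (1:A))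

lemma AKundt.d1dv (X : Fin m → A) : d 1 (aDv (dT d) (tGam d h hi) hi X)
    = aDv (dT d) (tGam d h hi) hi (fun i => d 1 (X i)) := by
  simp only [aDv, map_sum, Derivation.leibniz, K.hi_r, K.d1nab]
  simp

lemma AKundt.d1dv2 (T : Fin m → Fin m → A) (a) : d 1 (aDv2 (dT d) (tGam d h hi) hi T a)
    = aDv2 (dT d) (tGam d h hi) hi (fun i j => d 1 (T i j)) a := by
  simp only [aDv2, aCov2, map_sum, map_sub, map_add, Derivation.leibniz, K.hi_r, K.tG_r, dT, K.comm 1]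
  simp

lemma AKundt.d1E0 (lam : ℝ) (j : Fin m) :
    d 1 (aRic d (kGam d h hi W H) j.succ.succ 0 - lam • W j) =
    2 * d j.succ.succ H2 - (1/2:ℝ) • (aIp hi W1 W1 * W1 j) + (1/2:ℝ) • (aDv (dT d) (tGam d h hi) hi W1 * W1 j)
    + (1/2:ℝ) • (aDv2 (dT d) (tGam d h hi) hi (fun b a => aNab (dT d) (tGam d h hi) W1 a b) j
       - aDv2 (dT d) (tGam d h hi) hi (fun b a => aNab (dT d) (tGam d h hi) W1 b a) j)
    - (1/2:ℝ) • d j.succ.succ (aIp hi W1 W1)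
    + aIp hi W1 (fun k => aNab (dT d) (tGam d h hi) W1 k j) - lam • W1 j := by
  have e : (fun k => d 1 (W k)) = W1 := funext K.W_r
  have e0 : (fun k => d 1 (W1 k)) = fun _ => 0 := funext K.W1_r
  have z : ∀ X : Fin m → A, aIp hi X (fun _ => 0) = 0 := fun X => by simp [aIp]
  have z2 : (fun k => aNab (dT d) (tGam d h hi) (fun _ => (0:A)) k j) = fun _ => 0 := by
    funext k; simp [aNab]
  rw [K.ricj0]
  simp only [map_sub, map_add, Derivation.map_smul, K.comm 1, Derivation.leibniz, K.L_r, K.W1_r, K.Hr_r,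
    K.d1ip, K.d1dv, K.d1dv2, K.d1bL, e, e0, z, K.d1nab, z2, K.W_r, d_two, map_zero, smul_eq_mul]
  have : (fun i j => aNab (dT d) (tGam d h hi) W1 j i - aNab (dT d) (tGam d h hi) W1 i j) =
    fun i j => aNab (dT d) (tGam d h hi) W1 j i + (-1:ℝ) • aNab (dT d) (tGam d h hi) W1 i j := by
    funext i j; algebra
  rw [this, dv2_add, dv2_smul]
  algebra

/-- the `01` equation -/
def E2 (d : Fin (m+2) → Derivation ℝ A A) (h hi : Matrix (Fin m) (Fin m) A) (W1 : Fin m → A) (H2 : A) (lam : ℝ) : Prop :=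
  2 * H2 = (1/2:ℝ) • (∑ i, ∑ j, hi i j * aRic (dT d) (tGam d h hi) i j) - (((m:ℝ) - 2)/2 * lam) • (1:A)
     + (1/4:ℝ) • aIp hi W1 W1

lemma AKundt.e2_iff {lam : ℝ} (e : E1 d h hi W1 lam) :
    E2 d h hi W1 H2 lam ↔ aRic d (kGam d h hi W H) 1 0 = lam • (1:A) := by
  rw [E2, K.trE1 e, K.ric10]
  constructor
  · intro q; linear_combination (norm := algebra) q
  · intro q; linear_combination (norm := algebra) q

lemma AKundt.e3_iff {lam : ℝ} (e : E1 d h hi W1 lam) (e2 : aRic d (kGam d h hi W H) 1 0 = lam • (1:A)) :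
    E3 d h hi W1 lam ↔ ∀ j : Fin m, d 1 (aRic d (kGam d h hi W H) j.succ.succ 0 - lam • W j) = 0 := by
  refine forall_congr' fun a => ?_
  rw [K.d1E0]
  have B := K.bianchiE1 e a
  rw [K.ric10] at e2
  have q := congrArg (d a.succ.succ) e2
  rw [map_add, map_sub, Derivation.leibniz, Derivation.map_smul, Derivation.map_smul, Derivation.map_smul,
    d_two, Derivation.map_one_eq_zero, smul_eq_mul, smul_zero, smul_zero, add_zero] at q
  have p := K.dip a W1 W1
  rw [K.geo.ip_comm (fun i => aNab (dT d) (tGam d h hi) W1 a i) W1] at p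
  rw [p] at B q ⊢
  constructor
  · intro z
    linear_combination (norm := algebra) q - (1/2:ℝ) • B - z
  · intro z
    linear_combination (norm := algebra) q - (1/2:ℝ) • B - z

end AbsMain

section AbsRho

variable {A : Type*} [CommRing A] [Algebra ℝ A] {m : ℕ}
variable {d : Fin (m+2) → Derivation ℝ A A} {h hi : Matrix (Fin m) (Fin m) A}
    {W W1 W0 : Fin m → A} {H Hr H2 L H0 H1 : A}

/-- restriction to `r = 0` -/
structure ARho (ρ : A →ₐ[ℝ] A) (d : Fin (m+2) → Derivation ℝ A A) (W W0 : Fin m → A) (H Hr H0 H1 : A) : Prop where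
  fix : ∀ f, d 1 f = 0 → ρ f = f
  com : ∀ a, a ≠ 1 → ∀ f, ρ (d a f) = d a (ρ f)
  w : ∀ i, ρ (W i) = W0 i
  h0 : ρ H = H0
  h1 : ρ Hr = H1

variable {ρ : A →ₐ[ℝ] A}
variable (K : AKundt d h hi W W1 H Hr H2 L) (P : ARho ρ d W W0 H Hr H0 H1)

lemma ss_ne1 (i : Fin m) : (i.succ.succ : Fin (m+2)) ≠ 1 := by
  intro h; have := congrArg Fin.val h; simp at this

lemma ARho.cs (P : ARho ρ d W W0 H Hr H0 H1) (i : Fin m) (f : A) : ρ (d i.succ.succ f) = d i.succ.succ (ρ f) :=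
  P.com _ (ss_ne1 i) f

lemma ARho.c0 (P : ARho ρ d W W0 H Hr H0 H1) (f : A) : ρ (d 0 f) = d 0 (ρ f) :=
  P.com _ (by simp) f

include K P

lemma AKundt.rho_ip (X Y : Fin m → A) : ρ (aIp hi X Y) = aIp hi (fun i => ρ (X i)) (fun i => ρ (Y i)) := by
  simp only [aIp, map_sum, map_mul, P.fix _ (K.hi_r _ _)]

lemma AKundt.rho_up (X : Fin m → A) (i) : ρ (aUp hi X i) = aUp hi (fun i => ρ (X i)) i := by
  simp only [aUp, map_sum, map_mul, P.fix _ (K.hi_r _ _)]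

lemma AKundt.rho_nab (X : Fin m → A) (b a) : ρ (aNab (dT d) (tGam d h hi) X b a) =
    aNab (dT d) (tGam d h hi) (fun i => ρ (X i)) b a := by
  simp only [aNab, map_sub, map_sum, map_mul, P.fix _ (K.tG_r _ _ _), dT, P.cs]

lemma AKundt.rho_dv (X : Fin m → A) : ρ (aDv (dT d) (tGam d h hi) hi X) =
    aDv (dT d) (tGam d h hi) hi (fun i => ρ (X i)) := by
  simp only [aDv, map_sum, map_mul, P.fix _ (K.hi_r _ _), K.rho_nab P]

lemma AKundt.rho_dv2 (T : Fin m → Fin m → A) (a) : ρ (aDv2 (dT d) (tGam d h hi) hi T a) =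
    aDv2 (dT d) (tGam d h hi) hi (fun i j => ρ (T i j)) a := by
  simp only [aDv2, aCov2, map_sub, map_add, map_sum, map_mul, P.fix _ (K.hi_r _ _), P.fix _ (K.tG_r _ _ _), dT, P.cs]

lemma AKundt.rho_bL (i j) : ρ (bL d h W i j) = bL d h W0 i j := by
  simp only [bL, map_sub, map_add, P.c0, P.cs, P.w, P.fix _ (K.h_r _ _)]

omit P in
lemma AKundt.bL_nab' (X : Fin m → A) (k j) : bL d h X k j = d 0 (h k j) + aNab (dT d) (tGam d h hi) X j k - aNab (dT d) (tGam d h hi) X k j := by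
  simp only [bL, aNab, dT, K.tsy _ j k]; ring

omit K P in
/-- the equation (iv) -/
def E4 (d : Fin (m+2) → Derivation ℝ A A) (h hi : Matrix (Fin m) (Fin m) A) (W1 W0 : Fin m → A) (H1 L : A)
    (lam : ℝ) (a : Fin m) : Prop :=
  2 * d a.succ.succ H1 = - (∑ b, ∑ c, hi b c * aCov2 (dT d) (tGam d h hi) (fun i j => d 0 (h i j)) c a b)
    + (∑ b, ∑ c, hi b c * (aCov2 (dT d) (tGam d h hi) (fun i j => aNab (dT d) (tGam d h hi) W0 i j) c b a
        - aCov2 (dT d) (tGam d h hi) (fun i j => aNab (dT d) (tGam d h hi) W0 i j) c a b))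
    - 2 * (∑ b, ∑ c, hi b c * W0 c * aNab (dT d) (tGam d h hi) W1 b a)
    + d a.succ.succ (aIp hi W0 W1) + d 0 (W1 a) + 2 * d a.succ.succ (d 0 L)
    + W1 a * (aIp hi W0 W1 - aDv (dT d) (tGam d h hi) hi W0 + d 0 L) + (2 * lam) • W0 a

lemma AKundt.e4_iff (lam : ℝ) (a : Fin m) : E4 d h hi W1 W0 H1 L lam a ↔
    ρ (aRic d (kGam d h hi W H) a.succ.succ 0 - lam • W a) = 0 := by
  have e : (fun k => ρ (W k)) = W0 := funext P.w
  have e1 : (fun k => ρ (W1 k)) = W1 := funext fun k => P.fix _ (K.W1_r k)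
  have e1' : ρ (W1 a) = W1 a := P.fix _ (K.W1_r a)
  have eL : ρ L = L := P.fix _ K.L_r
  have eB : (fun i j => ρ (bL d h W i j)) = fun i j => bL d h W0 i j := by
    funext i j; exact K.rho_bL P i j
  rw [K.ricj0]
  simp only [map_sub, map_add, map_smul, map_mul, P.cs, P.c0, P.w, P.h1, K.rho_ip P, K.rho_dv P, K.rho_dv2 P,
    K.rho_nab P, e, e1, eL, eB, e1']
  have q1 : aDv2 (dT d) (tGam d h hi) hi (fun i j => bL d h W0 i j) a
     = (∑ b, ∑ c, hi b c * aCov2 (dT d) (tGam d h hi) (fun i j => d 0 (h i j)) c a b)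
      - (∑ b, ∑ c, hi b c * (aCov2 (dT d) (tGam d h hi) (fun i j => aNab (dT d) (tGam d h hi) W0 i j) c b a
        - aCov2 (dT d) (tGam d h hi) (fun i j => aNab (dT d) (tGam d h hi) W0 i j) c a b)) := by
    simp only [aDv2, ← Finset.sum_sub_distrib]
    refine Finset.sum_congr rfl fun b _ => Finset.sum_congr rfl fun c _ => ?_
    have : aCov2 (dT d) (tGam d h hi) (fun i j => bL d h W0 i j) c b a =
       aCov2 (dT d) (tGam d h hi) (fun i j => d 0 (h i j)) c a b -
       (aCov2 (dT d) (tGam d h hi) (fun i j => aNab (dT d) (tGam d h hi) W0 i j) c b a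
        - aCov2 (dT d) (tGam d h hi) (fun i j => aNab (dT d) (tGam d h hi) W0 i j) c a b) := by
      simp only [aCov2, K.bL_nab', map_add, map_sub, mul_add, mul_sub, Finset.sum_add_distrib, Finset.sum_sub_distrib]
      have s : ∀ i j, h i j = h j i := fun i j => K.geo.gs i j
      simp only [s b, s _ a]
      ring
    rw [this]; ring
  have q2 : ∑ b, ∑ c, hi b c * W0 c * aNab (dT d) (tGam d h hi) W1 b a
      = aIp hi W0 (fun k => aNab (dT d) (tGam d h hi) W1 k a) := by
    rw [aIp, Finset.sum_comm]
    exact Finset.sum_congr rfl fun b _ => Finset.sum_congr rfl fun c _ => by rw [K.geo.gis]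
  rw [E4, q2, q1, K.comm a.succ.succ 0]
  constructor
  · intro z; linear_combination (norm := algebra) (1/2:ℝ) • z
  · intro z; linear_combination (norm := algebra) (2:ℝ) • z

omit K P in
/-- the equation (v) -/
def E5 (d : Fin (m+2) → Derivation ℝ A A) (h hi : Matrix (Fin m) (Fin m) A) (W1 W0 : Fin m → A) (H0 H1 L τ : A)
    (lam : ℝ) : Prop :=
  aDv (dT d) (tGam d h hi) hi (fun j => d j.succ.succ H0) + aIp hi W1 (fun j => d j.succ.succ H0)
    + aDv (dT d) (tGam d h hi) hi W1 * H0
  = aIp hi W0 W0 * ((1/2:ℝ) • aDv (dT d) (tGam d h hi) hi W1 - lam • (1:A))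
    + H1 * (aDv (dT d) (tGam d h hi) hi W0 - d 0 L) - (1/2:ℝ) • (aIp hi W0 W1)^2
    + (∑ a, ∑ b, ∑ c, ∑ e, hi a c * hi b e *
        ((1/2:ℝ) • (aNab (dT d) (tGam d h hi) W0 b a - aNab (dT d) (tGam d h hi) W0 a b)) *
        ((1/2:ℝ) • (aNab (dT d) (tGam d h hi) W0 e c - aNab (dT d) (tGam d h hi) W0 c e)))
    + (∑ a, ∑ b, hi a b * aNab (dT d) (tGam d h hi) (fun j => d 0 (W0 j)) b a)
    - (∑ b, ∑ c, hi b c * W0 c * (2 * (∑ a, ∑ e, hi a e * W1 e *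
         ((1/2:ℝ) • (aNab (dT d) (tGam d h hi) W0 b a - aNab (dT d) (tGam d h hi) W0 a b)))
         + d 0 (W1 b) - 2 * d b.succ.succ H1))
    - d 0 (d 0 L) + (1/4:ℝ) • (∑ a, ∑ b, d 0 (hi a b) * d 0 (h a b)) - τ

omit P in
lemma AKundt.tr_BB (N : Matrix (Fin m) (Fin m) A) (hN : N.transpose = - N) :
    (hi * (dM (d 0) h + N) * (hi * (dM (d 0) h + N))).trace
     = (hi * N * (hi * N)).trace - ∑ a, ∑ b, d 0 (hi a b) * d 0 (h a b) := by
  set U := dM (d 0) h with hU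
  have hUs : U.transpose = U := by ext i j; simp only [hU, dM, Matrix.transpose_apply]; rw [K.geo.gs]
  have his : hi.transpose = hi := by ext i j; exact K.geo.gis _ _
  have c0 : (hi * U * (hi * N)).trace = 0 := by
    have q : (hi * U * (hi * N)).trace = - (hi * U * (hi * N)).trace := by
      conv_lhs => rw [← Matrix.trace_transpose]
      simp only [Matrix.transpose_mul, hUs, his, hN]
      rw [Matrix.trace_mul_comm, Matrix.neg_mul, Matrix.mul_neg, Matrix.trace_neg]
      congr 1
      rw [← Matrix.mul_assoc, Matrix.mul_assoc U, Matrix.trace_mul_comm, Matrix.mul_assoc]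
    have : (2:ℝ) • (hi * U * (hi * N)).trace = 0 := by
      rw [two_smul]; linear_combination q
    exact smul_inj2 this
  have c1 : (hi * N * (hi * U)).trace = 0 := by rw [Matrix.trace_mul_comm]; exact c0
  have dhi : dM (d 0) hi = - (hi * U * hi) := by
    have q : dM (d 0) (hi * h) = 0 := by
      rw [K.geo.inv]; ext i j
      simp only [dM, Matrix.one_apply, Matrix.zero_apply]
      split_ifs <;> simp
    rw [dM_mul] at q
    have q2 := congrArg (fun M => M * hi) q
    simp only [Matrix.add_mul, Matrix.zero_mul] at q2
    rw [Matrix.mul_assoc, K.geo.inv', Matrix.mul_one] at q2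
    exact eq_neg_of_add_eq_zero_left q2
  have e : ∑ a, ∑ b, d 0 (hi a b) * d 0 (h a b) = - (hi * U * (hi * U)).trace := by
    have : ∑ a, ∑ b, d 0 (hi a b) * d 0 (h a b) = (dM (d 0) hi * U.transpose).trace := by
      simp only [Matrix.trace, Matrix.diag, Matrix.mul_apply, Matrix.transpose_apply]; rfl
    rw [this, hUs, dhi, Matrix.neg_mul, Matrix.trace_neg, Matrix.mul_assoc]
  rw [e, Matrix.mul_add, Matrix.add_mul, Matrix.mul_add, Matrix.mul_add]
  simp only [Matrix.trace_add, c0, c1]; ring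

lemma AKundt.e5_iff (lam : ℝ) (τ : A) (e2 : aRic d (kGam d h hi W H) 1 0 = lam • (1:A)) :
    E5 d h hi W1 W0 H0 H1 L τ lam ↔
    ρ (aRic d (kGam d h hi W H) 0 0 - lam • (2 * H)) = τ := by
  rw [K.ric10] at e2
  have e2' : 2 * H2 - (1/2:ℝ) • aIp hi W1 W1 = lam • (1:A) - (1/2:ℝ) • aDv (dT d) (tGam d h hi) hi W1 := by
    linear_combination (norm := algebra) e2
  have e : (fun k => ρ (W k)) = W0 := funext P.w
  have e1 : (fun k => ρ (W1 k)) = W1 := funext fun k => P.fix _ (K.W1_r k)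
  have e1' : ∀ a, ρ (W1 a) = W1 a := fun a => P.fix _ (K.W1_r a)
  have eL : ρ L = L := P.fix _ K.L_r
  rw [K.ric00, e2']
  simp only [map_sub, map_add, map_smul, map_mul, map_pow, map_ofNat, map_one, map_sum, K.rho_up P, P.cs, P.c0, P.w, P.h1, P.h0, K.rho_ip P, K.rho_dv P, K.rho_dv2 P,
    K.rho_nab P, e, e1, eL, K.rho_bL P, e1', dv_sub]
  have q1 : ∑ a, ∑ b, aUp hi (fun k => bL d h W0 k a) b * aUp hi (fun k => bL d h W0 k b) a
    = - (4:ℝ) • (∑ a, ∑ b, ∑ c, ∑ e, hi a c * hi b e *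
        ((1/2:ℝ) • (aNab (dT d) (tGam d h hi) W0 b a - aNab (dT d) (tGam d h hi) W0 a b)) *
        ((1/2:ℝ) • (aNab (dT d) (tGam d h hi) W0 e c - aNab (dT d) (tGam d h hi) W0 c e)))
      - ∑ a, ∑ b, d 0 (hi a b) * d 0 (h a b) := by
    let N : Matrix (Fin m) (Fin m) A := Matrix.of fun k j => aNab (dT d) (tGam d h hi) W0 j k - aNab (dT d) (tGam d h hi) W0 k j
    have hN : N.transpose = - N := by ext i j; simp [N]
    have hB : ∀ k j, bL d h W0 k j = (dM (d 0) h + N) k j := by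
      intro k j; rw [K.bL_nab']; simp only [N, Matrix.add_apply, dM, Matrix.of_apply]; ring
    have t := K.tr_BB N hN
    have l : ∑ a, ∑ b, aUp hi (fun k => bL d h W0 k a) b * aUp hi (fun k => bL d h W0 k b) a
      = (hi * (dM (d 0) h + N) * (hi * (dM (d 0) h + N))).trace := by
      rw [Finset.sum_comm]
      simp only [Matrix.trace, Matrix.diag, Matrix.mul_apply (M := hi * (dM (d 0) h + N)), hB]
      rfl
    rw [l, t]
    congr 1
    have : ∀ a b, (hi * N) a b = ∑ k, hi a k * N k b := fun a b => Matrix.mul_apply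
    simp only [Matrix.trace, Matrix.diag, Matrix.mul_apply (M := hi * N), this, Finset.smul_sum, Finset.sum_mul, Finset.mul_sum]
    -- ∑ c ∑ b ∑ k ∑ l  (hi c k N k b)(hi b l N l c)
    have r : ∀ x y : Fin m, N x y = - N y x := fun x y => by
      have := congrFun (congrFun hN y) x; simpa using this
    calc _ = ∑ c, ∑ b, ∑ e, ∑ a, (-4:ℝ) • (hi a c * hi b e * ((1/2:ℝ) • N a b) * ((1/2:ℝ) • N c e)) := by
          refine Finset.sum_congr rfl fun c _ => Finset.sum_congr rfl fun b _ => ?_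
          refine Finset.sum_congr rfl fun e _ => Finset.sum_congr rfl fun a _ => ?_
          rw [r e c, K.geo.gis a c]; algebra
      _ = ∑ c, ∑ a, ∑ b, ∑ e, (-4:ℝ) • (hi a c * hi b e * ((1/2:ℝ) • N a b) * ((1/2:ℝ) • N c e)) := by
          refine Finset.sum_congr rfl fun c _ => ?_
          rw [Finset.sum_comm_cycle]
      _ = _ := by
          rw [Finset.sum_comm]
          refine Finset.sum_congr rfl fun a _ => ?_
          rw [Finset.sum_comm]
          rfl
  have q2 : ∑ a, ∑ b, hi a b * aNab (dT d) (tGam d h hi) (fun j => d 0 (W0 j)) b a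
      = aDv (dT d) (tGam d h hi) hi (fun j => d 0 (W0 j)) := by
    rw [aDv, Finset.sum_comm]
    exact Finset.sum_congr rfl fun b _ => Finset.sum_congr rfl fun c _ => by rw [K.geo.gis]
  have q3 : ∑ b, ∑ c, hi b c * W0 c * (2 * (∑ a, ∑ e, hi a e * W1 e *
         ((1/2:ℝ) • (aNab (dT d) (tGam d h hi) W0 b a - aNab (dT d) (tGam d h hi) W0 a b)))
         + d 0 (W1 b) - 2 * d b.succ.succ H1)
     = aIp hi W0 (fun i => d 0 (W1 i)) - 2 * aIp hi W0 (fun i => d i.succ.succ H1)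
       - (1/2:ℝ) • aIp hi W1 (fun k => aIp hi W0 (fun l => bL d h W0 l k - bL d h W0 k l)) := by
    have s : ∀ k l, bL d h W0 l k - bL d h W0 k l =
      (-4:ℝ) • ((1/2:ℝ) • (aNab (dT d) (tGam d h hi) W0 l k - aNab (dT d) (tGam d h hi) W0 k l)) := by
      intro k l; rw [K.bL_nab', K.bL_nab', K.geo.gs k l]; algebra
    have s2 : aIp hi W1 (fun k => aIp hi W0 (fun l => bL d h W0 l k - bL d h W0 k l)) =
       (-4:ℝ) • ∑ b, ∑ c, hi b c * W0 c * (∑ a, ∑ e, hi a e * W1 e *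
         ((1/2:ℝ) • (aNab (dT d) (tGam d h hi) W0 b a - aNab (dT d) (tGam d h hi) W0 a b))) := by
      simp only [s, aIp, Finset.mul_sum, Finset.smul_sum]
      -- lhs: ∑ e ∑ a ∑ c ∑ b ; rhs ∑ b ∑ c ∑ a ∑ e
      calc _ = ∑ e, ∑ a, ∑ b, ∑ c, (-4:ℝ) • (hi b c * W0 c * (hi a e * W1 e *
                ((1/2:ℝ) • (aNab (dT d) (tGam d h hi) W0 b a - aNab (dT d) (tGam d h hi) W0 a b)))) := by
            refine Finset.sum_congr rfl fun e _ => Finset.sum_congr rfl fun a _ => ?_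
            rw [Finset.sum_comm]
            refine Finset.sum_congr rfl fun b _ => Finset.sum_congr rfl fun c _ => ?_
            rw [K.geo.gis e a, K.geo.gis c b]; algebra
        _ = _ := by
            rw [Finset.sum_comm]
            rw [Finset.sum_comm_cycle]
            refine Finset.sum_congr rfl fun b _ => ?_
            rw [Finset.sum_comm_cycle]
    have s3 : ∑ b, ∑ c, hi b c * W0 c * (2 * (∑ a, ∑ e, hi a e * W1 e *
         ((1/2:ℝ) • (aNab (dT d) (tGam d h hi) W0 b a - aNab (dT d) (tGam d h hi) W0 a b)))
         + d 0 (W1 b) - 2 * d b.succ.succ H1)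
      = 2 * (∑ b, ∑ c, hi b c * W0 c * (∑ a, ∑ e, hi a e * W1 e *
         ((1/2:ℝ) • (aNab (dT d) (tGam d h hi) W0 b a - aNab (dT d) (tGam d h hi) W0 a b))))
        + (∑ b, ∑ c, hi b c * d 0 (W1 b) * W0 c) - 2 * (∑ b, ∑ c, hi b c * d b.succ.succ H1 * W0 c) := by
      simp only [Finset.mul_sum (a := (2:A)), ← Finset.sum_add_distrib, ← Finset.sum_sub_distrib]
      refine Finset.sum_congr rfl fun b _ => Finset.sum_congr rfl fun c _ => ?_
      simp only [← Finset.mul_sum]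
      ring
    rw [s3, s2, ← K.geo.ip_comm (fun i => d 0 (W1 i)), ← K.geo.ip_comm (fun i => d i.succ.succ H1)]
    simp only [aIp]
    algebra
  rw [E5, q2, q3, q1]
  constructor
  · intro z; linear_combination (norm := algebra) -z
  · intro z; linear_combination (norm := algebra) -z

end AbsRho

section AbsFinal

variable {A : Type*} [CommRing A] [Algebra ℝ A] {m : ℕ}
variable {d : Fin (m+2) → Derivation ℝ A A} {h hi : Matrix (Fin m) (Fin m) A}
    {W W1 W0 : Fin m → A} {H Hr H2 L H0 H1 : A}
variable {ρ : A →ₐ[ℝ] A}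

lemma AKundt.bianchi0 (K : AKundt d h hi W W1 H Hr H2 L) {lam : ℝ} {e : A}
    (hR : ∀ a b, aRic d (kGam d h hi W H) a b = lam • kG H W h a b + if a = 0 ∧ b = 0 then e else 0) :
    d 1 e = 0 := by
  have q : ∀ f c, aQ d (kG H W h) (kGi H W hi) f c = (if c = f then lam • (1:A) else 0)
      + if c = 0 ∧ f = 1 then e else 0 := by
    intro f c
    have h1 : aQ d (kG H W h) (kGi H W hi) f c = lam • (∑ b, kG H W h c b * kGi H W hi b f)
       + ∑ b, (if b = 0 ∧ c = 0 then e else 0) * kGi H W hi b f := by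
      simp only [aQ, Finset.smul_sum, ← Finset.sum_add_distrib]
      refine Finset.sum_congr rfl fun b _ => ?_
      have : aRic d (aGam d (kG H W h) (kGi H W hi)) b c = aRic d (kGam d h hi W H) b c := rfl
      rw [this, hR, K.full.gs c b]; algebra
    have h2 : ∑ b, kG H W h c b * kGi H W hi b f = if c = f then 1 else 0 := by
      rw [← Matrix.mul_apply, K.full.inv', Matrix.one_apply]
    rw [h1, h2]
    congr 1
    · split_ifs <;> simp
    · rw [Finset.sum_eq_single 0]
      · have : kGi H W hi 0 f = if f = 1 then 1 else 0 := by
          clear h1 h2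
          revert f
          simp only [forall2, kGi]
          refine ⟨by simp, by simp, fun i => ?_⟩
          simp [ss_ne1]
        rw [this]
        by_cases c0 : c = 0 <;> by_cases f1 : f = 1 <;> simp [c0, f1]
      · intro b _ hb; simp [hb]
      · simp
  have B := K.full.bianchi 0
  rw [← kGam] at B
  have q00 : aQ d (kG H W h) (kGi H W hi) 0 0 = lam • (1:A) := by
    have : ¬ ((0:Fin (m+2)) = 0 ∧ (0:Fin (m+2)) = 1) := by simp
    rw [q, if_pos rfl, if_neg this, add_zero]
  have q10 : aQ d (kG H W h) (kGi H W hi) 1 0 = e := by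
    have : ¬ ((0:Fin (m+2)) = 1) := by simp
    rw [q, if_neg this, if_pos ⟨rfl, rfl⟩, zero_add]
  have qj0 : ∀ j : Fin m, aQ d (kG H W h) (kGi H W hi) j.succ.succ 0 = 0 := by
    intro j
    have h1 : ¬ ((0:Fin (m+2)) = j.succ.succ) := (Fin.succ_ne_zero _).symm
    have h2 : ¬ ((0:Fin (m+2)) = 0 ∧ (j.succ.succ : Fin (m+2)) = 1) := fun h => ss_ne1 j h.2
    rw [q, if_neg h1, if_neg h2, zero_add]
  have qaa : ∀ a, aQ d (kG H W h) (kGi H W hi) a a = lam • (1:A) := by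
    intro a
    have : ¬ (a = 0 ∧ a = 1) := by rintro ⟨rfl, h⟩; simp at h
    rw [q, if_pos rfl, if_neg this, add_zero]
  have t0 : ∑ a, aQ d (kG H W h) (kGi H W hi) a a = (lam * (m+2)) • (1:A) := by
    simp only [qaa, Finset.sum_const, Finset.card_univ, Fintype.card_fin]
    rw [← Nat.cast_smul_eq_nsmul ℝ, smul_smul]; congr 1; push_cast; ring
  have t1 : ∑ a, d a (aQ d (kG H W h) (kGi H W hi) a 0) = d 1 e := by
    rw [sum2, q00, q10]; simp only [qj0]; simp
  have t2 : ∑ a, ∑ k, kGam d h hi W H a a k * aQ d (kG H W h) (kGi H W hi) k 0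
     = lam • (∑ a, kGam d h hi W H a a 0) + e * (∑ a, kGam d h hi W H a a 1) := by
    rw [Finset.smul_sum, Finset.mul_sum, ← Finset.sum_add_distrib]
    refine Finset.sum_congr rfl fun a _ => ?_
    rw [sum2, q00, q10]; simp only [qj0]
    simp only [mul_zero, Finset.sum_const_zero]; algebra
  have t3 : ∑ a, ∑ k, kGam d h hi W H a 0 k * aQ d (kG H W h) (kGi H W hi) k a
     = lam • (∑ a, kGam d h hi W H a a 0) + e * kGam d h hi W H 0 0 1 := by
    simp only [q, mul_add, Finset.sum_add_distrib]
    congr 1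
    · simp only [mul_ite, mul_zero, Finset.sum_ite_eq, Finset.mem_univ, if_true, Finset.smul_sum]
      exact Finset.sum_congr rfl fun a _ => by rw [K.sy]; algebra
    · rw [Finset.sum_eq_single 0, Finset.sum_eq_single 1]
      · simp [mul_comm]
      · intro b _ hb; simp [hb]
      · simp
      · intro b _ hb; simp [hb]
      · simp
  rw [t0, t3] at B
  rw [t1, t2, K.trace 1, K.L_r, K.sy, K.g0r, Derivation.map_smul, Derivation.map_one_eq_zero] at B
  apply smul_inj2
  rw [smul_zero] at B
  rw [← B]; algebra

theorem AKundt.main (K : AKundt d h hi W W1 H Hr H2 L) (P : ARho ρ d W W0 H Hr H0 H1) (lam : ℝ) (τ : A)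
    (hτ : d 1 τ = 0) :
    (∀ a b, aRic d (kGam d h hi W H) a b = lam • kG H W h a b + if a = 0 ∧ b = 0 then τ else 0) ↔
    (E1 d h hi W1 lam ∧ E2 d h hi W1 H2 lam ∧ E3 d h hi W1 lam ∧ (∀ a, E4 d h hi W1 W0 H1 L lam a) ∧
      E5 d h hi W1 W0 H0 H1 L τ lam) := by
  constructor
  · intro hR
    have e1 : E1 d h hi W1 lam := by
      intro i j
      have := hR i.succ.succ j.succ.succ
      rw [K.ricij] at this
      have z : ¬ ((i.succ.succ : Fin (m+2)) = 0 ∧ (j.succ.succ : Fin (m+2)) = 0) := by simp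
      rw [if_neg z] at this
      have k : kG H W h i.succ.succ j.succ.succ = h i j := rfl
      rw [k] at this
      linear_combination (norm := algebra) this
    have r10 : aRic d (kGam d h hi W H) 1 0 = lam • (1:A) := by
      rw [hR]; simp [kG]
    have rj0 : ∀ j : Fin m, aRic d (kGam d h hi W H) j.succ.succ 0 - lam • W j = 0 := by
      intro j; rw [hR]; simp [kG]
    have r00 : aRic d (kGam d h hi W H) 0 0 - lam • (2 * H) = τ := by
      rw [hR]; simp [kG]
    refine ⟨e1, (K.e2_iff e1).2 r10, (K.e3_iff e1 r10).2 fun j => ?_, fun a => (K.e4_iff P lam a).2 ?_,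
      (K.e5_iff P lam τ r10).2 ?_⟩
    · rw [rj0, map_zero]
    · rw [rj0, map_zero]
    · rw [r00, P.fix _ hτ]
  · rintro ⟨e1, e2, e3, e4, e5⟩
    have r10 := (K.e2_iff (H := H) (W := W) e1).1 e2
    have rj0 : ∀ j : Fin m, aRic d (kGam d h hi W H) j.succ.succ 0 = lam • W j := by
      intro j
      have d1 := (K.e3_iff e1 r10).1 e3 j
      have r := (K.e4_iff P lam j).1 (e4 j)
      rw [P.fix _ d1] at r
      exact sub_eq_zero.1 r
    have r00 := (K.e5_iff P lam τ r10).1 e5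
    have key : ∀ a b, aRic d (kGam d h hi W H) a b = lam • kG H W h a b + if a = 0 ∧ b = 0 then
        (aRic d (kGam d h hi W H) 0 0 - lam • (2 * H)) else 0 := by
      simp only [forall2]
      refine ⟨⟨?_, ?_, fun i => ?_⟩, ⟨?_, ?_, fun i => ?_⟩, fun i => ⟨?_, ?_, fun j => ?_⟩⟩
      · simp [kG]
      · rw [K.ricsy, r10]; simp [kG]
      · rw [K.ricsy, rj0]; simp [kG]
      · rw [r10]; simp [kG]
      · rw [K.ric11]; simp [kG]
      · rw [K.ric1j]; simp [kG]
      · rw [rj0]; simp [kG]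
      · rw [K.ricsy, K.ric1j]; simp [kG]
      · rw [K.ricij, e1 i j]; simp only [kG, blkij]
        have z : ¬ ((i.succ.succ : Fin (m+2)) = 0 ∧ (j.succ.succ : Fin (m+2)) = 0) := by simp
        rw [if_neg z]; algebra
    have b := K.bianchi0 key
    rw [P.fix _ b] at r00
    rw [r00] at key
    exact key

end AbsFinal

section Smooth

variable {n : ℕ}

/-- the algebra of smooth functions -/
def Sm (n : ℕ) : Subalgebra ℝ (Pt n → ℝ) where
  carrier := {f | ContDiff ℝ (⊤ : ℕ∞) f}
  mul_mem' := by
    intro a b ha hb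
    rw [Set.mem_ofPred_eq] at *
    exact ContDiff.mul ha hb
  add_mem' := by
    intro a b ha hb
    rw [Set.mem_ofPred_eq] at *
    exact ContDiff.add ha hb
  algebraMap_mem' := by
    intro c
    rw [Set.mem_ofPred_eq]
    exact contDiff_const

lemma mem_Sm {f : Pt n → ℝ} (h : ContDiff ℝ (⊤ : ℕ∞) f) : f ∈ Sm n := h

lemma smCd (f : Sm n) : ContDiff ℝ (⊤ : ℕ∞) f.1 := f.2

/-- evaluation at a point -/
def ev (x : Pt n) : Sm n →ₐ[ℝ] ℝ := (Pi.evalAlgHom ℝ (fun _ : Pt n => ℝ) x).comp (Sm n).val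

lemma ev_apply (x : Pt n) (f : Sm n) : ev x f = f.1 x := rfl

lemma ev_ext {f g : Sm n} (h : ∀ x, ev x f = ev x g) : f = g := Subtype.ext (funext h)

lemma sm_one_le : ((⊤:ℕ∞) : WithTop ℕ∞) ≠ 0 := by simp

lemma smDiff (f : Sm n) (x : Pt n) : DifferentiableAt ℝ f.1 x :=
  (ContDiff.differentiable (smCd f) sm_one_le).differentiableAt

lemma pd_smooth {f : Pt n → ℝ} (hf : ContDiff ℝ (⊤ : ℕ∞) f) (a : Fin n) : ContDiff ℝ (⊤ : ℕ∞) (pd f a) := by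
  have := ContDiff.fderiv_right (m := ((⊤:ℕ∞) : WithTop ℕ∞)) hf (by simp)
  exact this.clm_apply contDiff_const

/-- partial derivative as derivation -/
def pdD (a : Fin n) : Derivation ℝ (Sm n) (Sm n) where
  toFun f := ⟨pd f.1 a, mem_Sm (pd_smooth (smCd f) a)⟩
  map_add' f g := by
    apply Subtype.ext; funext x
    show fderiv ℝ (f.1 + g.1) x _ = fderiv ℝ f.1 x _ + fderiv ℝ g.1 x _
    rw [fderiv_add (smDiff f x) (smDiff g x)]; rfl
  map_smul' c f := by
    apply Subtype.ext; funext x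
    show fderiv ℝ (c • f.1) x _ = c * fderiv ℝ f.1 x _
    rw [fderiv_const_smul (smDiff f x)]; rfl
  map_one_eq_zero' := by
    apply Subtype.ext; funext x
    show fderiv ℝ (fun _ : Pt n => (1:ℝ)) x _ = 0
    rw [fderiv_fun_const]; rfl
  leibniz' f g := by
    apply Subtype.ext; funext x
    show fderiv ℝ (f.1 * g.1) x _ = f.1 x * fderiv ℝ g.1 x _ + g.1 x * fderiv ℝ f.1 x _
    rw [fderiv_mul (smDiff f x) (smDiff g x)]; rfl

lemma ev_pdD (x : Pt n) (a : Fin n) (f : Sm n) : ev x (pdD a f) = pd f.1 a x := rfl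

lemma pdD_comm (a b : Fin n) (f : Sm n) : pdD a (pdD b f) = pdD b (pdD a f) := by
  apply ev_ext; intro x
  have h2 : ∀ a b : Fin n, ev x (pdD a (pdD b f)) = fderiv ℝ (fderiv ℝ f.1) x (Pi.single a 1) (Pi.single b 1) := by
    intro a b
    show fderiv ℝ (fun y => fderiv ℝ f.1 y (Pi.single b 1)) x (Pi.single a 1) = _
    have hd : DifferentiableAt ℝ (fderiv ℝ f.1) x :=
      ((ContDiff.fderiv_right (m := ((⊤:ℕ∞) : WithTop ℕ∞)) (smCd f) (by simp)).differentiable sm_one_le).differentiableAt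
    rw [fderiv_clm_apply hd (differentiableAt_const _)]
    simp
  rw [h2, h2]
  have := (ContDiff.contDiffAt (x := x) (smCd f)).isSymmSndFDerivAt (by
    rw [minSmoothness_of_isRCLikeNormedField]; exact WithTop.coe_le_coe.2 le_top)
  exact this _ _

/-- projection to `r = 0` -/
def Pr [NeZero n] : Pt n →L[ℝ] Pt n :=
  ContinuousLinearMap.pi fun i => if i = 1 then 0 else ContinuousLinearMap.proj i

lemma Pr_apply [NeZero n] (x : Pt n) (i) : Pr x i = if i = 1 then 0 else x i := by
  simp only [Pr, ContinuousLinearMap.coe_pi']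
  split_ifs <;> rfl

/-- restriction -/
def rhoS [NeZero n] : Sm n →ₐ[ℝ] Sm n where
  toFun f := ⟨fun x => f.1 (Pr x), mem_Sm ((smCd f).comp (Pr : Pt n →L[ℝ] Pt n).contDiff)⟩
  map_one' := rfl
  map_mul' _ _ := rfl
  map_zero' := rfl
  map_add' _ _ := rfl
  commutes' _ := rfl

lemma ev_rho [NeZero n] (x : Pt n) (f : Sm n) : ev x (rhoS f) = ev (Pr x) f := rfl

lemma pd_rho [NeZero n] (f : Sm n) (a : Fin n) (x : Pt n) :
    pd (fun y => f.1 (Pr y)) a x = fderiv ℝ f.1 (Pr x) (Pr (Pi.single a 1)) := by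
  show fderiv ℝ (f.1 ∘ (Pr : Pt n →L[ℝ] Pt n)) x _ = _
  rw [fderiv_comp _ (smDiff f _) (Pr : Pt n →L[ℝ] Pt n).differentiableAt]
  simp

lemma rho_com [NeZero n] (a : Fin n) (ha : a ≠ 1) (f : Sm n) : rhoS (pdD a f) = pdD a (rhoS f) := by
  apply ev_ext; intro x
  show fderiv ℝ f.1 (Pr x) (Pi.single a 1) = pd (fun y => f.1 (Pr y)) a x
  rw [pd_rho]
  congr 1
  ext i
  rw [Pr_apply]
  split_ifs with h
  · rw [h, Pi.single_apply, if_neg (Ne.symm ha)]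
  · rfl

lemma Pr_eq [NeZero n] (x : Pt n) : x = Pr x + (x 1) • (Pi.single (1 : Fin n) (1:ℝ) : Pt n) := by
  ext i
  rw [Pi.add_apply, Pr_apply, Pi.smul_apply, Pi.single_apply]
  split_ifs with h
  · simp [h]
  · simp

lemma rho_fix [NeZero n] (f : Sm n) (hf : pdD 1 f = 0) : rhoS f = f := by
  apply ev_ext; intro x
  rw [ev_rho, ev_apply, ev_apply]
  let c : ℝ → ℝ := fun t => f.1 (Pr x + t • (Pi.single (1 : Fin n) (1:ℝ) : Pt n))
  have hc : ∀ t, HasDerivAt c 0 t := by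
    intro t
    have h1 : HasDerivAt (fun t : ℝ => Pr x + t • (Pi.single (1 : Fin n) (1:ℝ) : Pt n)) (Pi.single (1 : Fin n) (1:ℝ) : Pt n) t := by
      simpa using ((hasDerivAt_id t).smul_const (Pi.single (1 : Fin n) (1:ℝ) : Pt n)).const_add (Pr x)
    have h2 := (smDiff f (Pr x + t • (Pi.single (1 : Fin n) (1:ℝ) : Pt n))).hasFDerivAt.comp_hasDerivAt t h1
    have h3 : fderiv ℝ f.1 (Pr x + t • (Pi.single (1 : Fin n) (1:ℝ) : Pt n)) (Pi.single (1 : Fin n) (1:ℝ)) = 0 :=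
      congrFun (congrArg Subtype.val hf) _
    rw [h3] at h2
    exact h2
  have := is_const_of_deriv_eq_zero (fun t => (hc t).differentiableAt) (fun t => (hc t).deriv) 0 (x 1)
  simp only [c, zero_smul, add_zero] at this
  rw [this, ← Pr_eq]

lemma indep_pd [NeZero n] (h1 : ((1 : Fin n) : ℕ) = 1) (f : Sm n) (hf : IndepOfR f.1) : pdD 1 f = 0 := by
  apply ev_ext; intro x
  have e : f.1 = fun y => f.1 (Pr y) := by
    funext y; apply hf; intro i hi
    rw [Pr_apply, if_neg]
    rintro rfl; exact hi h1
  rw [ev_pdD, e, pd_rho]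
  have : Pr (Pi.single (1 : Fin n) (1:ℝ) : Pt n) = 0 := by
    ext i; rw [Pr_apply]; split_ifs with h
    · rfl
    · simp [h]
  rw [this]; simp

/-- the coordinate `r` -/
def rC [NeZero n] : Sm n := ⟨fun x => x 1, mem_Sm (contDiff_apply ℝ ℝ (1 : Fin n))⟩

lemma pd_r [NeZero n] (a : Fin n) : pdD a (rC : Sm n) = if a = 1 then 1 else 0 := by
  apply ev_ext; intro x
  show fderiv ℝ (fun y : Pt n => y 1) x (Pi.single a 1) = _
  have : (fun y : Pt n => y 1) = (ContinuousLinearMap.proj (R := ℝ) (φ := fun _ : Fin n => ℝ) 1) := rfl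
  rw [this, ContinuousLinearMap.fderiv, ContinuousLinearMap.proj_apply, Pi.single_apply]
  by_cases h : a = 1
  · rw [if_pos h, if_pos h.symm, map_one]
  · rw [if_neg h, if_neg (Ne.symm h), map_zero]

lemma rho_r [NeZero n] : rhoS (rC : Sm n) = 0 := by
  apply ev_ext; intro x
  rw [ev_rho]
  show Pr x 1 = _
  rw [Pr_apply, if_pos rfl, map_zero]

lemma smUnit (f : Sm n) (hf : ∀ x, ev x f ≠ 0) : IsUnit f := by
  refine IsUnit.of_mul_eq_one (⟨fun x => (f.1 x)⁻¹, mem_Sm (ContDiff.inv (smCd f) hf)⟩ : Sm n) ?_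
  apply ev_ext; intro x
  rw [map_mul, map_one]
  exact mul_inv_cancel₀ (hf x)

end Smooth

section Jacobi
variable {A : Type*} [CommRing A] [Algebra ℝ A] {ι : Type*} [Fintype ι] [DecidableEq ι]

lemma deriv_prod (δ : Derivation ℝ A A) (s : Finset ι) (F : ι → A) :
    δ (∏ i ∈ s, F i) = ∑ j ∈ s, δ (F j) * ∏ i ∈ s.erase j, F i := by
  induction s using Finset.induction_on with
  | empty => simp
  | insert a s ha ih =>
    rw [Finset.prod_insert ha, Derivation.leibniz, ih, Finset.sum_insert ha, Finset.erase_insert ha]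
    simp only [smul_eq_mul, Finset.mul_sum]
    rw [add_comm, mul_comm]
    congr 1
    refine Finset.sum_congr rfl fun j hj => ?_
    have : a ≠ j := fun h => ha (h ▸ hj)
    rw [Finset.erase_insert_of_ne this, Finset.prod_insert (fun h => ha (Finset.mem_of_mem_erase h))]
    ring

lemma deriv_det (δ : Derivation ℝ A A) (M : Matrix ι ι A) :
    δ M.det = ∑ i, ∑ j, M.adjugate j i * δ (M i j) := by
  have h1 : δ M.det = ∑ j, (M.updateCol j (fun i => δ (M i j))).det := by
    simp only [Matrix.det_apply', map_sum]
    rw [Finset.sum_comm]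
    refine Finset.sum_congr rfl fun σ _ => ?_
    have e : ((Equiv.Perm.sign σ : ℤ) : A) = algebraMap ℝ A ((Equiv.Perm.sign σ : ℤ) : ℝ) := by simp
    rw [Derivation.leibniz, e, Derivation.map_algebraMap, smul_zero, add_zero, deriv_prod, smul_eq_mul, Finset.mul_sum]
    refine Finset.sum_congr rfl fun j _ => ?_
    congr 1
    rw [← Finset.mul_prod_erase Finset.univ _ (Finset.mem_univ j)]
    simp only [Matrix.updateCol_self]
    congr 1
    refine Finset.prod_congr rfl fun i hi => ?_
    rw [Matrix.updateCol_ne (Finset.ne_of_mem_erase hi)]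
  rw [h1, Finset.sum_comm]
  refine Finset.sum_congr rfl fun j _ => ?_
  rw [← Matrix.cramer_apply, Matrix.cramer_eq_adjugate_mulVec]
  rfl

end Jacobi

section Trans

variable {n : ℕ}

lemma pd_ev {f : Pt n → ℝ} (F : Sm n) (h : ∀ y, f y = ev y F) (a : Fin n) (x : Pt n) :
    pd f a x = ev x (pdD a F) := by
  have : f = F.1 := funext h
  rw [this]; rfl

/-- masked derivations -/
def dP (a : Fin n) : Derivation ℝ (Sm n) (Sm n) := if 2 ≤ (a : ℕ) then pdD a else 0

lemma pdT_ev {f : Pt n → ℝ} (F : Sm n) (h : ∀ y, f y = ev y F) (a : Fin n) (x : Pt n) :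
    pdT f a x = ev x (dP a F) := by
  rw [pdT, dP]
  split_ifs
  · exact pd_ev F h a x
  · simp

variable {g : MetricField n} {G Gi : Matrix (Fin n) (Fin n) (Sm n)}

lemma chris_ev (hg : ∀ x a b, g x a b = ev x (G a b)) (hi : ∀ x a b, (g x)⁻¹ a b = ev x (Gi a b))
    (x : Pt n) (a b c : Fin n) : christoffel g x a b c = ev x (aGam pdD G Gi a b c) := by
  rw [christoffel, aGam, map_smul, smul_eq_mul, map_sum]
  congr 1
  refine Finset.sum_congr rfl fun e _ => ?_
  rw [map_mul, map_sub, map_add, hi, pd_ev _ (fun y => hg y e c), pd_ev _ (fun y => hg y b e),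
    pd_ev _ (fun y => hg y b c)]

lemma chrisT_ev (hg : ∀ x a b, g x a b = ev x (G a b)) (hi : ∀ x a b, (g x)⁻¹ a b = ev x (Gi a b))
    (x : Pt n) (a b c : Fin n) : christoffelT g x a b c = ev x (aGam dP G Gi a b c) := by
  rw [christoffelT, aGam, map_smul, smul_eq_mul, map_sum]
  congr 1
  refine Finset.sum_congr rfl fun e _ => ?_
  rw [map_mul, map_sub, map_add, hi, pdT_ev _ (fun y => hg y e c), pdT_ev _ (fun y => hg y b e),
    pdT_ev _ (fun y => hg y b c)]

lemma ric_aux (x : Pt n) (hgi : ∀ a b, Gi a b = Gi b a) (inv : Gi * G = 1) (R : Fin n → Fin n → ℝ) :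
    ∑ a, ∑ c, ev x (Gi a c) * ∑ e, ev x (G a e) * R e c = ∑ c, R c c := by
  have h1 : ∀ c e, ∑ a, ev x (Gi a c) * ev x (G a e) = if c = e then 1 else 0 := by
    intro c e
    have := congrArg (ev x) (congrFun (congrFun inv c) e)
    rw [Matrix.mul_apply, map_sum, Matrix.one_apply] at this
    simp only [map_mul] at this
    simp only [hgi _ c]
    rw [this]; split_ifs <;> simp
  rw [Finset.sum_comm]
  refine Finset.sum_congr rfl fun c _ => ?_
  simp only [Finset.mul_sum, ← mul_assoc]
  rw [Finset.sum_comm]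
  simp only [← Finset.sum_mul, h1]
  simp

lemma ricci_ev (hg : ∀ x a b, g x a b = ev x (G a b)) (hi : ∀ x a b, (g x)⁻¹ a b = ev x (Gi a b))
    (hgi : ∀ a b, Gi a b = Gi b a) (inv : Gi * G = 1)
    (x : Pt n) (b f : Fin n) : ricci g x b f = ev x (aRic pdD (aGam pdD G Gi) b f) := by
  rw [ricci, aRic, map_sum]
  simp only [riemann, hg, hi, Matrix.cons_val_zero, Matrix.cons_val_one, Matrix.cons_val]
  rw [ric_aux x hgi inv (fun e c => pd (fun y => christoffel g y e f b) c x
     - pd (fun y => christoffel g y e c b) f x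
     + ∑ f', (christoffel g x e c f' * christoffel g x f' f b
            - christoffel g x e f f' * christoffel g x f' c b))]
  refine Finset.sum_congr rfl fun c _ => ?_
  rw [aRm, map_add, map_sub, map_sum]
  congr 1
  · rw [pd_ev _ (fun y => chris_ev hg hi y _ _ _), pd_ev _ (fun y => chris_ev hg hi y _ _ _)]
  · simp only [map_sub, map_mul, chris_ev hg hi]

lemma ricciT_ev (hg : ∀ x a b, g x a b = ev x (G a b)) (hi : ∀ x a b, (g x)⁻¹ a b = ev x (Gi a b))
    (hgi : ∀ a b, Gi a b = Gi b a) (inv : Gi * G = 1)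
    (x : Pt n) (b f : Fin n) : ricciT g x b f = ev x (aRic dP (aGam dP G Gi) b f) := by
  rw [ricciT, aRic, map_sum]
  simp only [riemannT, hg, hi, Matrix.cons_val_zero, Matrix.cons_val_one, Matrix.cons_val]
  rw [ric_aux x hgi inv (fun e c => pdT (fun y => christoffelT g y e f b) c x
     - pdT (fun y => christoffelT g y e c b) f x
     + ∑ f', (christoffelT g x e c f' * christoffelT g x f' f b
            - christoffelT g x e f f' * christoffelT g x f' c b))]
  refine Finset.sum_congr rfl fun c _ => ?_
  rw [aRm, map_add, map_sub, map_sum]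
  congr 1
  · rw [pdT_ev _ (fun y => chrisT_ev hg hi y _ _ _), pdT_ev _ (fun y => chrisT_ev hg hi y _ _ _)]
  · simp only [map_sub, map_mul, chrisT_ev hg hi]

lemma cov1_ev (hg : ∀ x a b, g x a b = ev x (G a b)) (hi : ∀ x a b, (g x)⁻¹ a b = ev x (Gi a b))
    {T : TensorField n 1} {V : Fin n → Sm n} (hV : ∀ x v, T x v = ev x (V (v 0))) (x : Pt n) (v : Fin 2 → Fin n) :
    covDT g T x v = ev x (aNab dP (aGam dP G Gi) V (v 0) (v 1)) := by
  rw [covDT, aNab, map_sub, map_sum, Fin.sum_univ_one]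
  congr 1
  · rw [pdT_ev _ (fun y => hV y _)]; rfl
  · refine Finset.sum_congr rfl fun e _ => ?_
    rw [chrisT_ev hg hi, hV, map_mul, Function.update_self]; rfl

lemma cov2_ev (hg : ∀ x a b, g x a b = ev x (G a b)) (hi : ∀ x a b, (g x)⁻¹ a b = ev x (Gi a b))
    {T : TensorField n 2} {V : Fin n → Fin n → Sm n} (hV : ∀ x v, T x v = ev x (V (v 0) (v 1))) (x : Pt n)
    (c b a : Fin n) :
    covDT g T x ![c, b, a] = ev x (aCov2 dP (aGam dP G Gi) V c b a) := by
  rw [covDT, aCov2, map_sub, map_add, map_sum, map_sum, Fin.sum_univ_two]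
  congr 1
  · rw [pdT_ev _ (fun y => hV y _)]; rfl
  · congr 1
    · refine Finset.sum_congr rfl fun e _ => ?_
      rw [chrisT_ev hg hi, hV, map_mul]; rfl
    · refine Finset.sum_congr rfl fun e _ => ?_
      rw [chrisT_ev hg hi, hV, map_mul]; rfl

end Trans

section Pad
variable {m : ℕ} {A : Type*} [CommRing A] [Algebra ℝ A] (d : Fin (m+2) → Derivation ℝ A A) (h hi : Matrix (Fin m) (Fin m) A)

/-- masked derivations, abstractly -/
def dQ (a : Fin (m+2)) : Derivation ℝ A A := Fin.cases 0 (Fin.cases 0 (fun i => dT d i)) a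
@[simp] lemma dQ0 : dQ d (0 : Fin (m+2)) = 0 := rfl
@[simp] lemma dQ1 : dQ d (1 : Fin (m+2)) = 0 := rfl
@[simp] lemma dQs (i : Fin m) : dQ d (i.succ.succ : Fin (m+2)) = dT d i := rfl

/-- padded metric -/
def hP : Matrix (Fin (m+2)) (Fin (m+2)) A := blk 1 0 1 (fun _ => 0) (fun _ => 0) h

/-- padded two-tensor -/
def tP (T : Fin m → Fin m → A) : Fin (m+2) → Fin (m+2) → A := blk 0 0 0 (fun _ => 0) (fun _ => 0) T

section
variable (T : Fin m → Fin m → A) (i j : Fin m)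
@[simp] lemma tP00 : tP T 0 0 = 0 := rfl
@[simp] lemma tP01 : tP T 0 1 = 0 := rfl
@[simp] lemma tP10 : tP T 1 0 = 0 := rfl
@[simp] lemma tP11 : tP T 1 1 = 0 := rfl
@[simp] lemma tP0j : tP T 0 j.succ.succ = 0 := rfl
@[simp] lemma tP1j : tP T 1 j.succ.succ = 0 := rfl
@[simp] lemma tPi0 : tP T i.succ.succ 0 = 0 := rfl
@[simp] lemma tPi1 : tP T i.succ.succ 1 = 0 := rfl
@[simp] lemma tPij : tP T i.succ.succ j.succ.succ = T i j := rfl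
@[simp] lemma hP00 : hP h 0 0 = 1 := rfl
@[simp] lemma hP01 : hP h 0 1 = 0 := rfl
@[simp] lemma hP10 : hP h 1 0 = 0 := rfl
@[simp] lemma hP11 : hP h 1 1 = 1 := rfl
@[simp] lemma hP0j : hP h 0 j.succ.succ = 0 := rfl
@[simp] lemma hP1j : hP h 1 j.succ.succ = 0 := rfl
@[simp] lemma hPi0 : hP h i.succ.succ 0 = 0 := rfl
@[simp] lemma hPi1 : hP h i.succ.succ 1 = 0 := rfl
@[simp] lemma hPij : hP h i.succ.succ j.succ.succ = h i j := rfl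
end

/-- padded vector -/
def vP (V : Fin m → A) (a : Fin (m+2)) : A := Fin.cases 0 (Fin.cases 0 V) a

@[simp] lemma vP0 (V : Fin m → A) : vP V 0 = 0 := rfl
@[simp] lemma vP1 (V : Fin m → A) : vP V 1 = 0 := rfl
@[simp] lemma vPs (V : Fin m → A) (i : Fin m) : vP V i.succ.succ = V i := rfl

lemma ss_ne0 (i : Fin m) : (i.succ.succ : Fin (m+2)) ≠ 0 := by
  intro h; have := congrArg Fin.val h; simp at this

lemma hP_mul (e : h * hi = 1) : hP h * hP hi = 1 := by
  have key : ∀ a b, (hP h * hP hi) a b = (1 : Matrix _ _ _) a b := by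
    have e' : ∀ i j, ∑ k, h i k * hi k j = (1 : Matrix _ _ A) i j := by
      intro i j; rw [← e, Matrix.mul_apply]
    simp only [Matrix.mul_apply, sum2, hP]
    simp only [forall2]
    refine ⟨⟨?_, ?_, fun i => ?_⟩, ⟨?_, ?_, fun i => ?_⟩, fun i => ⟨?_, ?_, fun j => ?_⟩⟩ <;>
      simp [e', Matrix.one_apply, ss_ne1, ss_ne0, (ss_ne1 _).symm, (ss_ne0 _).symm]
  ext1 a b
  exact key a b

/-- padded Christoffel symbols -/
def gP : Fin (m+2) → Fin (m+2) → Fin (m+2) → A := aGam (dQ d) (hP h) (hP hi)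

lemma gP0 (b c) : gP d h hi 0 b c = 0 := by
  revert b c
  simp only [forall2, gP, aGam, sum2, hP]
  simp
lemma gP1 (b c) : gP d h hi 1 b c = 0 := by
  revert b c
  simp only [forall2, gP, aGam, sum2, hP]
  simp
lemma gPa0 (a c) : gP d h hi a 0 c = 0 := by
  revert a c
  simp only [forall2, gP, aGam, sum2, hP]
  simp
lemma gPa1 (a c) : gP d h hi a 1 c = 0 := by
  revert a c
  simp only [forall2, gP, aGam, sum2, hP]
  simp
lemma gPab0 (a c) : gP d h hi a c 0 = 0 := by
  revert a c
  simp only [forall2, gP, aGam, sum2, hP]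
  simp
lemma gPab1 (a c) : gP d h hi a c 1 = 0 := by
  revert a c
  simp only [forall2, gP, aGam, sum2, hP]
  simp
lemma gPs (i j k : Fin m) : gP d h hi i.succ.succ j.succ.succ k.succ.succ = tGam d h hi i j k := by
  simp only [gP, tGam, aGam, sum2, hP]
  simp

lemma ricP (i j : Fin m) : aRic (dQ d) (gP d h hi) i.succ.succ j.succ.succ = aRic (dT d) (tGam d h hi) i j := by
  simp only [aRic, sum2, aRm, gP0, gP1, gPa0, gPa1, gPab0, gPab1, gPs]
  simp

lemma ricP0 : aRic (dQ d) (gP d h hi) 0 0 = 0 := by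
  simp only [aRic, sum2, aRm, gP0, gP1, gPa0, gPa1, gPab0, gPab1, gPs]
  simp

lemma ricP1 : aRic (dQ d) (gP d h hi) 1 1 = 0 := by
  simp only [aRic, sum2, aRm, gP0, gP1, gPa0, gPa1, gPab0, gPab1, gPs]
  simp

lemma nabP (V : Fin m → A) (a b) : aNab (dQ d) (gP d h hi) (vP V) a b = tP (aNab (dT d) (tGam d h hi) V) a b := by
  revert a b
  simp only [forall2, sum2, aNab, gP0, gP1, gPa0, gPa1, gPab0, gPab1, gPs]
  simp
  intro i j; rfl

lemma cov2P0 (T : Fin (m+2) → Fin (m+2) → A) (a b) : aCov2 (dQ d) (gP d h hi) T 0 a b = 0 := by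
  simp only [aCov2, sum2, gP0, gP1, gPa0, gPa1, gPab0, gPab1, gPs]
  simp

lemma cov2P1 (T : Fin (m+2) → Fin (m+2) → A) (a b) : aCov2 (dQ d) (gP d h hi) T 1 a b = 0 := by
  simp only [aCov2, sum2, gP0, gP1, gPa0, gPa1, gPab0, gPab1, gPs]
  simp

lemma cov2Ps (T : Fin m → Fin m → A) (i j k : Fin m) :
    aCov2 (dQ d) (gP d h hi) (tP T) i.succ.succ j.succ.succ k.succ.succ = aCov2 (dT d) (tGam d h hi) T i j k := by
  simp only [aCov2, sum2, gP0, gP1, gPa0, gPa1, gPab0, gPab1, gPs]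
  simp

lemma dP_eq : (dP : Fin (m+2) → Derivation ℝ (Sm (m+2)) (Sm (m+2))) = dQ pdD := by
  have : ∀ a, (dP : Fin (m+2) → Derivation ℝ (Sm (m+2)) (Sm (m+2))) a = dQ pdD a := by
    rw [forall2]
    refine ⟨?_, ?_, fun i => ?_⟩
    · rw [dQ0, dP, if_neg]; simp
    · rw [dQ1, dP, if_neg]; simp
    · rw [dQs, dP, if_pos, dT]; simp
  exact funext this

end Pad

section Conc
variable {m : ℕ} {D : DegKundtData (m+2)}

lemma one_val : ((1 : Fin (m+2)) : ℕ) = 1 := by simp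

/-- transverse metric -/
def cH (hD : D.Regular) : Matrix (Fin m) (Fin m) (Sm (m+2)) := fun i j =>
  ⟨fun x => D.hT x i.succ.succ j.succ.succ, mem_Sm (hD.1.2.2.1 _ _)⟩
def cHi (hD : D.Regular) : Matrix (Fin m) (Fin m) (Sm (m+2)) := (cH hD)⁻¹
def cW1 (hD : D.Regular) (i : Fin m) : Sm (m+2) := ⟨fun x => D.W1 x i.succ.succ, mem_Sm (hD.2.2.2.2.2.2.2.2.2.1 _)⟩
def cW0 (hD : D.Regular) (i : Fin m) : Sm (m+2) := ⟨fun x => D.W0 x i.succ.succ, mem_Sm (hD.2.2.2.2.2.2.2.2.2.2.1 _)⟩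
def cH2 (hD : D.Regular) : Sm (m+2) := ⟨D.H2, mem_Sm hD.2.2.2.2.2.2.1⟩
def cH1 (hD : D.Regular) : Sm (m+2) := ⟨D.H1, mem_Sm hD.2.2.2.2.2.2.2.1⟩
def cH0 (hD : D.Regular) : Sm (m+2) := ⟨D.H0, mem_Sm hD.2.2.2.2.2.2.2.2.1⟩
def cW (hD : D.Regular) (i : Fin m) : Sm (m+2) := rC * cW1 hD i + cW0 hD i
def cF (hD : D.Regular) : Sm (m+2) := rC^2 * cH2 hD + rC * cH1 hD + cH0 hD
def cFr (hD : D.Regular) : Sm (m+2) := 2 * (rC * cH2 hD) + cH1 hD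

lemma hT_ev (hD : D.Regular) (x : Pt (m+2)) (a b : Fin (m+2)) : D.hT x a b = ev x (hP (cH hD) a b) := by
  revert a b
  have h := hD.1.1 x
  simp only [forall2]
  refine ⟨⟨?_, ?_, fun i => ?_⟩, ⟨?_, ?_, fun i => ?_⟩, fun i => ⟨?_, ?_, fun j => ?_⟩⟩
  · rw [h _ _ (by simp)]; simp
  · rw [h _ _ (by simp)]; simp
  · rw [h _ _ (by simp), if_neg (ss_ne0 i).symm]; simp
  · rw [h _ _ (by simp)]; simp
  · rw [h _ _ (by simp)]; simp
  · rw [h _ _ (by simp), if_neg (ss_ne1 i).symm]; simp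
  · rw [h _ _ (by simp), if_neg (ss_ne0 i)]; simp
  · rw [h _ _ (by simp), if_neg (ss_ne1 i)]; simp
  · rfl

lemma ev_det {n k : ℕ} (M : Matrix (Fin k) (Fin k) (Sm n)) (x : Pt n) : ev x M.det = Matrix.det (fun a b => ev x (M a b)) := by
  rw [AlgHom.map_det]; rfl

lemma cH_unit (hD : D.Regular) : IsUnit (cH hD).det := by
  apply smUnit
  intro x
  have hp : ((D.hT x).submatrix (fun i : Fin m => i.succ.succ) (fun i : Fin m => i.succ.succ)).PosDef :=
    (hD.1.2.2.2.2 x).submatrix (fun i j h => by simpa using h)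
  rw [ev_det]
  exact hp.det_pos.ne'

lemma cH_inv (hD : D.Regular) : cHi hD * cH hD = 1 := Matrix.nonsing_inv_mul _ (cH_unit hD)
lemma cH_inv' (hD : D.Regular) : cH hD * cHi hD = 1 := Matrix.mul_nonsing_inv _ (cH_unit hD)

lemma inv_ev {n k : ℕ} {M N : Matrix (Fin k) (Fin k) (Sm n)} (h : M * N = 1) {R : Matrix (Fin k) (Fin k) ℝ} {x : Pt n}
    (hR : ∀ a b, R a b = ev x (M a b)) (a b) : R⁻¹ a b = ev x (N a b) := by
  have e1 : R = M.map (ev x) := by ext a b; rw [hR]; rfl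
  have e2 : R * N.map (ev x) = 1 := by
    rw [e1, ← Matrix.map_mul, h]
    exact Matrix.map_one _ (map_zero _) (map_one _)
  rw [Matrix.inv_eq_right_inv e2]; rfl

lemma hTi_ev (hD : D.Regular) (x : Pt (m+2)) (a b : Fin (m+2)) : (D.hT x)⁻¹ a b = ev x (hP (cHi hD) a b) :=
  inv_ev (hP_mul _ _ (cH_inv' hD)) (hT_ev hD x) a b

lemma cH_symm (hD : D.Regular) (i j) : cH hD i j = cH hD j i := by
  apply ev_ext; intro x
  exact (hD.1.2.1 x).apply _ _

lemma cHi_symm (hD : D.Regular) (i j) : cHi hD i j = cHi hD j i := by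
  have : (cHi hD).transpose = cHi hD := by
    rw [cHi, Matrix.transpose_nonsing_inv]
    congr 1
    ext1 i j; exact cH_symm hD j i
  exact congrFun (congrFun this j) i

lemma hP_symm {A : Type*} [CommRing A] [Algebra ℝ A] {h : Matrix (Fin m) (Fin m) A} (hs : ∀ i j, h i j = h j i) (a b) : hP h a b = hP h b a := by
  revert a b
  simp only [forall2]
  refine ⟨⟨?_, ?_, fun i => ?_⟩, ⟨?_, ?_, fun i => ?_⟩, fun i => ⟨?_, ?_, fun j => ?_⟩⟩ <;> simp [hs]

/-- determinant -/
def cDet (hD : D.Regular) : Sm (m+2) := (hP (cH hD)).det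

lemma det_ev (hD : D.Regular) (x : Pt (m+2)) : (D.hT x).det = ev x (cDet hD) := by
  rw [cDet, ev_det]
  congr 1
  ext a b; exact hT_ev hD x a b

lemma det_pos (hD : D.Regular) (x : Pt (m+2)) : 0 < (D.hT x).det := (hD.1.2.2.2.2 x).det_pos

lemma lnS_eq (hD : D.Regular) (x : Pt (m+2)) : lnSqrtDet D.hT x = (1/2) * Real.log (ev x (cDet hD)) := by
  rw [lnSqrtDet, Real.log_sqrt (det_pos hD x).le, det_ev hD]; ring

def cL (hD : D.Regular) : Sm (m+2) := ⟨lnSqrtDet D.hT, by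
  apply mem_Sm
  have : lnSqrtDet D.hT = fun x => (1/2) * Real.log ((cDet hD).1 x) := funext (lnS_eq hD)
  rw [this]
  refine contDiff_const.mul ((smCd (cDet hD)).log fun x => ?_)
  have := det_pos hD x
  rw [det_ev hD] at this
  exact this.ne'⟩

lemma cL_d (hD : D.Regular) (a : Fin (m+2)) :
    pdD a (cL hD) = (1/2:ℝ) • ∑ i, ∑ j, cHi hD i j * pdD a (cH hD i j) := by
  have h0 : ∀ x, ev x (cDet hD) ≠ 0 := by
    intro x; have := det_pos hD x
    rw [det_ev hD] at this
    exact this.ne'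
  have h1 : cDet hD * pdD a (cL hD) = (1/2:ℝ) • pdD a (cDet hD) := by
    apply ev_ext; intro x
    rw [map_mul, map_smul, ev_pdD, ev_pdD]
    have : (cL hD).1 = fun x => (1/2) * Real.log ((cDet hD).1 x) := funext (lnS_eq hD)
    rw [this, pd, fderiv_const_mul ((smDiff (cDet hD) x).log (h0 x)), fderiv.log (smDiff (cDet hD) x) (h0 x)]
    simp only [_root_.smul_apply, smul_eq_mul, pd]
    have := h0 x
    rw [ev_apply] at this ⊢
    field_simp
  have h2 : pdD a (cDet hD) = cDet hD * ∑ i, ∑ j, cHi hD i j * pdD a (cH hD i j) := by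
    have hadj : ∀ i j, (hP (cH hD)).adjugate i j = cDet hD * hP (cHi hD) i j := by
      have : (hP (cH hD)).adjugate = cDet hD • hP (cHi hD) := by
        calc (hP (cH hD)).adjugate = (hP (cH hD)).adjugate * (hP (cH hD) * hP (cHi hD)) := by
              rw [hP_mul _ _ (cH_inv' hD), mul_one]
          _ = _ := by rw [← mul_assoc, Matrix.adjugate_mul, Matrix.smul_mul, one_mul]; rfl
      intro i j; rw [this]; rfl
    rw [cDet, deriv_det]
    simp only [hadj, sum2]
    simp only [hP00, hP01, hP10, hP11, hP0j, hP1j, hPi0, hPi1, hPij, map_zero, Derivation.map_one_eq_zero, mul_zero,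
      zero_add, add_zero, Finset.sum_const_zero, mul_assoc, ← Finset.mul_sum]
    rw [← cDet]
    congr 1
    refine Finset.sum_congr rfl fun i _ => Finset.sum_congr rfl fun j _ => ?_
    rw [cHi_symm]
  rw [h2, ← mul_smul_comm] at h1
  exact (smUnit _ h0).mul_left_cancel h1

lemma cK (hD : D.Regular) : AKundt pdD (cH hD) (cHi hD) (cW hD) (cW1 hD) (cF hD) (cFr hD) (cH2 hD) (cL hD) := by
  have w1 : ∀ i, pdD 1 (cW1 hD i) = 0 := fun i => indep_pd one_val _ fun x y h => congrFun (hD.2.2.2.2.1 x y h) _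
  have w0 : ∀ i, pdD 1 (cW0 hD i) = 0 := fun i => indep_pd one_val _ fun x y h => congrFun (hD.2.2.2.2.2.1 x y h) _
  have h2 : pdD 1 (cH2 hD) = 0 := indep_pd one_val _ hD.2.1
  have h1 : pdD 1 (cH1 hD) = 0 := indep_pd one_val _ hD.2.2.1
  have h0 : pdD 1 (cH0 hD) = 0 := indep_pd one_val _ hD.2.2.2.1
  have hr : pdD 1 (rC : Sm (m+2)) = 1 := by rw [pd_r, if_pos rfl]
  refine ⟨pdD_comm, ⟨fun a b f => pdD_comm _ _ _, cH_symm hD, cHi_symm hD, cH_inv hD, cH_inv' hD⟩, ?_, ?_, w1, ?_, ?_, h2, cL_d hD⟩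
  · intro i j
    exact indep_pd one_val _ fun x y h => congrFun (congrFun (hD.1.2.2.2.1 x y h) _) _
  · intro i
    rw [cW, map_add, Derivation.leibniz, w1, w0, hr]
    simp only [smul_eq_mul]; ring
  · rw [cF, map_add, map_add, Derivation.leibniz, Derivation.leibniz, Derivation.leibniz_pow, h2, h1, h0, hr, cFr]
    simp only [smul_eq_mul, nsmul_eq_mul]; push_cast; ring
  · rw [cFr, map_add, Derivation.leibniz, Derivation.leibniz, h2, h1, hr, d_two]
    simp only [smul_eq_mul]; ring

lemma cP (hD : D.Regular) : ARho rhoS pdD (cW hD) (cW0 hD) (cF hD) (cFr hD) (cH0 hD) (cH1 hD) := by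
  have w1 : ∀ i, pdD 1 (cW1 hD i) = 0 := fun i => indep_pd one_val _ fun x y h => congrFun (hD.2.2.2.2.1 x y h) _
  have w0 : ∀ i, pdD 1 (cW0 hD i) = 0 := fun i => indep_pd one_val _ fun x y h => congrFun (hD.2.2.2.2.2.1 x y h) _
  have h2 : pdD 1 (cH2 hD) = 0 := indep_pd one_val _ hD.2.1
  have h1 : pdD 1 (cH1 hD) = 0 := indep_pd one_val _ hD.2.2.1
  have h0 : pdD 1 (cH0 hD) = 0 := indep_pd one_val _ hD.2.2.2.1
  refine ⟨rho_fix, rho_com, ?_, ?_, ?_⟩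
  · intro i
    rw [cW, map_add, map_mul, rho_r, rho_fix _ (w0 i)]; ring
  · rw [cF, map_add, map_add, map_mul, map_mul, map_pow, rho_r, rho_fix _ h0]; ring
  · rw [cFr, map_add, map_mul, map_mul, rho_r, rho_fix _ h1]; ring

lemma metric_ev (hD : D.Regular) (x : Pt (m+2)) (a b : Fin (m+2)) : D.metric x a b = ev x (kG (cF hD) (cW hD) (cH hD) a b) := by
  revert a b
  simp only [forall2, DegKundtData.metric, kundtMetric, kG]
  refine ⟨⟨?_, ?_, fun i => ?_⟩, ⟨?_, ?_, fun i => ?_⟩, fun i => ⟨?_, ?_, fun j => ?_⟩⟩ <;> simp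
  · rfl
  · rfl
  · rfl
  · rfl

lemma metrici_ev (hD : D.Regular) (x : Pt (m+2)) (a b : Fin (m+2)) : (D.metric x)⁻¹ a b = ev x (kGi (cF hD) (cW hD) (cHi hD) a b) :=
  inv_ev (cK hD).full.inv' (metric_ev hD x) a b

lemma ricci_kG (hD : D.Regular) (x : Pt (m+2)) (a b : Fin (m+2)) :
    ricci D.metric x a b = ev x (aRic pdD (kGam pdD (cH hD) (cHi hD) (cW hD) (cF hD)) a b) :=
  ricci_ev (metric_ev hD) (metrici_ev hD) (cK hD).full.gis (cK hD).full.inv x a b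

end Conc

section Eqs
variable {m : ℕ} {D : DegKundtData (m+2)}

/-- transverse connection -/
def cG (hD : D.Regular) : Fin m → Fin m → Fin m → Sm (m+2) := tGam pdD (cH hD) (cHi hD)

lemma sumP (hD : D.Regular) (x : Pt (m+2)) (Y : Fin (m+2) → Fin (m+2) → ℝ) :
    ∑ b, ∑ c, (D.hT x)⁻¹ b c * Y b c = Y 0 0 + Y 1 1 + ∑ i : Fin m, ∑ j : Fin m, ev x (cHi hD i j) * Y i.succ.succ j.succ.succ := by
  simp only [hTi_ev hD, sum2]
  simp only [hP00, hP01, hP10, hP11, hP0j, hP1j, hPi0, hPi1, hPij, map_zero, map_one, zero_mul, one_mul, add_zero, zero_add,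
    Finset.sum_const_zero]

lemma ricT (hD : D.Regular) (x : Pt (m+2)) (a b : Fin (m+2)) : ricciT D.hT x a b = ev x (aRic (dQ pdD) (gP pdD (cH hD) (cHi hD)) a b) := by
  rw [ricciT_ev (hT_ev hD) (hTi_ev hD) (hP_symm (cHi_symm hD)) (hP_mul _ _ (cH_inv hD)), dP_eq]; rfl

lemma nabT (hD : D.Regular) {V : Pt (m+2) → Fin (m+2) → ℝ} {X : Fin m → Sm (m+2)} (hV : ∀ x a, V x a = ev x (vP X a))
    (x : Pt (m+2)) (b a : Fin (m+2)) : nablaT D.hT (oneForm V) x b a = ev x (tP (aNab (dT pdD) (cG hD) X) b a) := by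
  rw [nablaT, cov1_ev (hT_ev hD) (hTi_ev hD) (T := oneForm V) (V := vP X) (fun x v => hV x (v 0)), dP_eq]
  exact congrArg (ev x) (nabP _ _ _ _ _ _)

lemma nabTf (hD : D.Regular) {T : TensorField (m+2) 1} {X : Fin m → Sm (m+2)} (hV : ∀ x v, T x v = ev x (vP X (v 0)))
    (x : Pt (m+2)) (v : Fin 2 → Fin (m+2)) : covDT D.hT T x v = ev x (tP (aNab (dT pdD) (cG hD) X) (v 0) (v 1)) := by
  rw [cov1_ev (hT_ev hD) (hTi_ev hD) (V := vP X) hV, dP_eq]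
  exact congrArg (ev x) (nabP _ _ _ _ _ _)

lemma covT (hD : D.Regular) {T : TensorField (m+2) 2} {X : Fin m → Fin m → Sm (m+2)} (hV : ∀ x v, T x v = ev x (tP X (v 0) (v 1)))
    (x : Pt (m+2)) (c b a : Fin (m+2)) : covDT D.hT T x ![c, b, a] = ev x (aCov2 (dQ pdD) (gP pdD (cH hD) (cHi hD)) (tP X) c b a) := by
  rw [cov2_ev (hT_ev hD) (hTi_ev hD) (V := tP X) hV, dP_eq]; rfl

lemma nab2T (hD : D.Regular) {V : Pt (m+2) → Fin (m+2) → ℝ} {X : Fin m → Sm (m+2)} (hV : ∀ x a, V x a = ev x (vP X a))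
    (x : Pt (m+2)) (c b a : Fin (m+2)) : nablaT2 D.hT (oneForm V) x c b a =
      ev x (aCov2 (dQ pdD) (gP pdD (cH hD) (cHi hD)) (tP (aNab (dT pdD) (cG hD) X)) c b a) := by
  rw [nablaT2]
  exact covT hD (nabTf hD (fun x v => hV x (v 0))) x c b a

lemma W1_ev (hD : D.Regular) (x : Pt (m+2)) (a) : D.W1 x a = ev x (vP (cW1 hD) a) := by
  revert a
  rw [forall2]
  refine ⟨?_, ?_, fun i => rfl⟩
  · rw [hD.2.2.2.2.2.2.2.2.2.2.2.1 _ _ (by simp)]; simp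
  · rw [hD.2.2.2.2.2.2.2.2.2.2.2.1 _ _ (by simp)]; simp

lemma W0_ev (hD : D.Regular) (x : Pt (m+2)) (a) : D.W0 x a = ev x (vP (cW0 hD) a) := by
  revert a
  rw [forall2]
  refine ⟨?_, ?_, fun i => rfl⟩
  · rw [hD.2.2.2.2.2.2.2.2.2.2.2.2 _ _ (by simp)]; simp
  · rw [hD.2.2.2.2.2.2.2.2.2.2.2.2 _ _ (by simp)]; simp

lemma divT_ev (hD : D.Regular) {V : Pt (m+2) → Fin (m+2) → ℝ} {X : Fin m → Sm (m+2)} (hV : ∀ x a, V x a = ev x (vP X a))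
    (x : Pt (m+2)) : divT D.hT (oneForm V) x = ev x (aDv (dT pdD) (cG hD) (cHi hD) X) := by
  rw [divT, sumP hD]
  simp only [nabT hD hV, tP00, tP11, tPij, aDv, map_zero, zero_add, map_sum, map_mul]

lemma ip_ev (hD : D.Regular) {V U : Pt (m+2) → Fin (m+2) → ℝ} {X Y : Fin m → Sm (m+2)} (hV : ∀ x a, V x a = ev x (vP X a))
    (hU : ∀ x a, U x a = ev x (vP Y a))
    (x : Pt (m+2)) : ∑ a, ∑ b, (D.hT x)⁻¹ a b * V x a * U x b = ev x (aIp (cHi hD) X Y) := by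
  simp only [mul_assoc]
  rw [sumP hD x (fun a b => V x a * U x b)]
  simp only [hV, hU, vP0, vP1, vPs, aIp, map_zero, zero_add, map_sum, map_mul, mul_zero, zero_mul, add_zero, mul_assoc]

lemma forallT {P : Fin (m+2) → Prop} : (∀ a : Fin (m+2), 2 ≤ (a:ℕ) → P a) ↔ ∀ i : Fin m, P i.succ.succ := by
  rw [forall2]; simp

lemma ev_iff {n : ℕ} {f g : Sm n} : f = g ↔ ∀ x, ev x f = ev x g := ⟨fun h _ => by rw [h], ev_ext⟩

lemma eq1 (hD : D.Regular) (lam : ℝ) : (∀ (x : Pt (m+2)) (a b : Fin (m+2)), 2 ≤ (a : ℕ) → 2 ≤ (b : ℕ) →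
        ricciT D.hT x a b = lam * D.hT x a b
          + (1/2) * D.W1 x a * D.W1 x b
          - (1/2) * (nablaT D.hT (oneForm D.W1) x b a + nablaT D.hT (oneForm D.W1) x a b))
   ↔ E1 pdD (cH hD) (cHi hD) (cW1 hD) lam := by
  simp only [ricT hD, nabT hD (W1_ev hD), W1_ev hD, hT_ev hD]
  constructor
  · intro h i j
    apply ev_ext; intro x
    have := h x i.succ.succ j.succ.succ (by simp) (by simp)
    rw [ricP] at this
    rw [this]
    simp only [map_add, map_sub, map_mul, map_smul, smul_eq_mul, hPij, tPij, vPs, cG]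
    ring
  · intro h x a b ha hb
    revert b; rw [forallT]
    revert a; rw [forallT]
    intro i j
    rw [ricP, h i j]
    simp only [map_add, map_sub, map_mul, map_smul, smul_eq_mul, hPij, tPij, vPs, cG]
    ring

lemma eq2 (hD : D.Regular) (lam c : ℝ) (hc : c = ((m:ℝ) - 2)/2 * lam) : (∀ x : Pt (m+2), 2 * D.H2 x = ricciScalarT D.hT x / 2 - c
          + (1/4) * ∑ a, ∑ b, (D.hT x)⁻¹ a b * D.W1 x a * D.W1 x b)
   ↔ E2 pdD (cH hD) (cHi hD) (cW1 hD) (cH2 hD) lam := by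
  rw [E2, ev_iff]
  refine forall_congr' fun x => ?_
  rw [ip_ev hD (W1_ev hD) (W1_ev hD), ricciScalarT, sumP hD x]
  simp only [ricT hD, ricP, ricP0, ricP1, map_zero, zero_add]
  simp only [map_add, map_sub, map_mul, map_smul, smul_eq_mul, map_sum, map_one, ev_apply (f := cH2 hD), map_ofNat]
  rw [← hc]
  have : (cH2 hD).1 x = D.H2 x := rfl
  rw [this, mul_one, div_eq_inv_mul, one_div, one_div]

lemma eq3 (hD : D.Regular) (lam : ℝ) : (∀ (x : Pt (m+2)) (a : Fin (m+2)), 2 ≤ (a : ℕ) →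
        (∑ b, ∑ c, (D.hT x)⁻¹ b c * nablaT2 D.hT (oneForm D.W1) x c b a)
          = (1/2) * (∑ b, ∑ c, (D.hT x)⁻¹ b c * D.W1 x c *
                (3 * nablaT D.hT (oneForm D.W1) x b a - nablaT D.hT (oneForm D.W1) x a b))
            + D.W1 x a * (divT D.hT (oneForm D.W1) x
                - (1/2) * (∑ b, ∑ c, (D.hT x)⁻¹ b c * D.W1 x b * D.W1 x c)
                - lam))
   ↔ E3 pdD (cH hD) (cHi hD) (cW1 hD) lam := by
  simp only [forallT, E3]
  rw [forall_comm]
  refine forall_congr' fun i => ?_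
  rw [ev_iff]
  refine forall_congr' fun x => ?_
  rw [ip_ev hD (W1_ev hD) (W1_ev hD), divT_ev hD (W1_ev hD), sumP hD x]
  simp only [mul_assoc ((D.hT x)⁻¹ _ _)]
  rw [sumP hD x (fun b c => D.W1 x c * (3 * nablaT D.hT (oneForm D.W1) x b i.succ.succ - nablaT D.hT (oneForm D.W1) x i.succ.succ b))]
  have e1 : (1/2) * (3 * ev x (aIp (cHi hD) (cW1 hD) (fun k => aNab (dT pdD) (cG hD) (cW1 hD) k i))
      - ev x (aIp (cHi hD) (cW1 hD) (fun k => aNab (dT pdD) (cG hD) (cW1 hD) i k)))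
      = (1/2) * ∑ b, ∑ c, ev x (cHi hD b c) * (ev x (cW1 hD c) * (3 * ev x (aNab (dT pdD) (cG hD) (cW1 hD) b i)
         - ev x (aNab (dT pdD) (cG hD) (cW1 hD) i b))) := by
    simp only [aIp, map_sum, map_mul, Finset.mul_sum, ← Finset.sum_sub_distrib]
    rw [Finset.sum_comm]
    refine Finset.sum_congr rfl fun b _ => Finset.sum_congr rfl fun c _ => ?_
    rw [cHi_symm hD c b]; ring
  simp only [nab2T hD (W1_ev hD), nabT hD (W1_ev hD), W1_ev hD, cov2P0, cov2P1, cov2Ps, tP00, tP11, tPij, vP0, vP1, vPs, map_zero, zero_mul, mul_zero,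
    zero_add, aDv2]
  simp only [map_add, map_sub, map_mul, map_smul, smul_eq_mul, map_sum, map_one, map_ofNat, mul_one]
  rw [← cG, e1]
end Eqs

section Eqs
variable {m : ℕ} {D : DegKundtData (m+2)}

lemma dhT_ev (hD : D.Regular) (x : Pt (m+2)) (a b : Fin (m+2)) :
    pd (fun z => D.hT z a b) 0 x = ev x (tP (fun i j => pdD 0 (cH hD i j)) a b) := by
  rw [pd_ev _ (fun y => hT_ev hD y a b)]
  congr 1
  revert a b
  simp only [forall2]
  refine ⟨⟨?_, ?_, fun i => ?_⟩, ⟨?_, ?_, fun i => ?_⟩, fun i => ⟨?_, ?_, fun j => ?_⟩⟩ <;>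
    simp only [hP00, hP01, hP10, hP11, hP0j, hP1j, hPi0, hPi1, hPij, tP00, tP01, tP10, tP11, tP0j, tP1j, tPi0, tPi1, tPij,
      map_zero, Derivation.map_one_eq_zero]

lemma dhTi_ev (hD : D.Regular) (x : Pt (m+2)) (a b : Fin (m+2)) :
    pd (fun z => (D.hT z)⁻¹ a b) 0 x = ev x (tP (fun i j => pdD 0 (cHi hD i j)) a b) := by
  rw [pd_ev _ (fun y => hTi_ev hD y a b)]
  congr 1
  revert a b
  simp only [forall2]
  refine ⟨⟨?_, ?_, fun i => ?_⟩, ⟨?_, ?_, fun i => ?_⟩, fun i => ⟨?_, ?_, fun j => ?_⟩⟩ <;>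
    simp only [hP00, hP01, hP10, hP11, hP0j, hP1j, hPi0, hPi1, hPij, tP00, tP01, tP10, tP11, tP0j, tP1j, tPi0, tPi1, tPij,
      map_zero, Derivation.map_one_eq_zero]

lemma dvP_ev {V : Pt (m+2) → Fin (m+2) → ℝ} {X : Fin m → Sm (m+2)} (hV : ∀ x a, V x a = ev x (vP X a))
    (c : Fin (m+2)) (x : Pt (m+2)) (a : Fin (m+2)) :
    pd (fun z => V z a) c x = ev x (vP (fun i => pdD c (X i)) a) := by
  rw [pd_ev _ (fun y => hV y a)]
  congr 1
  revert a
  simp only [forall2, vP0, vP1, vPs, map_zero, implies_true, and_self]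

lemma pdL (hD : D.Regular) (a x) : pd (lnSqrtDet D.hT) a x = ev x (pdD a (cL hD)) := rfl
lemma pdLL (hD : D.Regular) (a x) : pd (fun y => pd (lnSqrtDet D.hT) 0 y) a x = ev x (pdD a (pdD 0 (cL hD))) := rfl
lemma evH0 (hD : D.Regular) (x) : D.H0 x = ev x (cH0 hD) := rfl
lemma evH1 (hD : D.Regular) (x) : D.H1 x = ev x (cH1 hD) := rfl
lemma pdH1 (hD : D.Regular) (a x) : pd D.H1 a x = ev x (pdD a (cH1 hD)) := rfl
lemma pdH0 (hD : D.Regular) (a x) : pd D.H0 a x = ev x (pdD a (cH0 hD)) := rfl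

lemma eq4 (hD : D.Regular) (lam c4 : ℝ) (hc : c4 = 2 * lam) : (∀ (x : Pt (m+2)) (a : Fin (m+2)), 2 ≤ (a : ℕ) →
        2 * pd D.H1 a x =
          - (∑ b, ∑ c, (D.hT x)⁻¹ b c *
              covDT D.hT (fun y idx => pd (fun z => D.hT z (idx 0) (idx 1)) 0 y) x ![c, a, b])
          + (∑ b, ∑ c, (D.hT x)⁻¹ b c *
              (nablaT2 D.hT (oneForm D.W0) x c b a - nablaT2 D.hT (oneForm D.W0) x c a b))
          - 2 * (∑ b, ∑ c, (D.hT x)⁻¹ b c * D.W0 x c * nablaT D.hT (oneForm D.W1) x b a)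
          + pd (fun y => ∑ b, ∑ c, (D.hT y)⁻¹ b c * D.W0 y b * D.W1 y c) a x
          + pd (fun y => D.W1 y a) 0 x
          + 2 * pd (fun y => pd (lnSqrtDet D.hT) 0 y) a x
          + D.W1 x a * ((∑ b, ∑ c, (D.hT x)⁻¹ b c * D.W0 x b * D.W1 x c)
              - divT D.hT (oneForm D.W0) x + pd (lnSqrtDet D.hT) 0 x)
          + c4 * D.W0 x a)
   ↔ ∀ a, E4 pdD (cH hD) (cHi hD) (cW1 hD) (cW0 hD) (cH1 hD) (cL hD) lam a := by
  simp only [forallT]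
  rw [forall_comm]
  refine forall_congr' fun i => ?_
  rw [E4, ev_iff]
  refine forall_congr' fun x => ?_
  rw [divT_ev hD (W0_ev hD), sumP hD x, sumP hD x]
  simp only [ip_ev hD (W0_ev hD) (W1_ev hD)]
  rw [pd_ev (aIp (cHi hD) (cW0 hD) (cW1 hD)) (fun y => rfl), dvP_ev (W1_ev hD), pdLL hD, pdL hD,
    pdH1 hD]
  simp only [mul_assoc ((D.hT x)⁻¹ _ _)]
  rw [sumP hD x (fun b c => D.W0 x c * nablaT D.hT (oneForm D.W1) x b i.succ.succ)]
  simp only [covT hD (fun x v => dhT_ev hD x (v 0) (v 1)), nab2T hD (W0_ev hD), nabT hD (W1_ev hD), W1_ev hD, W0_ev hD, cov2P0, cov2P1, cov2Ps, tP00, tP11, tPij, vP0, vP1, vPs, map_zero, zero_mul, mul_zero,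
    zero_add, sub_zero]
  simp only [map_add, map_sub, map_mul, map_neg, map_smul, smul_eq_mul, map_sum, map_one, map_ofNat, mul_one, mul_assoc, hc]
  exact Iff.rfl

def aQ4 {A : Type*} [CommRing A] [Algebra ℝ A] (hi : Matrix (Fin m) (Fin m) A) (N : Fin m → Fin m → A) : A :=
  ∑ a, ∑ b, ∑ c, ∑ e, hi a c * hi b e * ((1/2:ℝ) • (N b a - N a b)) * ((1/2:ℝ) • (N e c - N c e))

def aInn {A : Type*} [CommRing A] [Algebra ℝ A] (hi : Matrix (Fin m) (Fin m) A) (N : Fin m → Fin m → A) (W1 : Fin m → A)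
    (b : Fin m) : A := ∑ a, ∑ e, hi a e * W1 e * ((1/2:ℝ) • (N b a - N a b))

def aBig {A : Type*} [CommRing A] [Algebra ℝ A] (hi : Matrix (Fin m) (Fin m) A) (N : Fin m → Fin m → A) (W1 W0 d0 d1 : Fin m → A) : A :=
  ∑ b, ∑ c, hi b c * W0 c * (2 * aInn hi N W1 b + d0 b - 2 * d1 b)

def aDw {A : Type*} [CommRing A] (hi : Matrix (Fin m) (Fin m) A) (N : Fin m → Fin m → A) : A :=
  ∑ a, ∑ b, hi a b * N b a

def aLast {A : Type*} [CommRing A] (X Y : Fin m → Fin m → A) : A := ∑ a, ∑ b, X a b * Y a b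

lemma inngen {A : Type*} [CommRing A] [Algebra ℝ A] (φ : A →ₐ[ℝ] ℝ) (hi : Matrix (Fin m) (Fin m) A)
    (N : Fin m → Fin m → A) (W1 : Fin m → A) (b : Fin m) : φ (aInn hi N W1 b) = 
     ∑ a, ∑ e, φ (hi a e) * (φ (W1 e) * ((1/2) * (φ (N b a) - φ (N a b)))) := by
  simp only [aInn, map_sum, map_mul, map_smul, map_sub, smul_eq_mul, mul_assoc]

lemma biggen {A : Type*} [CommRing A] [Algebra ℝ A] (φ : A →ₐ[ℝ] ℝ) (hi : Matrix (Fin m) (Fin m) A)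
    (N : Fin m → Fin m → A) (W1 W0 d0 d1 : Fin m → A) : φ (aBig hi N W1 W0 d0 d1) = 
     ∑ b, ∑ c, φ (hi b c) * (φ (W0 c) * (2 * φ (aInn hi N W1 b) + φ (d0 b) - 2 * φ (d1 b))) := by
  simp only [aBig, map_sum, map_mul, map_add, map_sub, map_ofNat, mul_assoc]

lemma dwgen {A : Type*} [CommRing A] [Algebra ℝ A] (φ : A →ₐ[ℝ] ℝ) (hi : Matrix (Fin m) (Fin m) A)
    (N : Fin m → Fin m → A) : φ (aDw hi N) = ∑ a, ∑ b, φ (hi a b) * φ (N b a) := by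
  simp only [aDw, map_sum, map_mul]

lemma lastgen {A : Type*} [CommRing A] [Algebra ℝ A] (φ : A →ₐ[ℝ] ℝ) (X Y : Fin m → Fin m → A) :
    φ (aLast X Y) = ∑ a, ∑ b, φ (X a b) * φ (Y a b) := by
  simp only [aLast, map_sum, map_mul]

lemma e5gen {A : Type*} [CommRing A] [Algebra ℝ A] (φ : A →ₐ[ℝ] ℝ) (d : Fin (m+2) → Derivation ℝ A A)
    (h hi : Matrix (Fin m) (Fin m) A) (W1 W0 : Fin m → A) (H0 H1 L τ : A) (lam : ℝ) :
    (φ (aDv (dT d) (tGam d h hi) hi (fun j => d j.succ.succ H0) + aIp hi W1 (fun j => d j.succ.succ H0)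
    + aDv (dT d) (tGam d h hi) hi W1 * H0)
  = φ (aIp hi W0 W0 * ((1/2:ℝ) • aDv (dT d) (tGam d h hi) hi W1 - lam • (1:A))
    + H1 * (aDv (dT d) (tGam d h hi) hi W0 - d 0 L) - (1/2:ℝ) • (aIp hi W0 W1)^2
    + (∑ a, ∑ b, ∑ c, ∑ e, hi a c * hi b e *
        ((1/2:ℝ) • (aNab (dT d) (tGam d h hi) W0 b a - aNab (dT d) (tGam d h hi) W0 a b)) *
        ((1/2:ℝ) • (aNab (dT d) (tGam d h hi) W0 e c - aNab (dT d) (tGam d h hi) W0 c e)))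
    + (∑ a, ∑ b, hi a b * aNab (dT d) (tGam d h hi) (fun j => d 0 (W0 j)) b a)
    - (∑ b, ∑ c, hi b c * W0 c * (2 * (∑ a, ∑ e, hi a e * W1 e *
         ((1/2:ℝ) • (aNab (dT d) (tGam d h hi) W0 b a - aNab (dT d) (tGam d h hi) W0 a b)))
         + d 0 (W1 b) - 2 * d b.succ.succ H1))
    - d 0 (d 0 L) + (1/4:ℝ) • (∑ a, ∑ b, d 0 (hi a b) * d 0 (h a b)) - τ))
  ↔ (φ (aDv (dT d) (tGam d h hi) hi (fun j => d j.succ.succ H0)) + φ (aIp hi W1 (fun j => d j.succ.succ H0))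
    + φ (aDv (dT d) (tGam d h hi) hi W1) * φ H0
  = φ (aIp hi W0 W0) * ((1/2) * φ (aDv (dT d) (tGam d h hi) hi W1) - lam)
    + φ H1 * (φ (aDv (dT d) (tGam d h hi) hi W0) - φ (d 0 L)) - (1/2) * (φ (aIp hi W0 W1))^2
    + φ (aQ4 hi (aNab (dT d) (tGam d h hi) W0))
    + φ (aDw hi (aNab (dT d) (tGam d h hi) (fun j => d 0 (W0 j))))
    - φ (aBig hi (aNab (dT d) (tGam d h hi) W0) W1 W0 (fun j => d 0 (W1 j)) (fun j => d j.succ.succ H1))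
    - φ (d 0 (d 0 L)) + (1/4) * φ (aLast (fun i j => d 0 (hi i j)) (fun i j => d 0 (h i j))) - φ τ) := by
  rw [aQ4, aDw, aBig, aLast]
  simp only [aInn]
  simp only [map_add φ, map_sub φ, map_mul φ _ H0, map_mul φ H1, map_mul φ (aIp hi W0 W0), map_smul φ, map_pow φ, smul_eq_mul, map_one φ, mul_one]

lemma q4gen {A : Type*} [CommRing A] [Algebra ℝ A] (φ : A →ₐ[ℝ] ℝ) (hi : Matrix (Fin m) (Fin m) A)
    (N : Fin m → Fin m → A) :
    φ (aQ4 hi N)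
    = ∑ a, ∑ c, φ (hi a c) * ∑ b, ∑ e, φ (hi b e) *
        (((1/2) * (φ (N b a) - φ (N a b))) * ((1/2) * (φ (N e c) - φ (N c e)))) := by
  simp only [aQ4, map_sum, map_mul, map_smul, map_sub, smul_eq_mul, Finset.mul_sum]
  refine Finset.sum_congr rfl fun a _ => ?_
  rw [Finset.sum_comm]
  refine Finset.sum_congr rfl fun c _ => Finset.sum_congr rfl fun b _ => Finset.sum_congr rfl fun e _ => ?_
  ring

lemma q4re {n : ℕ} (hi X : Fin n → Fin n → ℝ) :
    ∑ a, ∑ b, ∑ c, ∑ d, hi a c * hi b d * ((1/2) * (X b a - X a b)) * ((1/2) * (X d c - X c d))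
    = ∑ a, ∑ c, hi a c * ∑ b, ∑ d, hi b d * (((1/2) * (X b a - X a b)) * ((1/2) * (X d c - X c d))) := by
  simp only [Finset.mul_sum]
  refine Finset.sum_congr rfl fun a _ => ?_
  rw [Finset.sum_comm]
  refine Finset.sum_congr rfl fun c _ => Finset.sum_congr rfl fun b _ => Finset.sum_congr rfl fun e _ => ?_
  ring

lemma e5q4 (hD : D.Regular) (x : Pt (m+2)) : ∑ a, ∑ b, ∑ c, ∑ d, (D.hT x)⁻¹ a c * (D.hT x)⁻¹ b d *
              ((1/2) * (nablaT D.hT (oneForm D.W0) x b a - nablaT D.hT (oneForm D.W0) x a b)) *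
              ((1/2) * (nablaT D.hT (oneForm D.W0) x d c - nablaT D.hT (oneForm D.W0) x c d))
      = ev x (aQ4 (cHi hD) (aNab (dT pdD) (cG hD) (cW0 hD))) := by
  refine (q4re (fun a b => (D.hT x)⁻¹ a b) (fun a b => nablaT D.hT (oneForm D.W0) x a b)).trans ?_
  refine Eq.trans ?_ (q4gen (ev x) (cHi hD) (aNab (dT pdD) (cG hD) (cW0 hD))).symm
  rw [sumP hD x]
  simp only [sumP hD x]
  simp only [nabT hD (W0_ev hD), tP00, tP01, tP10, tP11, tP0j, tP1j, tPi0, tPi1, tPij, map_zero, sub_zero, mul_zero, zero_mul,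
    add_zero, zero_add, Finset.sum_const_zero]

lemma e5lap (hD : D.Regular) (x : Pt (m+2)) : laplaceT D.hT D.H0 x = ev x (aDv (dT pdD) (cG hD) (cHi hD) (fun j => pdD j.succ.succ (cH0 hD))) := by
    rw [laplaceT, sumP hD x]
    have : ∀ (y : Pt (m+2)) (v : Fin 1 → Fin (m+2)), gradT D.H0 y v = ev y (vP (fun j => pdD j.succ.succ (cH0 hD)) (v 0)) := by
      intro y v
      generalize e : v 0 = a
      rw [gradT, e, pdT_ev (cH0 hD) (evH0 hD), dP_eq]
      congr 1
      clear e; revert a; simp only [forall2]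
      simp [dT]
    simp only [nabTf hD this, aDv, map_sum, map_mul]
    simp
lemma e5gr (hD : D.Regular) (x : Pt (m+2)) : ∑ b, ∑ c, (D.hT x)⁻¹ b c * D.W1 x b * pd D.H0 c x = ev x (aIp (cHi hD) (cW1 hD) (fun j => pdD j.succ.succ (cH0 hD))) := by
    simp only [mul_assoc]
    rw [sumP hD x (fun b c => D.W1 x b * pd D.H0 c x)]
    simp only [W1_ev hD, pdH0 hD, vP0, vP1, vPs, aIp, map_sum, map_mul, map_zero, zero_mul, zero_add, mul_assoc]
lemma e5dw (hD : D.Regular) (x : Pt (m+2)) : ∑ a, ∑ b, (D.hT x)⁻¹ a b *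
              covDT D.hT (fun y idx => pd (fun z => D.W0 z (idx 0)) 0 y) x ![b, a]
      = ev x (aDw (cHi hD) (aNab (dT pdD) (cG hD) (fun j => pdD 0 (cW0 hD j)))) := by
    rw [sumP hD x, dwgen]
    simp only [nabTf hD (fun x v => dvP_ev (W0_ev hD) 0 x (v 0)), map_sum, map_mul]
    simp
lemma e5inn (hD : D.Regular) (x : Pt (m+2)) : ∀ b : Fin m, ∑ a, ∑ d, (D.hT x)⁻¹ a d * D.W1 x d *
                  ((1/2) * (nablaT D.hT (oneForm D.W0) x b.succ.succ a - nablaT D.hT (oneForm D.W0) x a b.succ.succ))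
      = ev x (aInn (cHi hD) (aNab (dT pdD) (cG hD) (cW0 hD)) (cW1 hD) b) := by
    intro b
    rw [inngen]
    simp only [mul_assoc ((D.hT x)⁻¹ _ _)]
    rw [sumP hD x (fun a d => D.W1 x d * ((1/2) * (nablaT D.hT (oneForm D.W0) x b.succ.succ a - nablaT D.hT (oneForm D.W0) x a b.succ.succ)))]
    simp only [nabT hD (W0_ev hD), W1_ev hD, vP0, vP1, vPs, tPij, map_zero, zero_mul, zero_add]

lemma e5big (hD : D.Regular) (x : Pt (m+2)) : ∑ b, ∑ c, (D.hT x)⁻¹ b c * D.W0 x c *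
              (2 * (∑ a, ∑ d, (D.hT x)⁻¹ a d * D.W1 x d *
                  ((1/2) * (nablaT D.hT (oneForm D.W0) x b a - nablaT D.hT (oneForm D.W0) x a b)))
                + pd (fun y => D.W1 y b) 0 x - 2 * pd D.H1 b x)
      = ev x (aBig (cHi hD) (aNab (dT pdD) (cG hD) (cW0 hD)) (cW1 hD) (cW0 hD) (fun j => pdD 0 (cW1 hD j)) (fun j => pdD j.succ.succ (cH1 hD))) := by
    rw [biggen]
    have := sumP hD x (fun b c => D.W0 x c * (2 * (∑ a, ∑ d, (D.hT x)⁻¹ a d * D.W1 x d *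
                  ((1/2) * (nablaT D.hT (oneForm D.W0) x b a - nablaT D.hT (oneForm D.W0) x a b)))
                + pd (fun y => D.W1 y b) 0 x - 2 * pd D.H1 b x))
    simp only [← mul_assoc ((D.hT x)⁻¹ _ _) (D.W0 x _) _] at this
    rw [this]
    simp only [e5inn hD, W0_ev hD, vP0, vP1, vPs, map_zero, zero_mul, zero_add, dvP_ev (W1_ev hD), pdH1 hD]

lemma e5last (hD : D.Regular) (x : Pt (m+2)) : ∑ a, ∑ b, pd (fun y => (D.hT y)⁻¹ a b) 0 x * pd (fun y => D.hT y a b) 0 x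
      = ev x (aLast (fun i j => pdD 0 (cHi hD i j)) (fun i j => pdD 0 (cH hD i j))) := by
    rw [lastgen]
    simp only [dhT_ev hD, dhTi_ev hD, sum2]
    simp
lemma eq5 (hD : D.Regular) (lam : ℝ) (τ : Sm (m+2)) (t : Pt (m+2) → ℝ) (ht : ∀ x, t x = ev x τ) : (∀ x : Pt (m+2),
        laplaceT D.hT D.H0 x
          + (∑ b, ∑ c, (D.hT x)⁻¹ b c * D.W1 x b * pd D.H0 c x)
          + divT D.hT (oneForm D.W1) x * D.H0 x
        = (∑ b, ∑ c, (D.hT x)⁻¹ b c * D.W0 x b * D.W0 x c) *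
            ((1/2) * divT D.hT (oneForm D.W1) x - lam)
          + D.H1 x * (divT D.hT (oneForm D.W0) x - pd (lnSqrtDet D.hT) 0 x)
          - (1/2) * (∑ b, ∑ c, (D.hT x)⁻¹ b c * D.W0 x b * D.W1 x c)^2
          + (∑ a, ∑ b, ∑ c, ∑ d, (D.hT x)⁻¹ a c * (D.hT x)⁻¹ b d *
              ((1/2) * (nablaT D.hT (oneForm D.W0) x b a - nablaT D.hT (oneForm D.W0) x a b)) *
              ((1/2) * (nablaT D.hT (oneForm D.W0) x d c - nablaT D.hT (oneForm D.W0) x c d)))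
          + (∑ a, ∑ b, (D.hT x)⁻¹ a b *
              covDT D.hT (fun y idx => pd (fun z => D.W0 z (idx 0)) 0 y) x ![b, a])
          - (∑ b, ∑ c, (D.hT x)⁻¹ b c * D.W0 x c *
              (2 * (∑ a, ∑ d, (D.hT x)⁻¹ a d * D.W1 x d *
                  ((1/2) * (nablaT D.hT (oneForm D.W0) x b a - nablaT D.hT (oneForm D.W0) x a b)))
                + pd (fun y => D.W1 y b) 0 x - 2 * pd D.H1 b x))
          - pd (fun y => pd (lnSqrtDet D.hT) 0 y) 0 x
          + (1/4) * (∑ a, ∑ b, pd (fun y => (D.hT y)⁻¹ a b) 0 x * pd (fun y => D.hT y a b) 0 x)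
          - t x)
   ↔ E5 pdD (cH hD) (cHi hD) (cW1 hD) (cW0 hD) (cH0 hD) (cH1 hD) (cL hD) τ lam := by
  rw [E5, ev_iff]
  refine forall_congr' fun x => ?_
  refine Iff.trans ?_ (e5gen (ev x) _ _ _ _ _ _ _ _ _ _).symm
  rw [e5q4 hD, e5lap hD, e5gr hD, e5dw hD, e5big hD, e5last hD, divT_ev hD (W0_ev hD), divT_ev hD (W1_ev hD), ip_ev hD (W0_ev hD) (W1_ev hD),
    ip_ev hD (W0_ev hD) (W0_ev hD), pdLL hD, pdL hD, ht, evH0 hD, evH1 hD]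
  exact Iff.rfl
end Eqs

section Alt
variable {n k : ℕ}

/-- alternating functions of indices -/
def AltF (a : (Fin k → Fin n) → ℝ) : Prop :=
  ∀ (v : Fin k → Fin n) (σ : Equiv.Perm (Fin k)), a (v ∘ σ) = ((Equiv.Perm.sign σ : ℤ) : ℝ) * a v

lemma AltF.eq_zero {a : (Fin k → Fin n) → ℝ} (ha : AltF a) (v : Fin k → Fin n) {i j : Fin k} (hij : i ≠ j)
    (h : v i = v j) : a v = 0 := by
  have := ha v (Equiv.swap i j)
  rw [Equiv.Perm.sign_swap hij] at this
  have e : v ∘ (Equiv.swap i j) = v := by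
    ext l
    simp only [Function.comp]
    rcases eq_or_ne l i with rfl | h1
    · rw [Equiv.swap_apply_left, h]
    rcases eq_or_ne l j with rfl | h2
    · rw [Equiv.swap_apply_right, h]
    rw [Equiv.swap_apply_of_ne_of_ne h1 h2]
  rw [e] at this
  push_cast at this
  linarith

lemma prod_upd [inst : DecidableEq (Fin k)] (v : Fin k → Fin n → ℝ) (i : Fin k) (z : Fin n → ℝ) (idx : Fin k → Fin n) :
    ∏ l, Function.update v i z l (idx l) = z (idx i) * ∏ l ∈ Finset.univ.erase i, v l (idx l) := by
  rw [← Finset.mul_prod_erase Finset.univ _ (Finset.mem_univ i), Function.update_self]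
  congr 1
  refine Finset.prod_congr rfl fun l hl => ?_
  rw [Function.update_of_ne (Finset.ne_of_mem_erase hl)]

/-- the alternating map attached to an alternating function of indices -/
def toAlt (a : (Fin k → Fin n) → ℝ) (ha : AltF a) : (Fin n → ℝ) [⋀^Fin k]→ₗ[ℝ] ℝ :=
  { toFun := fun v => ∑ idx : Fin k → Fin n, (∏ l, v l (idx l)) * a idx
    map_update_add' := by
      intro _ v i x y
      rw [← Finset.sum_add_distrib]
      refine Finset.sum_congr rfl fun idx _ => ?_
      rw [← add_mul]
      congr 1
      rw [prod_upd, prod_upd, prod_upd, Pi.add_apply, add_mul]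
    map_update_smul' := by
      intro _ v i c x
      rw [Finset.smul_sum]
      refine Finset.sum_congr rfl fun idx _ => ?_
      rw [prod_upd, prod_upd, Pi.smul_apply, smul_eq_mul, smul_eq_mul]
      ring
    map_eq_zero_of_eq' := by
      intro v i j h hij
      have key : ∑ idx : Fin k → Fin n, (∏ l, v l (idx l)) * a idx = - ∑ idx : Fin k → Fin n, (∏ l, v l (idx l)) * a idx := by
        rw [← Finset.sum_neg_distrib]
        refine Fintype.sum_equiv (Equiv.arrowCongr (Equiv.swap i j) (Equiv.refl _)) _ _ fun idx => ?_
        have e : (Equiv.arrowCongr (Equiv.swap i j) (Equiv.refl _)) idx = idx ∘ (Equiv.swap i j) := by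
          ext l; simp [Equiv.arrowCongr]
        rw [e, ha, Equiv.Perm.sign_swap hij]
        push_cast
        have : ∏ l, v l ((idx ∘ (Equiv.swap i j)) l) = ∏ l, v l (idx l) := by
          rw [← Equiv.prod_comp (Equiv.swap i j)]
          refine Finset.prod_congr rfl fun l _ => ?_
          simp only [Function.comp, Equiv.swap_apply_self]
          refine congrFun (?_ : v _ = v _) _
          rcases eq_or_ne l i with rfl | h1
          · rw [Equiv.swap_apply_left, h]
          rcases eq_or_ne l j with rfl | h2
          · rw [Equiv.swap_apply_right, h]
          rw [Equiv.swap_apply_of_ne_of_ne h1 h2]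
        rw [this]; ring
      linarith }

lemma toAlt_single (a : (Fin k → Fin n) → ℝ) (ha : AltF a) (idx : Fin k → Fin n) :
    toAlt a ha (fun l => Pi.single (idx l) 1) = a idx := by
  show ∑ idx' : Fin k → Fin n, (∏ l, (Pi.single (idx l) 1 : Fin n → ℝ) (idx' l)) * a idx' = _
  rw [Finset.sum_eq_single idx]
  · simp
  · intro b _ hb
    obtain ⟨l, hl⟩ := Function.ne_iff.1 hb
    rw [Finset.prod_eq_zero (Finset.mem_univ l), zero_mul]
    simp [Pi.single_apply, hl]
  · simp

/-- the antisymmetrized sum -/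
def altS (a : Fin n → (Fin k → Fin n) → ℝ) (idx : Fin (k+1) → Fin n) : ℝ :=
  ∑ m : Fin (k+1), (-1 : ℝ)^(m:ℕ) * a (idx m) (fun i => idx (m.succAbove i))

lemma altS_alt (a : Fin n → (Fin k → Fin n) → ℝ) (ha : ∀ b, AltF (a b)) : AltF (altS a) := by
  let L : (Fin n → ℝ) →ₗ[ℝ] (Fin n → ℝ) [⋀^Fin k]→ₗ[ℝ] ℝ :=
    ∑ b, (LinearMap.proj b : (Fin n → ℝ) →ₗ[ℝ] ℝ).smulRight (toAlt (a b) (ha b))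
  have hL : ∀ b, L (Pi.single b 1) = toAlt (a b) (ha b) := by
    intro b
    simp only [L, LinearMap.sum_apply, LinearMap.smulRight_apply, LinearMap.proj_apply, Pi.single_apply, ite_smul, one_smul, zero_smul]
    simp
  have key : ∀ idx, altS a idx = AlternatingMap.alternatizeUncurryFin L (fun l => Pi.single (idx l) 1) := by
    intro idx
    rw [AlternatingMap.alternatizeUncurryFin_apply, altS]
    refine Finset.sum_congr rfl fun m _ => ?_
    rw [hL]
    have : m.removeNth (fun l => (Pi.single (idx l) 1 : Fin n → ℝ)) = fun i => Pi.single (idx (m.succAbove i)) 1 := rfl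
    rw [this, toAlt_single]
    simp
  intro v σ
  rw [key, key]
  have := AlternatingMap.map_perm (AlternatingMap.alternatizeUncurryFin L) (fun l => Pi.single (v l) 1) σ
  have e : (fun l => (Pi.single ((v ∘ σ) l) 1 : Fin n → ℝ)) = (fun l => Pi.single (v l) 1) ∘ σ := rfl
  rw [e, this]
  rcases Int.units_eq_one_or (Equiv.Perm.sign σ) with h | h <;> simp [h]
end Alt

section Alt2
variable {n k : ℕ}

lemma AltF.insertNth {a : (Fin (k+1) → Fin n) → ℝ} (ha : AltF a) (p : Fin (k+1)) (b : Fin n) (c : Fin k → Fin n) :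
    a (p.insertNth b c) = (-1)^(p:ℕ) * a (Fin.cons b c) := by
  have := ha (p.insertNth b c) p.cycleRange.symm
  rw [Fin.insertNth_comp_cycleRange_symm, Equiv.Perm.sign_symm, Fin.sign_cycleRange] at this
  rw [this]
  push_cast
  rw [← mul_assoc, ← mul_pow]
  simp

lemma permSign_alt : AltF (fun v : Fin n → Fin n => ((permSign v : ℤ) : ℝ)) := by
  intro v σ
  show ((permSign (v ∘ σ) : ℤ) : ℝ) = _ * ((permSign v : ℤ) : ℝ)
  by_cases h : Function.Bijective v
  · have h' : Function.Bijective (v ∘ σ) := h.comp σ.bijective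
    rw [permSign, permSign, dif_pos h, dif_pos h']
    have : Equiv.ofBijective (v ∘ σ) h' = (Equiv.ofBijective v h) * σ := by ext i; rfl
    rw [this, Equiv.Perm.sign_mul]
    push_cast; ring
  · have h' : ¬ Function.Bijective (v ∘ σ) := fun h' => h (by
      have := h'.comp σ.symm.bijective
      rwa [Function.comp_assoc, Equiv.self_comp_symm] at this)
    rw [permSign, permSign, dif_neg h, dif_neg h']; simp

lemma permSign_ne {v : Fin n → Fin n} (h : Function.Injective v) : ((permSign v : ℤ) : ℝ) ≠ 0 := by
  rw [permSign, dif_pos (Finite.injective_iff_bijective.1 h)]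
  rcases Int.units_eq_one_or (Equiv.Perm.sign (Equiv.ofBijective v (Finite.injective_iff_bijective.1 h))) with h | h <;> simp [h]

lemma permSign_zero {v : Fin n → Fin n} (h : ¬ Function.Injective v) : ((permSign v : ℤ) : ℝ) = 0 := by
  rw [permSign, dif_neg (fun h' => h h'.1)]; simp

lemma schouten (b : Fin n) (B : Fin (n+1) → Fin n) :
    altS (fun b' v => if b' = b then ((permSign v : ℤ) : ℝ) else 0) B = 0 := by
  have ha := altS_alt (fun b' v => if b' = b then ((permSign v : ℤ) : ℝ) else 0) (by
    intro b' v σ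
    dsimp only
    split_ifs
    · exact permSign_alt v σ
    · simp)
  have : ¬ Function.Injective B := fun h => by simpa using Fintype.card_le_of_injective B h
  simp only [Function.Injective, not_forall] at this
  obtain ⟨i, j, h, hij⟩ := this
  exact ha.eq_zero B hij h

lemma append_val {α : Type*} {p q : ℕ} (a : Fin p → α) (b : Fin q → α) (i : Fin (p+q)) :
    Fin.append a b i = if h : (i:ℕ) < p then a ⟨i, h⟩ else b ⟨i - p, by omega⟩ := by
  refine Fin.addCases (fun j => ?_) (fun j => ?_) i
  · rw [Fin.append_left, dif_pos (by simp)]; rfl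
  · rw [Fin.append_right, dif_neg (by simp)]; congr 1; ext; simp

lemma sA_val {k : ℕ} (p : Fin (k+1)) (i : Fin k) : ((p.succAbove i : Fin (k+1)) : ℕ) = if (i:ℕ) < p then (i:ℕ) else i+1 := by
  simp only [Fin.succAbove, Fin.lt_def, Fin.val_castSucc]
  split_ifs <;> simp

lemma append_nat {α : Type*} {p s : ℕ} (A : Fin p → α) (idx : Fin (s+2) → α) (m : Fin (s+2)) (i : Fin (p+(s+1))) :
    Fin.append A idx (Fin.succAbove (n := p+(s+1)) (Fin.natAdd p m) i) = Fin.append A (fun i => idx (m.succAbove i)) i := by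
  rw [append_val, append_val]
  have hv : ((Fin.succAbove (n := p+(s+1)) (Fin.natAdd p m) i : Fin (p+(s+1)+1)) : ℕ) = if (i:ℕ) < p + m then (i:ℕ) else i+1 :=
    sA_val _ _
  by_cases h : (i:ℕ) < p
  · rw [dif_pos h, dif_pos (by rw [hv, if_pos (by omega)]; exact h)]
    congr 1; ext; simp only [hv]; rw [if_pos (by omega)]
  · rw [dif_neg h, dif_neg (by rw [hv]; split_ifs <;> omega)]
    congr 1; ext
    show ((Fin.succAbove (n := p+(s+1)) (Fin.natAdd p m) i : Fin (p+(s+1)+1)) : ℕ) - p = _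
    refine Eq.trans ?_ (sA_val m ⟨i - p, by omega⟩).symm
    rw [hv]
    show _ = if (i:ℕ) - p < m then (i:ℕ) - p else (i:ℕ) - p + 1
    by_cases h2 : (i:ℕ) < p + m
    · rw [if_pos h2, if_pos (by omega)]
    · rw [if_neg h2, if_neg (by omega)]; omega

lemma append_cast {α : Type*} {q s : ℕ} (A : Fin (q+1) → α) (idx : Fin (s+2) → α) (m : Fin (q+1)) (i : Fin (q+1+(s+1))) :
    Fin.append A idx (Fin.succAbove (n := q+1+(s+1)) (Fin.castAdd (s+2) m) i)
      = Fin.append (fun i => A (m.succAbove i)) idx (Fin.cast (by omega : q+1+(s+1) = q+(s+2)) i) := by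
  rw [append_val, append_val]
  have hv : ((Fin.succAbove (n := q+1+(s+1)) (Fin.castAdd (s+2) m) i : Fin (q+1+(s+1)+1)) : ℕ) = if (i:ℕ) < m then (i:ℕ) else i+1 :=
    sA_val _ _
  have hm := m.2
  have hc : ((Fin.cast (by omega : q+1+(s+1) = q+(s+2)) i : Fin (q+(s+2))) : ℕ) = i := rfl
  by_cases h : (i:ℕ) < q
  · have h1 : ((Fin.succAbove (n := q+1+(s+1)) (Fin.castAdd (s+2) m) i : Fin (q+1+(s+1)+1)) : ℕ) < q + 1 := by
      rw [hv]; split_ifs <;> omega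
    have h2 : ((Fin.cast (by omega : q+1+(s+1) = q+(s+2)) i : Fin (q+(s+2))) : ℕ) < q := h
    rw [dif_pos h1, dif_pos h2]
    congr 1; ext
    exact hv.trans (sA_val m ⟨i, h⟩).symm
  · have h1 : ¬ ((Fin.succAbove (n := q+1+(s+1)) (Fin.castAdd (s+2) m) i : Fin (q+1+(s+1)+1)) : ℕ) < q + 1 := by
      rw [hv]; split_ifs <;> omega
    have h2 : ¬ ((Fin.cast (by omega : q+1+(s+1) = q+(s+2)) i : Fin (q+(s+2))) : ℕ) < q := h
    rw [dif_neg h1, dif_neg h2]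
    congr 1; ext; simp only [hv, hc]
    rw [if_neg (by omega)]; omega

lemma codiff {q s : ℕ} (P : Fin (q+1+(s+1)) → (Fin (q+1) → Fin (q+1+(s+1))) → ℝ) (hP : ∀ b, AltF (P b))
    (idx : Fin (s+2) → Fin (q+1+(s+1))) :
    ∑ m : Fin (s+2), (-1:ℝ)^(m:ℕ) * ∑ A, P (idx m) A *
        ((permSign (fun i => Fin.append A (fun i => idx (m.succAbove i)) i) : ℤ) : ℝ)
    = (-1)^q * (q+1) * ∑ c : Fin q → Fin (q+1+(s+1)),
        ((permSign (fun i => Fin.append c idx (Fin.cast (by omega : q+1+(s+1) = q+(s+2)) i)) : ℤ) : ℝ) * ∑ b, P b (Fin.cons b c) := by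
  have h0 : ∑ A, ∑ b, P b A * altS (fun b' v => if b' = b then ((permSign v : ℤ) : ℝ) else 0) 
      (Fin.append (m := q+1) (n := s+2) A idx) = 0 := by
    simp only [schouten, mul_zero, Finset.sum_const_zero]
  have h1 : ∀ A b, altS (fun b' v => if b' = b then ((permSign v : ℤ) : ℝ) else 0) 
      (Fin.append (m := q+1) (n := s+2) A idx) = 
      ∑ k : Fin (q+1), (-1:ℝ)^(k:ℕ) * (if A k = b then 
        ((permSign (fun i => Fin.append (fun i => A (k.succAbove i)) idx (Fin.cast (by omega : q+1+(s+1) = q+(s+2)) i)) : ℤ) : ℝ) else 0)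
      + ∑ m : Fin (s+2), (-1:ℝ)^(q+1+(m:ℕ)) * (if idx m = b then 
        ((permSign (fun i => Fin.append A (fun i => idx (m.succAbove i)) i) : ℤ) : ℝ) else 0) := by
    intro A b
    refine (Fin.sum_univ_add (a := q+1) (b := s+2) _).trans ?_
    congr 1
    · refine Finset.sum_congr rfl fun k _ => ?_
      rw [Fin.append_left]
      simp only [append_cast]
      rfl
    · refine Finset.sum_congr rfl fun k _ => ?_
      rw [Fin.append_right]
      simp only [append_nat]
      rfl
  replace h0 := (Finset.sum_congr rfl fun A _ => Finset.sum_congr rfl fun b _ => congrArg (P b A * ·) (h1 A b)).symm.trans h0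
  simp only [mul_add, Finset.sum_add_distrib, Finset.mul_sum] at h0
  have t2 : ∑ A : Fin (q+1) → Fin (q+1+(s+1)), ∑ b, ∑ m : Fin (s+2), P b A * ((-1:ℝ)^(q+1+(m:ℕ)) * (if idx m = b then 
        ((permSign (fun i => Fin.append A (fun i => idx (m.succAbove i)) i) : ℤ) : ℝ) else 0))
      = (-1)^(q+1) * ∑ m : Fin (s+2), (-1:ℝ)^(m:ℕ) * ∑ A, P (idx m) A *
        ((permSign (fun i => Fin.append A (fun i => idx (m.succAbove i)) i) : ℤ) : ℝ) := by
    simp only [Finset.mul_sum]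
    rw [Finset.sum_comm (s := (Finset.univ : Finset (Fin (s+2))))]
    refine Finset.sum_congr rfl fun A _ => ?_
    rw [Finset.sum_comm]
    refine Finset.sum_congr rfl fun m _ => ?_
    rw [Finset.sum_eq_single (idx m) (by intro b _ hb; rw [if_neg hb.symm]; simp) (by simp), if_pos rfl]
    ring
  have t1 : ∑ A : Fin (q+1) → Fin (q+1+(s+1)), ∑ b, ∑ k : Fin (q+1), P b A * ((-1:ℝ)^(k:ℕ) * (if A k = b then 
        ((permSign (fun i => Fin.append (fun i => A (k.succAbove i)) idx (Fin.cast (by omega : q+1+(s+1) = q+(s+2)) i)) : ℤ) : ℝ) else 0))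
      = (q+1) * ∑ c : Fin q → Fin (q+1+(s+1)),
        ((permSign (fun i => Fin.append c idx (Fin.cast (by omega : q+1+(s+1) = q+(s+2)) i)) : ℤ) : ℝ) * ∑ b, P b (Fin.cons b c) := by
    have : ∀ k : Fin (q+1), ∑ A : Fin (q+1) → Fin (q+1+(s+1)), ∑ b, P b A * ((-1:ℝ)^(k:ℕ) * (if A k = b then 
        ((permSign (fun i => Fin.append (fun i => A (k.succAbove i)) idx (Fin.cast (by omega : q+1+(s+1) = q+(s+2)) i)) : ℤ) : ℝ) else 0))
       = ∑ c : Fin q → Fin (q+1+(s+1)),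
        ((permSign (fun i => Fin.append c idx (Fin.cast (by omega : q+1+(s+1) = q+(s+2)) i)) : ℤ) : ℝ) * ∑ b, P b (Fin.cons b c) := by
      intro k
      rw [← (Fin.insertNthEquiv (fun _ => Fin (q+1+(s+1))) k).sum_comp, Fintype.sum_prod_type, Finset.sum_comm]
      refine Finset.sum_congr rfl fun c _ => ?_
      rw [Finset.mul_sum]
      refine Finset.sum_congr rfl fun b _ => ?_
      simp only [Fin.insertNthEquiv_apply, Fin.insertNth_apply_same, Fin.insertNth_apply_succAbove]
      rw [Finset.sum_eq_single b (by intro b' _ hb; rw [if_neg hb.symm]; simp) (by simp), if_pos rfl]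
      show P b (Fin.insertNth k b c) * _ = _
      rw [(hP b).insertNth]
      have e : ((-1:ℝ)^(k:ℕ))*((-1:ℝ)^(k:ℕ)) = 1 := by rw [← mul_pow]; simp
      linear_combination (P b (Fin.cons b c) * ((permSign (fun i => Fin.append c idx (Fin.cast (by omega : q+1+(s+1) = q+(s+2)) i)) : ℤ) : ℝ)) * e
    have e2 : ∀ (X : (Fin (q+1) → Fin (q+1+(s+1))) → Fin (q+1+(s+1)) → Fin (q+1) → ℝ), ∑ A, ∑ b, ∑ k, X A b k = ∑ k, ∑ A, ∑ b, X A b k := by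
      intro X
      rw [Finset.sum_comm (s := (Finset.univ : Finset (Fin (q+1))))]
      refine Finset.sum_congr rfl fun A _ => ?_
      rw [Finset.sum_comm]
    rw [e2]
    simp only [this]
    simp
  have h0 := (congrArg₂ (fun a b : ℝ => a + b) t1 t2).symm.trans h0
  have e : ((-1:ℝ)^q)*((-1:ℝ)^q) = 1 := by rw [← mul_pow]; simp
  rw [pow_succ] at h0
  set X := ∑ m : Fin (s+2), (-1:ℝ)^(m:ℕ) * ∑ A, P (idx m) A *
        ((permSign (fun i => Fin.append A (fun i => idx (m.succAbove i)) i) : ℤ) : ℝ)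
  linear_combination (-(-1)^q) * h0 - X * e
end Alt2

section Alt3
variable {n k q s : ℕ}

lemma codiff' (hn : q+1+(s+1) = n) (P : Fin n → (Fin (q+1) → Fin n) → ℝ) (hP : ∀ b, AltF (P b))
    (idx : Fin (s+2) → Fin n) :
    ∑ m : Fin (s+2), (-1:ℝ)^(m:ℕ) * ∑ A, P (idx m) A *
        ((permSign (fun i => Fin.append A (fun i => idx (m.succAbove i)) (Fin.cast hn.symm i)) : ℤ) : ℝ)
    = (-1)^q * (q+1) * ∑ c : Fin q → Fin n,
        ((permSign (fun i => Fin.append c idx (Fin.cast (by omega : n = q+(s+2)) i)) : ℤ) : ℝ) * ∑ b, P b (Fin.cons b c) := by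
  subst hn
  exact codiff P hP idx

lemma J_alt (P : Fin n → (Fin (q+1) → Fin n) → ℝ) (hP : ∀ b, AltF (P b)) :
    AltF (fun c => ∑ b, P b (Fin.cons b c)) := by
  intro c σ
  dsimp only
  rw [Finset.mul_sum]
  refine Finset.sum_congr rfl fun b _ => ?_
  have := hP b (Fin.cons b c) (Equiv.Perm.decomposeFin.symm (0, σ))
  rw [Equiv.Perm.decomposeFin.symm_sign] at this
  simp only [if_true, one_mul] at this
  rw [← this]
  congr 1
  funext i
  refine Fin.cases ?_ (fun j => ?_) i
  · simp
  · simp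

lemma eps_inj {J : (Fin q → Fin n) → ℝ} (hJ : AltF J) (h : n = q + (s+2))
    (h0 : ∀ idx : Fin (s+2) → Fin n, ∑ c : Fin q → Fin n,
      ((permSign (fun i => Fin.append c idx (Fin.cast h i)) : ℤ) : ℝ) * J c = 0) (c : Fin q → Fin n) : J c = 0 := by
  by_cases hc : Function.Injective c
  swap
  · rw [Function.Injective] at hc
    push Not at hc
    obtain ⟨i, j, e, ne⟩ := hc
    exact hJ.eq_zero c ne e
  have hcard : (Finset.univ \ Finset.univ.image c).card = s+2 := by
    rw [Finset.card_sdiff_of_subset (Finset.subset_univ _), Finset.card_image_of_injective _ hc]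
    simp; omega
  let idx : Fin (s+2) → Fin n := (Finset.univ \ Finset.univ.image c).orderEmbOfFin hcard
  have hii : Function.Injective idx := ((Finset.univ \ Finset.univ.image c).orderEmbOfFin hcard).injective
  have hid : ∀ j i, idx j ≠ c i := by
    intro j i e
    have := (Finset.univ \ Finset.univ.image c).orderEmbOfFin_mem hcard j
    simp only [Finset.mem_sdiff, Finset.mem_image, Finset.mem_univ, true_and, not_exists] at this
    exact this i e.symm
  have hrange : ∀ a, (∃ i, c i = a) ∨ ∃ j, idx j = a := by
    intro a
    by_cases ha : a ∈ Finset.univ.image c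
    · left; simpa using ha
    · right
      have : a ∈ Set.range ((Finset.univ \ Finset.univ.image c).orderEmbOfFin hcard) := by
        rw [Finset.range_orderEmbOfFin]; simpa using ha
      exact this
  set e : (Fin q → Fin n) → ℝ := fun c' => ((permSign (fun i => Fin.append c' idx (Fin.cast h i)) : ℤ) : ℝ) with he
  have hperm : ∀ (c' : Fin q → Fin n) (σ : Equiv.Perm (Fin q)), e (c' ∘ σ) = ((Equiv.Perm.sign σ : ℤ) : ℝ) * e c' := by
    intro c' σ
    subst h
    have := permSign_alt (fun i => Fin.append c' idx (Fin.cast rfl i)) (finSumFinEquiv.permCongr (Equiv.Perm.sumCongr σ 1))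
    rw [Equiv.Perm.sign_permCongr, Equiv.Perm.sign_sumCongr, Equiv.Perm.sign_one, mul_one] at this
    rw [he]
    dsimp only at this ⊢
    rw [← this]
    congr 3
    funext i
    refine Fin.addCases (fun j => ?_) (fun j => ?_) i
    · simp [Equiv.permCongr_apply]
    · simp [Equiv.permCongr_apply]
  have hne : e c ≠ 0 := by
    refine permSign_ne ?_
    intro i j hij
    have : Function.Injective (Fin.append c idx) := by
      rw [Fin.append_injective_iff]
      exact ⟨hc, hii, fun i j => (hid j i).symm⟩
    exact Fin.cast_injective _ (this hij)
  have hterm : ∀ c', ∃ t : ℝ, 0 ≤ t ∧ e c' * J c' = t * (e c * J c) := by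
    intro c'
    by_cases hi : Function.Injective (fun i => Fin.append c' idx (Fin.cast h i))
    swap
    · exact ⟨0, le_rfl, by rw [he]; dsimp only; rw [permSign_zero hi]; simp⟩
    have hi' : Function.Injective (Fin.append c' idx) := by
      intro i j hij
      have := @hi (Fin.cast h.symm i) (Fin.cast h.symm j) (by simpa using hij)
      exact Fin.cast_injective _ this
    rw [Fin.append_injective_iff] at hi'
    have : ∀ i, ∃ j, c j = c' i := by
      intro i
      rcases hrange (c' i) with h | ⟨j, hj⟩
      · exact h
      · exact absurd hj.symm (hi'.2.2 i j)
    choose σ hσ using this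
    have hσi : Function.Injective σ := by
      intro i j hij
      apply hi'.1
      rw [← hσ, ← hσ, hij]
    let τ : Equiv.Perm (Fin q) := Equiv.ofBijective σ (Finite.injective_iff_bijective.1 hσi)
    have hc' : c' = c ∘ τ := funext fun i => (hσ i).symm
    refine ⟨1, zero_le_one, ?_⟩
    rw [hc', hperm, hJ]
    have : (((Equiv.Perm.sign τ : ℤ) : ℝ)) * ((Equiv.Perm.sign τ : ℤ) : ℝ) = 1 := by
      rcases Int.units_eq_one_or (Equiv.Perm.sign τ) with h | h <;> simp [h]
    linear_combination (e c * J c) * this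
  choose t ht0 ht using hterm
  have hs := h0 idx
  change ∑ c', e c' * J c' = 0 at hs
  rw [Finset.sum_congr rfl (fun c' _ => ht c')] at hs
  rw [← Finset.sum_mul] at hs
  rcases mul_eq_zero.1 hs with h1 | h1
  · rw [Finset.sum_eq_zero_iff_of_nonneg (fun i _ => ht0 i)] at h1
    have := ht c
    rw [h1 c (Finset.mem_univ _), zero_mul] at this
    exact (mul_eq_zero.1 this).resolve_left hne
  · exact (mul_eq_zero.1 h1).resolve_left hne
end Alt3

section Max1
variable {m q : ℕ} {f : TensorField (m+2) q}

lemma pd_cmul {n : ℕ} (c : ℝ) (g : Pt n → ℝ) (a : Fin n) (x : Pt n) : pd (fun y => c * g y) a x = c * pd g a x := by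
  unfold pd
  have := fderiv_const_smul_field (𝕜 := ℝ) (f := g) c
  have h2 : (fun y => c * g y) = c • g := rfl
  rw [h2, this]; rfl

lemma pd_zero {n : ℕ} (g : Pt n → ℝ) (h : ∀ y, g y = 0) (a : Fin n) (x : Pt n) : pd g a x = 0 := by
  have : g = fun _ => 0 := funext h
  subst this
  simp [pd]

lemma pd_indep (g : Pt (m+2) → ℝ) (hg : ContDiff ℝ (⊤ : ℕ∞) g) (hi : IndepOfR g) (x : Pt (m+2)) : pd g 1 x = 0 := by
  have := indep_pd (n := m+2) one_val ⟨g, mem_Sm hg⟩ hi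
  have h2 := congrArg (ev x) this
  simpa [ev_pdD] using h2

lemma duW_eq {n : ℕ} (f : TensorField n q) (x : Pt n) : duWedge f x = altS (fun b v => (if (b:ℕ) = 0 then 1 else 0) * f x v) := by
  funext idx
  simp only [duWedge, altS, mul_assoc]

lemma duW_alt {n : ℕ} {f : TensorField n q} (hf : IsAlternating f) (x : Pt n) : AltF (duWedge f x) := by
  rw [duW_eq]
  refine altS_alt _ fun b v σ => ?_
  rw [hf x v σ]; ring

lemma duW_no0 {n : ℕ} {f : TensorField n q} (x : Pt n) (idx) (h : ∀ i, (idx i : ℕ) ≠ 0) : duWedge f x idx = 0 := by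
  unfold duWedge
  refine Finset.sum_eq_zero fun k _ => ?_
  rw [if_neg (h k)]; ring

def Trv {n q : ℕ} (f : TensorField n q) : Prop := ∀ (x : Pt n) (v : Fin q → Fin n), (∃ i, (v i : ℕ) < 2) → f x v = 0

lemma duW_one {n : ℕ} {f : TensorField n q} (ht : Trv f) (x : Pt n) (idx) (i) (h : (idx i : ℕ) = 1) : duWedge f x idx = 0 := by
  unfold duWedge
  refine Finset.sum_eq_zero fun k _ => ?_
  by_cases hk : (idx k : ℕ) = 0
  · have hki : i ≠ k := by rintro rfl; omega
    obtain ⟨j, rfl⟩ := Fin.exists_succAbove_eq hki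
    rw [ht x _ ⟨j, by omega⟩]; ring
  · rw [if_neg hk]; ring

lemma duW_cons [NeZero q] (ht : Trv f) (x : Pt (m+2)) (v) : duWedge f x (Fin.cons 0 v) = f x v := by
  unfold duWedge
  rw [Fin.sum_univ_succ, Finset.sum_eq_zero]
  · simp
  · intro k _
    rw [ht x _ ⟨0, ?_⟩]
    · ring
    · obtain ⟨q', rfl⟩ := Nat.exists_eq_succ_of_ne_zero (NeZero.ne q)
      rw [Fin.succ_succAbove_zero]; simp

lemma extD_alt {n k : ℕ} {F : TensorField n k} (hF : ∀ x, AltF (F x)) (x : Pt n) : AltF (extD F x) := by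
  have : extD F x = altS (fun b v => pd (fun y => F y v) b x) := rfl
  rw [this]
  refine altS_alt _ fun b v σ => ?_
  rw [← pd_cmul]
  congr 1
  funext y
  exact hF y v σ

lemma extD_cons [NeZero q] (ht : Trv f) (x : Pt (m+2)) (c : Fin (q+1) → Fin (m+2)) (hc : ∀ i, (c i : ℕ) ≠ 0) :
    extD (duWedge f) x (Fin.cons 0 c) = -∑ k : Fin (q+1), (-1 : ℝ) ^ (k : ℕ) *
      pd (fun y => f y fun i => c (k.succAbove i)) (c k) x := by
  unfold extD
  rw [Fin.sum_univ_succ]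
  have h1 : ∀ y, duWedge f y (fun i => (Fin.cons 0 c : Fin (q+2) → Fin (m+2)) (Fin.succAbove 0 i)) = 0 := by
    intro y
    refine duW_no0 y _ fun i => ?_
    simpa using hc i
  rw [pd_zero _ h1, mul_zero, zero_add, ← Finset.sum_neg_distrib]
  refine Finset.sum_congr rfl fun k _ => ?_
  have : ∀ y, duWedge f y (fun i => (Fin.cons 0 c : Fin (q+2) → Fin (m+2)) (Fin.succAbove k.succ i)) = f y fun i => c (k.succAbove i) := by
    intro y
    rw [← duW_cons ht]
    congr 1
    funext i
    refine Fin.cases ?_ (fun j => ?_) i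
    · simp [Fin.succ_succAbove_zero]
    · simp [Fin.succ_succAbove_succ]
  rw [Fin.cons_succ, funext this, Fin.val_succ, pow_succ]; ring

lemma ins_rem {α : Type*} {k : ℕ} (v : Fin (k+1) → α) (i : Fin (k+1)) : v = i.insertNth (v i) (fun j => v (i.succAbove j)) := by
  exact (Fin.insertNth_self_removeNth i v).symm

lemma closed_iff [NeZero q] (hs : IsSmoothT f) (ha : IsAlternating f) (ht : Trv f) (hr : IndepOfR f) :
    (∀ x idx, extD (duWedge f) x idx = 0) ↔ TransClosed f := by
  constructor
  · intro h x v hv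
    have := h x (Fin.cons 0 v)
    rw [extD_cons ht x v (fun i => by have := hv i; omega)] at this
    linarith
  · intro h x idx
    have hA := extD_alt (F := duWedge f) (fun y => duW_alt ha y) x
    by_cases hi : Function.Injective idx
    swap
    · rw [Function.Injective] at hi
      push Not at hi
      obtain ⟨i, j, e, ne⟩ := hi
      exact hA.eq_zero idx ne e
    by_cases h0 : ∃ i, (idx i : ℕ) = 0
    swap
    · push Not at h0
      unfold extD
      refine Finset.sum_eq_zero fun k _ => ?_
      rw [pd_zero _ (fun y => duW_no0 y _ fun i => h0 _), mul_zero]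
    obtain ⟨i, h0⟩ := h0
    have e0 : idx i = 0 := Fin.ext h0
    set c : Fin (q+1) → Fin (m+2) := fun j => idx (i.succAbove j) with hc
    have hc0 : ∀ j, (c j : ℕ) ≠ 0 := by
      intro j hj
      have : idx (i.succAbove j) = idx i := Fin.ext (hj.trans h0.symm)
      exact Fin.succAbove_ne i j (hi this)
    rw [ins_rem idx i, e0, hA.insertNth, extD_cons ht x c hc0]
    suffices hh : ∑ k : Fin (q+1), (-1 : ℝ) ^ (k : ℕ) *
      pd (fun y => f y fun i => c (k.succAbove i)) (c k) x = 0 by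
      rw [hh]; simp
    by_cases h1 : ∃ j, (c j : ℕ) = 1
    · obtain ⟨j, hj⟩ := h1
      refine Finset.sum_eq_zero fun k _ => ?_
      by_cases hk : j = k
      · subst hk
        have : c j = 1 := Fin.ext (by rw [hj, one_val])
        rw [this, pd_indep _ (hs _) (fun x y hxy => by rw [hr x y hxy]), mul_zero]
      · obtain ⟨l, rfl⟩ := Fin.exists_succAbove_eq hk
        rw [pd_zero _ (fun y => ht y _ ⟨l, by omega⟩), mul_zero]
    · push Not at h1
      exact h x c fun j => by have := hc0 j; have := h1 j; omega
end Max1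

section Max2
variable {m q : ℕ} {f : TensorField (m+2) q} {D : DegKundtData (m+2)}

structure GH (gi hi : Matrix (Fin (m+2)) (Fin (m+2)) ℝ) : Prop where
  a0 : ∀ a : Fin (m+2), (a:ℕ) ≠ 1 → gi a 0 = 0
  o0 : gi 1 0 = 1
  zb : ∀ b : Fin (m+2), (b:ℕ) ≠ 1 → gi 0 b = 0
  tt : ∀ a b : Fin (m+2), 2 ≤ (a:ℕ) → 2 ≤ (b:ℕ) → gi a b = hi a b
  ht : ∀ a b : Fin (m+2), (a:ℕ) < 2 → 2 ≤ (b:ℕ) → hi a b = 0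

lemma gh (hD : D.Regular) (x : Pt (m+2)) : GH (D.metric x)⁻¹ (D.hT x)⁻¹ := by
  constructor
  · simp only [metrici_ev hD, kGi]
    refine Fin.cases (fun _ => ?_) (fun a => Fin.cases (fun h => ?_) (fun a _ => ?_) a)
    · simp
    · simp at h
    · simp
  · simp [metrici_ev hD, kGi]
  · simp only [metrici_ev hD, kGi]
    refine Fin.cases (fun _ => ?_) (fun a => Fin.cases (fun h => ?_) (fun a _ => ?_) a)
    · simp
    · simp at h
    · simp
  · simp only [metrici_ev hD, hTi_ev hD, kGi]
    refine Fin.cases (fun _ => ?_) (fun a => Fin.cases (fun h => ?_) (fun a => ?_) a)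
    · simp
    · simp
    refine Fin.cases (fun _ => ?_) (fun a => Fin.cases (fun h => ?_) (fun a => ?_) a)
    · simp
    · simp
    · simp
  · simp only [hTi_ev hD]
    refine Fin.cases ?_ (fun a => Fin.cases ?_ (fun a => ?_) a)
    · refine Fin.cases (fun _ => ?_) (fun a => Fin.cases (fun h => ?_) (fun a => ?_) a) <;> simp
    · refine Fin.cases (fun _ => ?_) (fun a => Fin.cases (fun h => ?_) (fun a => ?_) a) <;> simp
    · intro b h; simp at h

lemma v0 {a : Fin (m+2)} (h : (a:ℕ) = 0) : a = 0 := Fin.ext h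
lemma v1 {a : Fin (m+2)} (h : (a:ℕ) = 1) : a = 1 := Fin.ext (h.trans one_val.symm)

/-- transverse raise vanishes on non-transverse indices -/
lemma raiseT_zero {g : MetricField (m+2)} {x : Pt (m+2)} {gi} (H : GH gi (g x)⁻¹) (ht : Trv f) (v : Fin q → Fin (m+2)) (i) (hv : (v i : ℕ) < 2) :
    raiseAll g f x v = 0 := by
  unfold raiseAll
  refine Finset.sum_eq_zero fun w _ => ?_
  by_cases hw : (w i : ℕ) < 2
  · rw [ht x w ⟨i, hw⟩, mul_zero]
  · rw [Finset.prod_eq_zero (Finset.mem_univ i) (H.ht _ _ hv (by omega)), zero_mul]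

lemma raise_alt {n k : ℕ} {g : MetricField n} {F : TensorField n k} (hF : ∀ x, AltF (F x)) (x : Pt n) : AltF (raiseAll g F x) := by
  intro v σ
  unfold raiseAll
  rw [Finset.mul_sum, ← (Equiv.arrowCongr σ.symm (Equiv.refl (Fin n))).sum_comp]
  refine Finset.sum_congr rfl fun w _ => ?_
  have e1 : (Equiv.arrowCongr σ.symm (Equiv.refl (Fin n))) w = w ∘ σ := by
    funext i; simp [Equiv.arrowCongr]
  rw [e1, hF x w σ]
  have : ∏ i, (g x)⁻¹ ((v ∘ σ) i) ((w ∘ σ) i) = ∏ i, (g x)⁻¹ (v i) (w i) :=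
    Equiv.prod_comp σ (fun i => (g x)⁻¹ (v i) (w i))
  rw [this]; ring

/-- full raise of du ∧ f with no index 1 vanishes -/
lemma raise_no1 {g : MetricField (m+2)} {x : Pt (m+2)} {hi} (H : GH (g x)⁻¹ hi) (v : Fin (q+1) → Fin (m+2)) (hv : ∀ i, (v i : ℕ) ≠ 1) :
    raiseAll g (duWedge f) x v = 0 := by
  unfold raiseAll
  refine Finset.sum_eq_zero fun w _ => ?_
  by_cases hw : ∃ i, (w i : ℕ) = 0
  · obtain ⟨i, hw⟩ := hw
    rw [Finset.prod_eq_zero (Finset.mem_univ i) (by rw [v0 hw]; exact H.a0 _ (hv i)), zero_mul]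
  · push Not at hw
    rw [duW_no0 x w hw, mul_zero]

lemma raise_has0 {g : MetricField (m+2)} {x : Pt (m+2)} {hi} (H : GH (g x)⁻¹ hi) (ht : Trv f) (v : Fin (q+1) → Fin (m+2)) (i) (hv : (v i : ℕ) = 0) :
    raiseAll g (duWedge f) x v = 0 := by
  unfold raiseAll
  refine Finset.sum_eq_zero fun w _ => ?_
  by_cases hw : (w i : ℕ) = 1
  · rw [duW_one ht x w i hw, mul_zero]
  · rw [Finset.prod_eq_zero (Finset.mem_univ i) (by rw [v0 hv]; exact H.zb _ hw), zero_mul]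

/-- sum over w of ∏ gi f for transverse or arbitrary v without 1 -/
lemma raise_f {g : MetricField (m+2)} {hT : MetricField (m+2)} {x : Pt (m+2)} (H : GH (g x)⁻¹ (hT x)⁻¹) (ht : Trv f)
    (v : Fin q → Fin (m+2)) (hv : ∀ i, 2 ≤ (v i : ℕ)) :
    ∑ w, (∏ i, (g x)⁻¹ (v i) (w i)) * f x w = raiseAll hT f x v := by
  unfold raiseAll
  refine Finset.sum_congr rfl fun w _ => ?_
  by_cases hw : ∃ i, (w i : ℕ) < 2
  · rw [ht x w hw, mul_zero, mul_zero]
  · push Not at hw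
    congr 1
    exact Finset.prod_congr rfl fun i _ => H.tt _ _ (hv i) (hw i)

lemma raise_cons1 [NeZero q] {g : MetricField (m+2)} {hT : MetricField (m+2)} {x : Pt (m+2)} (H : GH (g x)⁻¹ (hT x)⁻¹) (ha : IsAlternating f) (ht : Trv f)
    (v : Fin q → Fin (m+2)) : raiseAll g (duWedge f) x (Fin.cons 1 v) = raiseAll hT f x v := by
  by_cases h1 : ∃ i, (v i : ℕ) = 1
  · obtain ⟨i, hi⟩ := h1
    rw [raiseT_zero H ht v i (by omega)]
    refine (raise_alt (fun y => duW_alt ha y) x).eq_zero _ (i := 0) (j := i.succ) (Fin.succ_ne_zero _).symm ?_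
    simp [v1 hi]
  by_cases h0 : ∃ i, (v i : ℕ) = 0
  · obtain ⟨i, hi⟩ := h0
    rw [raiseT_zero H ht v i (by omega), raise_has0 H ht _ i.succ (by simpa using hi)]
  push Not at h0 h1
  rw [← raise_f H ht v (fun i => by have := h0 i; have := h1 i; omega)]
  unfold raiseAll
  rw [← (Fin.consEquiv (fun _ => Fin (m+2))).sum_comp, Fintype.sum_prod_type, Finset.sum_eq_single 0]
  · refine Finset.sum_congr rfl fun w _ => ?_
    have : (Fin.consEquiv (fun _ => Fin (m+2))) (0, w) = (Fin.cons 0 w : Fin (q+1) → Fin (m+2)) := rfl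
    rw [this, duW_cons ht, Fin.prod_univ_succ]
    simp [H.o0]
  · intro b _ hb
    refine Finset.sum_eq_zero fun w _ => ?_
    have : (Fin.consEquiv (fun _ => Fin (m+2))) (b, w) = (Fin.cons b w : Fin (q+1) → Fin (m+2)) := rfl
    rw [this]
    by_cases hw : ∃ i, (w i : ℕ) = 0
    · obtain ⟨i, hw⟩ := hw
      rw [Finset.prod_eq_zero (Finset.mem_univ i.succ) (by simp only [Fin.cons_succ]; rw [v0 hw]; exact H.a0 _ (h1 i)), zero_mul]
    · push Not at hw
      rw [duW_no0 x _ (Fin.cases (by simpa using fun h => hb (v0 h)) (by simpa using hw)), mul_zero]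
  · simp
end Max2
section Det
variable {m : ℕ} {A : Type*} [CommRing A] [Algebra ℝ A]

lemma det_hP (h : Matrix (Fin m) (Fin m) A) : (hP h).det = h.det := by
  rw [Matrix.det_succ_row_zero, Fin.sum_univ_succ, Finset.sum_eq_zero, Matrix.det_succ_row_zero, Fin.sum_univ_succ, Finset.sum_eq_zero]
  · simp
    congr 1
  · intro j _
    simp
  · refine fun j _ => Fin.cases ?_ (fun j => ?_) j <;> simp

lemma det_kG (H : A) (W : Fin m → A) (h : Matrix (Fin m) (Fin m) A) : (kG H W h).det = - h.det := by
  have := Matrix.det_permute (Equiv.swap 0 1) (kG H W h)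
  rw [Equiv.Perm.sign_swap (by simp)] at this
  have e : ((kG H W h).submatrix (Equiv.swap 0 1) id).det = h.det := by
    rw [Matrix.det_succ_row_zero, Fin.sum_univ_succ, Finset.sum_eq_zero, Matrix.det_succ_column_zero, Fin.sum_univ_succ, Finset.sum_eq_zero]
    · simp [kG]
      congr 1
    · intro j _
      have : Equiv.swap (0 : Fin (m+2)) 1 j.succ.succ = j.succ.succ := Equiv.swap_apply_of_ne_of_ne (by simp) (by simp [Fin.ext_iff])
      simp [kG, this]
    · refine fun j _ => Fin.cases ?_ (fun j => ?_) j <;> simp [kG]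
  rw [e] at this
  rw [this]; simp
end Det

section Max3
variable {m q s : ℕ} {f : TensorField (m+2) q} {D : DegKundtData (m+2)}

lemma det_metric (hD : D.Regular) (x : Pt (m+2)) : (D.metric x).det = -(D.hT x).det := by
  have h1 : D.metric x = fun a b => ev x (kG (cF hD) (cW hD) (cH hD) a b) := by funext a b; exact metric_ev hD x a b
  have h2 := congrArg Matrix.det h1
  rw [h2, ← ev_det, det_kG, det_ev hD, cDet, det_hP, map_neg]

lemma sqrt_metric (hD : D.Regular) (x : Pt (m+2)) : Real.sqrt |(D.metric x).det| = Real.sqrt (D.hT x).det := by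
  rw [det_metric hD, abs_neg, abs_of_pos (det_pos hD x)]

lemma sm_ev {n : ℕ} {g : Pt n → ℝ} (F : Sm n) (h : ∀ y, g y = ev y F) : ContDiff ℝ (⊤ : ℕ∞) g := by
  have : g = F.1 := funext h
  rw [this]; exact smCd F

lemma sm_sqrt (hD : D.Regular) : ContDiff ℝ (⊤ : ℕ∞) (fun y => Real.sqrt (D.hT y).det) := by
  have : ContDiff ℝ (⊤ : ℕ∞) (fun y => (D.hT y).det) := sm_ev _ (det_ev hD)
  exact this.sqrt fun x => (det_pos hD x).ne'

lemma sm_duW {n : ℕ} {f : TensorField n q} (hs : IsSmoothT f) : IsSmoothT (duWedge f) := by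
  intro idx
  unfold duWedge
  exact ContDiff.sum fun k _ => contDiff_const.mul (hs _)

lemma sm_raise {n k : ℕ} {g : MetricField n} {F : TensorField n k} (hg : ∀ a b, ContDiff ℝ (⊤ : ℕ∞) fun y => (g y)⁻¹ a b) (hF : IsSmoothT F) :
    IsSmoothT (raiseAll g F) := by
  intro idx
  unfold raiseAll
  exact ContDiff.sum fun k _ => (contDiff_prod fun i _ => hg _ _).mul (hF _)

lemma sm_metrici (hD : D.Regular) (a b) : ContDiff ℝ (⊤ : ℕ∞) fun y => (D.metric y)⁻¹ a b := sm_ev _ (fun y => metrici_ev hD y a b)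
lemma sm_hTi (hD : D.Regular) (a b) : ContDiff ℝ (⊤ : ℕ∞) fun y => (D.hT y)⁻¹ a b := sm_ev _ (fun y => hTi_ev hD y a b)

lemma sm_pd {n : ℕ} {ι : Type*} (S : Finset ι) (G : ι → Pt n → ℝ) (e : ι → ℝ) (hG : ∀ i, ContDiff ℝ (⊤ : ℕ∞) (G i)) (a : Fin n) (x : Pt n) :
    pd (fun y => ∑ i ∈ S, G i y * e i) a x = ∑ i ∈ S, pd (G i) a x * e i := by
  have := pd_ev (f := fun y => ∑ i ∈ S, G i y * e i) (∑ i ∈ S, e i • (⟨G i, mem_Sm (hG i)⟩ : Sm n)) (by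
    intro y
    rw [map_sum]
    refine Finset.sum_congr rfl fun i _ => ?_
    rw [map_smul, ev_apply, smul_eq_mul, mul_comm]) a x
  rw [this, map_sum, map_sum]
  refine Finset.sum_congr rfl fun i _ => ?_
  rw [Derivation.map_smul, map_smul, ev_pdD, smul_eq_mul, mul_comm]

/-- Hodge coclosedness as divergence. -/
lemma hodge_iff (hn : (q+1)+(s+1) = m+2) (hD : D.Regular) (hs : IsSmoothT f) (ha : IsAlternating f) :
    (∀ x idx, extD (hodge hn D.metric (duWedge f)) x idx = 0) ↔
    ∀ x c, ∑ b, pd (fun y => Real.sqrt (D.hT y).det * raiseAll D.metric (duWedge f) y (Fin.cons b c)) b x = 0 := by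
  have hsm : ∀ A, ContDiff ℝ (⊤ : ℕ∞) (fun y => Real.sqrt (D.hT y).det * raiseAll D.metric (duWedge f) y A) :=
    fun A => (sm_sqrt hD).mul (sm_raise (sm_metrici hD) (sm_duW hs) A)
  let P : Pt (m+2) → Fin (m+2) → (Fin (q+1) → Fin (m+2)) → ℝ := fun x b A =>
    pd (fun y => Real.sqrt (D.hT y).det * raiseAll D.metric (duWedge f) y A) b x
  have hP : ∀ x b, AltF (P x b) := by
    intro x b v σ
    show pd _ _ _ = _ * pd _ _ _
    rw [← pd_cmul]
    congr 1
    funext y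
    rw [raise_alt (fun y => duW_alt ha y) y v σ]; ring
  have key : ∀ x idx, extD (hodge hn D.metric (duWedge f)) x idx = (1 / (Nat.factorial (q+1) : ℝ)) * ((-1)^q * (q+1) * ∑ c : Fin q → Fin (m+2),
        ((permSign (fun i => Fin.append c idx (Fin.cast (by omega : m+2 = q+(s+2)) i)) : ℤ) : ℝ) * ∑ b, P x b (Fin.cons b c)) := by
    intro x idx
    rw [← codiff' hn (P x) (hP x) idx, Finset.mul_sum]
    unfold extD
    refine Finset.sum_congr rfl fun k _ => ?_
    unfold hodge
    rw [pd_cmul]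
    have := sm_pd Finset.univ (fun A y => Real.sqrt (D.hT y).det * raiseAll D.metric (duWedge f) y A)
      (fun A => ((permSign (fun i => Fin.append A (fun i => idx (k.succAbove i)) (Fin.cast hn.symm i)) : ℤ) : ℝ)) hsm (idx k) x
    simp only [P]
    rw [← this]
    rw [mul_left_comm]
    congr 4
    funext y
    refine Finset.sum_congr rfl fun A _ => ?_
    rw [sqrt_metric hD]; ring
  constructor
  · intro h x
    refine eps_inj (s := s) (J_alt (P x) (hP x)) (by omega) fun idx => ?_
    have h1 := h x idx
    rw [key] at h1
    have n1 : (1 / (Nat.factorial (q+1) : ℝ)) ≠ 0 := by positivity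
    have n2 : ((-1:ℝ)^q * (q+1)) ≠ 0 := mul_ne_zero (by simp) (by positivity)
    exact (mul_eq_zero.1 ((mul_eq_zero.1 h1).resolve_left n1)).resolve_left n2
  · intro h x idx
    rw [key]
    have : ∀ c, ∑ b, P x b (Fin.cons b c) = 0 := h x
    simp [this]

lemma indep_w (hD : D.Regular) (hr : IndepOfR f) (v) :
    IndepOfR (fun y => Real.sqrt (D.hT y).det * raiseAll D.hT f y v) := by
  intro x y h
  simp only [raiseAll]
  rw [hD.1.2.2.2.1 x y h, hr x y h]

lemma coclosed_iff [NeZero q] (hn : (q+1)+(s+1) = m+2) (hD : D.Regular) (hs : IsSmoothT f) (ha : IsAlternating f) (ht : Trv f) (hr : IndepOfR f) :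
    (∀ x idx, extD (hodge hn D.metric (duWedge f)) x idx = 0) ↔ TransCoclosed D.hT f := by
  rw [hodge_iff hn hD hs ha]
  obtain ⟨q', rfl⟩ := Nat.exists_eq_succ_of_ne_zero (NeZero.ne q)
  have hA : ∀ y, AltF (raiseAll D.metric (duWedge f) y) := fun y => raise_alt (fun y => duW_alt ha y) y
  have key : ∀ x (d : Fin q' → Fin (m+2)),
      ∑ b, pd (fun y => Real.sqrt (D.hT y).det * raiseAll D.metric (duWedge f) y (Fin.cons b (Fin.cons 1 d))) b x
      = -∑ b, pd (fun y => Real.sqrt (D.hT y).det * raiseAll D.hT f y (Fin.cons b d)) b x := by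
    intro x d
    rw [← Finset.sum_neg_distrib]
    refine Finset.sum_congr rfl fun b _ => ?_
    rw [neg_eq_neg_one_mul, ← pd_cmul]
    congr 1
    funext y
    rw [← raise_cons1 (gh hD y) ha ht]
    have := hA y (Fin.cons 1 (Fin.cons b d)) (Equiv.swap 0 1)
    rw [Equiv.Perm.sign_swap (by simp)] at this
    have e : (Fin.cons 1 (Fin.cons b d) : Fin (q'+2) → Fin (m+2)) ∘ (Equiv.swap 0 1) = Fin.cons b (Fin.cons 1 d) := by
      funext i
      refine Fin.cases ?_ (fun j => Fin.cases ?_ (fun j => ?_) j) i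
      · simp
      · simp
      · have : Equiv.swap (0 : Fin (q'+2)) 1 j.succ.succ = j.succ.succ := Equiv.swap_apply_of_ne_of_ne (by simp) (by simp [Fin.ext_iff])
        simp [this]
    rw [e] at this
    rw [this]
    simp
  constructor
  · intro h x v
    have h1 := h x (Fin.cons 1 (Fin.tail v))
    rw [key] at h1
    have e : ∀ b, Function.update v 0 b = Fin.cons b (Fin.tail v) := by
      intro b
      conv_lhs => rw [← Fin.cons_self_tail v]
      exact Fin.update_cons_zero _ _ _
    simp only [e]
    linarith
  · intro h x c
    by_cases h1 : ∃ i, (c i : ℕ) = 1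
    · obtain ⟨i, hi⟩ := h1
      have hJ := J_alt (fun b A => pd (fun y => Real.sqrt (D.hT y).det * raiseAll D.metric (duWedge f) y A) b x) (by
        intro b v σ
        show pd _ _ _ = _ * pd _ _ _
        rw [← pd_cmul]
        congr 1
        funext y
        rw [hA y v σ]; ring)
      have h2 := hJ.insertNth i 1 (fun j => c (i.succAbove j))
      rw [← v1 hi, ← ins_rem c i] at h2
      rw [h2, v1 hi, key]
      have h3 := h x (Fin.cons 0 (fun j => c (i.succAbove j)))
      have e : ∀ b, Function.update (Fin.cons 0 (fun j => c (i.succAbove j)) : Fin (q'+1) → Fin (m+2)) 0 b = Fin.cons b (fun j => c (i.succAbove j)) := fun b => Fin.update_cons_zero _ _ _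
      simp only [e] at h3
      rw [h3]; simp
    · push Not at h1
      rw [Finset.sum_eq_single 1]
      · simp only [raise_cons1 (gh hD _) ha ht]
        exact pd_indep _ ((sm_sqrt hD).mul (sm_raise (sm_hTi hD) hs c)) (indep_w hD hr c) x
      · intro b _ hb
        refine pd_zero _ (fun y => ?_) _ _
        rw [raise_no1 (gh hD y) _ (Fin.cases (by simpa using fun h => hb (v1 h)) (by simpa using h1)), mul_zero]
      · simp
end Max3

section Ein
variable {m q s : ℕ} {f : TensorField (m+2) q} {D : DegKundtData (m+2)}

lemma emT [NeZero q] {g hT : MetricField (m+2)} {x : Pt (m+2)} (H : GH (g x)⁻¹ (hT x)⁻¹) (ht : Trv f) (a b : Fin (m+2)) :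
    emTensor g (duWedge f) x a b = if a = 0 ∧ b = 0 then (1 / (Nat.factorial q : ℝ)) * ∑ v, f x v * raiseAll hT f x v else 0 := by
  have hF2 : ∑ v, duWedge f x v * raiseAll g (duWedge f) x v = 0 := by
    refine Finset.sum_eq_zero fun v _ => ?_
    by_cases h : ∃ i, (v i : ℕ) = 0
    · obtain ⟨i, h⟩ := h
      rw [raise_has0 H ht v i h, mul_zero]
    · push Not at h
      rw [duW_no0 x v h, zero_mul]
  have hin0 : ∀ (v : Fin q → Fin (m+2)) i, (v i : ℕ) = 0 → ∑ w : Fin q → Fin (m+2), (∏ i, (g x)⁻¹ (v i) (w i)) * duWedge f x (Fin.cons b w) = 0 := by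
    intro v i hv
    refine Finset.sum_eq_zero fun w _ => ?_
    by_cases hw : (w i : ℕ) = 1
    · rw [duW_one ht x _ i.succ (by simpa using hw), mul_zero]
    · rw [Finset.prod_eq_zero (Finset.mem_univ i) (by rw [v0 hv]; exact H.zb _ hw), zero_mul]
  have cons_ne : ∀ (c : Fin (m+2)) (v : Fin q → Fin (m+2)), c ≠ 0 → (∀ i, (v i : ℕ) ≠ 0) → duWedge f x (Fin.cons c v) = 0 := by
    intro c v hc hv
    exact duW_no0 x _ (Fin.cases (by simpa using fun h => hc (v0 h)) (by simpa using hv))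
  unfold emTensor
  rw [hF2, mul_zero, sub_zero]
  by_cases ha : a = 0
  swap
  · rw [if_neg (fun h => ha h.1), Finset.sum_eq_zero, mul_zero]
    intro v _
    by_cases h : ∃ i, (v i : ℕ) = 0
    · obtain ⟨i, h⟩ := h
      rw [hin0 v i h, mul_zero]
    · push Not at h
      rw [cons_ne a v ha h, zero_mul]
  subst ha
  by_cases hb : b = 0
  · subst hb
    rw [if_pos ⟨rfl, rfl⟩]
    congr 1
    refine Finset.sum_congr rfl fun v _ => ?_
    simp only [duW_cons ht]
    by_cases h : ∃ i, (v i : ℕ) < 2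
    · rw [ht x v h]; ring
    · push Not at h
      rw [raise_f H ht v h]
  · rw [if_neg (fun h => hb h.2), Finset.sum_eq_zero, mul_zero]
    intro v _
    rw [duW_cons ht]
    by_cases h : ∃ i, (v i : ℕ) < 2
    · rw [ht x v h]; ring
    · push Not at h
      rw [Finset.sum_eq_zero, mul_zero]
      intro w _
      by_cases hw : ∃ i, (w i : ℕ) = 0
      · obtain ⟨i, hw⟩ := hw
        rw [Finset.prod_eq_zero (Finset.mem_univ i) (by rw [v0 hw]; exact H.a0 _ (by have := h i; omega)), zero_mul]
      · push Not at hw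
        rw [cons_ne b w hb hw, mul_zero]

lemma metric_symm (hD : D.Regular) (x : Pt (m+2)) (a b) : D.metric x a b = D.metric x b a := by
  rw [metric_ev hD, metric_ev hD, (cK hD).full.gs]

lemma tr_metric (hD : D.Regular) (x : Pt (m+2)) : ∑ b, ∑ d, (D.metric x)⁻¹ b d * D.metric x b d = (m:ℝ) + 2 := by
  have h : (D.metric x)⁻¹ * D.metric x = 1 := Matrix.nonsing_inv_mul _ (by
    rw [det_metric hD]; exact (neg_ne_zero.2 (det_pos hD x).ne').isUnit)
  have h2 := congrArg Matrix.trace h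
  rw [Matrix.trace_one] at h2
  simp only [Matrix.trace, Matrix.diag, Matrix.mul_apply] at h2
  rw [show ∑ b, ∑ d, (D.metric x)⁻¹ b d * D.metric x b d = ∑ b, ∑ d, (D.metric x)⁻¹ b d * D.metric x d b from
    Finset.sum_congr rfl fun b _ => Finset.sum_congr rfl fun d _ => by rw [metric_symm hD x b d]]
  rw [h2]; simp

lemma einstein_iff (hD : D.Regular) (hm : m ≠ 0) (Λ : ℝ) (t : ℝ) (x : Pt (m+2)) :
    (∀ a b, ricci D.metric x a b - (1/2) * ricciScalar D.metric x * D.metric x a b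
          + Λ * D.metric x a b = if a = 0 ∧ b = 0 then t else 0) ↔
    (∀ a b, ricci D.metric x a b = 2 * Λ / m * D.metric x a b + if a = 0 ∧ b = 0 then t else 0) := by
  have hm' : (m:ℝ) ≠ 0 := by exact_mod_cast hm
  have g00 : (D.metric x)⁻¹ 0 0 = 0 := (gh hD x).a0 0 (by simp)
  have hT : ∑ b, ∑ d, (D.metric x)⁻¹ b d * (if b = 0 ∧ d = 0 then t else 0) = 0 := by
    refine Finset.sum_eq_zero fun b _ => Finset.sum_eq_zero fun d _ => ?_
    split_ifs with h
    · rw [h.1, h.2, g00, zero_mul]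
    · rw [mul_zero]
  have tr : ∀ c : ℝ, (∀ a b, ricci D.metric x a b = c * D.metric x a b + if a = 0 ∧ b = 0 then t else 0) →
      ricciScalar D.metric x = c * (m + 2) := by
    intro c h
    unfold ricciScalar
    simp only [h, mul_add, Finset.sum_add_distrib, hT]
    rw [← mul_add, ← tr_metric hD x, Finset.mul_sum, add_zero]
    refine Finset.sum_congr rfl fun b _ => ?_
    rw [Finset.mul_sum]
    refine Finset.sum_congr rfl fun d _ => ?_
    ring
  constructor
  · intro h
    have h1 : ∀ a b, ricci D.metric x a b = ((1/2) * ricciScalar D.metric x - Λ) * D.metric x a b + if a = 0 ∧ b = 0 then t else 0 := by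
      intro a b
      linear_combination h a b
    have h2 := tr _ h1
    have h3 : ((1/2) * ricciScalar D.metric x - Λ) = 2 * Λ / m := by
      rw [eq_div_iff hm']; linear_combination -h2
    rw [h3] at h1
    exact h1
  · intro h a b
    have h2 := tr _ h
    have h3 : ((1/2) * ricciScalar D.metric x - Λ) = 2 * Λ / m := by
      rw [h2]; field_simp; ring
    rw [h a b]
    linear_combination (-D.metric x a b) * h3

lemma einstein_main (hD : D.Regular) (hm : m ≠ 0) (Λ lam : ℝ) (hl : lam = 2*Λ/m) (τ : Sm (m+2)) (hτ : pdD 1 τ = 0) :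
    (∀ x a b, ricci D.metric x a b - (1/2) * ricciScalar D.metric x * D.metric x a b
          + Λ * D.metric x a b = if a = 0 ∧ b = 0 then ev x τ else 0) ↔
    (E1 (A := Sm (m+2)) (m := m) pdD (cH hD) (cHi hD) (cW1 hD) lam ∧ E2 (A := Sm (m+2)) (m := m) pdD (cH hD) (cHi hD) (cW1 hD) (cH2 hD) lam ∧ E3 (A := Sm (m+2)) (m := m) pdD (cH hD) (cHi hD) (cW1 hD) lam ∧
     (∀ a : Fin m, E4 (A := Sm (m+2)) (m := m) pdD (cH hD) (cHi hD) (cW1 hD) (cW0 hD) (cH1 hD) (cL hD) lam a) ∧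
      E5 (A := Sm (m+2)) (m := m) pdD (cH hD) (cHi hD) (cW1 hD) (cW0 hD) (cH0 hD) (cH1 hD) (cL hD) τ lam) := by
  have hE := fun x => einstein_iff hD hm Λ (ev x τ) x
  rw [← hl] at hE
  refine Iff.trans (forall_congr' hE) (Iff.trans ?_ ((cK hD).main (cP hD) lam τ hτ))
  constructor
  · intro h a b
    refine ev_ext fun x => ?_
    have := h x a b
    rw [ricci_kG hD, metric_ev hD] at this
    rw [this, map_add, map_smul, smul_eq_mul, apply_ite (ev x), map_zero]
  · intro h x a b
    have := congrArg (ev x) (h a b)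
    rw [map_add, map_smul, smul_eq_mul, apply_ite (ev x), map_zero] at this
    rw [ricci_kG hD, metric_ev hD, this]
end Ein

/-- a degenerate Kundt metric with an aligned VSI Maxwell `p`-form
`F = du ∧ f` solves the Einstein–Maxwell equations with cosmological constant `Λ` iff
`f` solves the transverse Maxwell equations and the metric functions satisfy the
reduced equations (i)–(v). -/
theorem einstein_maxwell_kundt {n q s : ℕ} [NeZero n] [NeZero q]
    (hn : (q+1) + (s+1) = n) (Λ κ₀ : ℝ)
    (D : DegKundtData n) (hD : D.Regular)
    (f : TensorField n q) (hf_sm : IsSmoothT f) (hf_alt : IsAlternating f)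
    (hf_tr : ∀ (x : Pt n) (v : Fin q → Fin n), (∃ i, (v i : ℕ) < 2) → f x v = 0)
    (hf_r : IndepOfR f) :
    ((∀ (x : Pt n) (a b : Fin n),
        ricci D.metric x a b - (1/2) * ricciScalar D.metric x * D.metric x a b
          + Λ * D.metric x a b = κ₀ * emTensor D.metric (duWedge f) x a b) ∧
      MaxwellEqs hn D.metric (duWedge f))
    ↔
    (TransClosed f ∧ TransCoclosed D.hT f ∧
      (∀ (x : Pt n) (a b : Fin n), 2 ≤ (a : ℕ) → 2 ≤ (b : ℕ) →
        ricciT D.hT x a b = 2 * Λ / ((n : ℝ) - 2) * D.hT x a b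
          + (1/2) * D.W1 x a * D.W1 x b
          - (1/2) * (nablaT D.hT (oneForm D.W1) x b a + nablaT D.hT (oneForm D.W1) x a b)) ∧
      (∀ x : Pt n, 2 * D.H2 x = ricciScalarT D.hT x / 2 - ((n : ℝ) - 4) / ((n : ℝ) - 2) * Λ
          + (1/4) * ∑ a, ∑ b, (D.hT x)⁻¹ a b * D.W1 x a * D.W1 x b) ∧
      (∀ (x : Pt n) (a : Fin n), 2 ≤ (a : ℕ) →
        (∑ b, ∑ c, (D.hT x)⁻¹ b c * nablaT2 D.hT (oneForm D.W1) x c b a)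
          = (1/2) * (∑ b, ∑ c, (D.hT x)⁻¹ b c * D.W1 x c *
                (3 * nablaT D.hT (oneForm D.W1) x b a - nablaT D.hT (oneForm D.W1) x a b))
            + D.W1 x a * (divT D.hT (oneForm D.W1) x
                - (1/2) * (∑ b, ∑ c, (D.hT x)⁻¹ b c * D.W1 x b * D.W1 x c)
                - 2 * Λ / ((n : ℝ) - 2))) ∧
      (∀ (x : Pt n) (a : Fin n), 2 ≤ (a : ℕ) →
        2 * pd D.H1 a x =
          - (∑ b, ∑ c, (D.hT x)⁻¹ b c *
              covDT D.hT (fun y idx => pd (fun z => D.hT z (idx 0) (idx 1)) 0 y) x ![c, a, b])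
          + (∑ b, ∑ c, (D.hT x)⁻¹ b c *
              (nablaT2 D.hT (oneForm D.W0) x c b a - nablaT2 D.hT (oneForm D.W0) x c a b))
          - 2 * (∑ b, ∑ c, (D.hT x)⁻¹ b c * D.W0 x c * nablaT D.hT (oneForm D.W1) x b a)
          + pd (fun y => ∑ b, ∑ c, (D.hT y)⁻¹ b c * D.W0 y b * D.W1 y c) a x
          + pd (fun y => D.W1 y a) 0 x
          + 2 * pd (fun y => pd (lnSqrtDet D.hT) 0 y) a x
          + D.W1 x a * ((∑ b, ∑ c, (D.hT x)⁻¹ b c * D.W0 x b * D.W1 x c)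
              - divT D.hT (oneForm D.W0) x + pd (lnSqrtDet D.hT) 0 x)
          + 4 * Λ / ((n : ℝ) - 2) * D.W0 x a) ∧
      (∀ x : Pt n,
        laplaceT D.hT D.H0 x
          + (∑ b, ∑ c, (D.hT x)⁻¹ b c * D.W1 x b * pd D.H0 c x)
          + divT D.hT (oneForm D.W1) x * D.H0 x
        = (∑ b, ∑ c, (D.hT x)⁻¹ b c * D.W0 x b * D.W0 x c) *
            ((1/2) * divT D.hT (oneForm D.W1) x - 2 * Λ / ((n : ℝ) - 2))
          + D.H1 x * (divT D.hT (oneForm D.W0) x - pd (lnSqrtDet D.hT) 0 x)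
          - (1/2) * (∑ b, ∑ c, (D.hT x)⁻¹ b c * D.W0 x b * D.W1 x c)^2
          + (∑ a, ∑ b, ∑ c, ∑ d, (D.hT x)⁻¹ a c * (D.hT x)⁻¹ b d *
              ((1/2) * (nablaT D.hT (oneForm D.W0) x b a - nablaT D.hT (oneForm D.W0) x a b)) *
              ((1/2) * (nablaT D.hT (oneForm D.W0) x d c - nablaT D.hT (oneForm D.W0) x c d)))
          + (∑ a, ∑ b, (D.hT x)⁻¹ a b *
              covDT D.hT (fun y idx => pd (fun z => D.W0 z (idx 0)) 0 y) x ![b, a])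
          - (∑ b, ∑ c, (D.hT x)⁻¹ b c * D.W0 x c *
              (2 * (∑ a, ∑ d, (D.hT x)⁻¹ a d * D.W1 x d *
                  ((1/2) * (nablaT D.hT (oneForm D.W0) x b a - nablaT D.hT (oneForm D.W0) x a b)))
                + pd (fun y => D.W1 y b) 0 x - 2 * pd D.H1 b x))
          - pd (fun y => pd (lnSqrtDet D.hT) 0 y) 0 x
          + (1/4) * (∑ a, ∑ b, pd (fun y => (D.hT y)⁻¹ a b) 0 x * pd (fun y => D.hT y a b) 0 x)
          - κ₀ * ((1 / (Nat.factorial q : ℝ)) *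
              ∑ v : Fin q → Fin n, f x v * raiseAll D.hT f x v))) := by
  have ht : Trv f := hf_tr
  obtain ⟨m, rfl⟩ : ∃ m, n = m + 2 := ⟨q + s, by omega⟩
  have hm : m ≠ 0 := by have := NeZero.ne q; omega
  have hm' : (m:ℝ) ≠ 0 := by exact_mod_cast hm
  have hcast : ((m + 2 : ℕ) : ℝ) - 2 = m := by push_cast; ring
  have hcast4 : ((m + 2 : ℕ) : ℝ) - 4 = m - 2 := by push_cast; ring
  have hts : ContDiff ℝ (⊤ : ℕ∞) (fun x => κ₀ * ((1 / (Nat.factorial q : ℝ)) *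
      ∑ v : Fin q → Fin (m+2), f x v * raiseAll D.hT f x v)) :=
    contDiff_const.mul (contDiff_const.mul (ContDiff.sum fun v _ => (hf_sm v).mul (sm_raise (sm_hTi hD) hf_sm v)))
  let τ : Sm (m+2) := ⟨_, mem_Sm hts⟩
  have hτ : pdD 1 τ = 0 := by
    refine indep_pd one_val τ fun x y h => ?_
    show κ₀ * _ = κ₀ * _
    simp only [raiseAll]
    rw [hD.1.2.2.2.1 x y h, hf_r x y h]
  have hev : ∀ x, κ₀ * ((1 / (Nat.factorial q : ℝ)) * ∑ v : Fin q → Fin (m+2), f x v * raiseAll D.hT f x v) = ev x τ := fun x => rfl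
  have hem : ∀ x a b, κ₀ * emTensor D.metric (duWedge f) x a b = if a = 0 ∧ b = 0 then ev x τ else 0 := by
    intro x a b
    rw [emT (gh hD x) ht, ← hev]
    split_ifs <;> simp
  have hE := einstein_main hD hm Λ (2 * Λ / m) rfl τ hτ
  have h1 := eq1 hD (2 * Λ / m)
  have h2 := eq2 hD (2 * Λ / m) (((m:ℝ) - 2) / m * Λ) (by field_simp)
  have h3 := eq3 hD (2 * Λ / m)
  have h4 := eq4 hD (2 * Λ / m) (4 * Λ / m) (by ring)
  have h5 := eq5 hD (2 * Λ / m) τ _ hev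
  rw [← h1, ← h2, ← h3, ← h4, ← h5] at hE
  simp only [hem]
  rw [hcast, hcast4]
  rw [MaxwellEqs, closed_iff hf_sm hf_alt ht hf_r, coclosed_iff hn hD hf_sm hf_alt ht hf_r]
  constructor
  · rintro ⟨a, b, c⟩
    exact ⟨b, c, hE.1 a⟩
  · rintro ⟨b, c, a⟩
    exact ⟨hE.2 a, b, c⟩

end VSI
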